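/- arXiv:2603.25448 — 2 statements merged into one kernel-verified Lean document; each statement's English description precedes it below -/
import Mathlib

section
/- Let $\Omega_{out}\subset\mathbb{R}^n$ be a bounded connected Lipschitz domain, $\overline{B_r}\subset\Omega_{out}$, and $\Omega_r = \Omega_{out}\setminus\overline{B_r}$. Then $\lim_{r\to 0^+}\mu_1(\Omega_r) = \sigma_1(\Omega_{out})$, where $\mu_1(\Omega_r)$ is the first nonzero Steklov--Neumann eigenvalue of $\Omega_r$ (Neumann on $\partial B_r$, Steklov on $\partial\Omega_{out}$) and $\sigma_1(\Omega_{out})$ is the first nonzero Steklov eigenvalue of $\Omega_{out}$. -/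
open Real MeasureTheory Filter

/-- First nonzero Steklov–Neumann eigenvalue of `Ω` with Steklov boundary part `Γ`
(Neumann on the rest of the boundary), via its variational characterization. Taking
`Γ = frontier Ω` gives the first nonzero classical Steklov eigenvalue. -/
noncomputable def steklovNeumannMu1 {n : ℕ} (Ω Γ : Set (EuclideanSpace ℝ (Fin n))) : ℝ :=
  sInf {t : ℝ | ∃ u : EuclideanSpace ℝ (Fin n) → ℝ, ContDiff ℝ 1 u ∧
    (∫ x in Γ, u x ∂(μH[(n : ℝ) - 1])) = 0 ∧
    (∫ x in Γ, (u x) ^ 2 ∂(μH[(n : ℝ) - 1])) ≠ 0 ∧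
    t = (∫ x in Ω, ‖fderiv ℝ u x‖ ^ 2) / ∫ x in Γ, (u x) ^ 2 ∂(μH[(n : ℝ) - 1])}

section Poincare

open Set Module Metric
open scoped ENNReal NNReal

theorem sq_lintegral_le_lintegral_sq {α : Type*} [MeasurableSpace α] {ν : Measure α}
    [IsProbabilityMeasure ν] {f : α → ℝ≥0∞} (hf : AEMeasurable f ν) :
    (∫⁻ a, f a ∂ν) ^ 2 ≤ ∫⁻ a, f a ^ 2 ∂ν := by
  have h := ENNReal.lintegral_mul_le_Lp_mul_Lq ν Real.HolderConjugate.two_two hf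
    (aemeasurable_const (b := (1 : ℝ≥0∞)))
  simp only [Pi.mul_apply, mul_one, ENNReal.one_rpow, lintegral_const, measure_univ] at h
  calc (∫⁻ a, f a ∂ν) ^ 2 ≤ ((∫⁻ a, f a ^ (2 : ℝ) ∂ν) ^ ((1 : ℝ) / 2)) ^ 2 := by gcongr
    _ = ∫⁻ a, f a ^ 2 ∂ν := by
      rw [← ENNReal.rpow_natCast, ← ENNReal.rpow_mul]
      norm_num

variable {E : Type*} [NormedAddCommGroup E] [NormedSpace ℝ E]

theorem ContDiff.measurable_enorm_fderiv_sq [MeasurableSpace E] [OpensMeasurableSpace E]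
    {u : E → ℝ} (hu : ContDiff ℝ 1 u) : Measurable fun x => ‖fderiv ℝ u x‖ₑ ^ 2 :=
  ((ENNReal.continuous_pow 2).comp (hu.continuous_fderiv one_ne_zero).enorm).measurable

theorem enorm_sub_sq_le_lintegral_segment {u : E → ℝ} (hu : ContDiff ℝ 1 u) (p q : E) :
    ‖u p - u q‖ₑ ^ 2 ≤
      ‖p - q‖ₑ ^ 2 * ∫⁻ t in Icc (0 : ℝ) 1, ‖fderiv ℝ u (q + t • (p - q))‖ₑ ^ 2 := by
  have hprob : IsProbabilityMeasure ((volume : Measure ℝ).restrict (Icc 0 1)) := ⟨by simp⟩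
  have hγ : ContDiff ℝ 1 fun t : ℝ => q + t • (p - q) := by fun_prop
  have h := enorm_sub_le_lintegral_deriv_of_contDiffOn_Icc
    (f := fun t : ℝ => u (q + t • (p - q))) (hu.comp hγ).contDiffOn zero_le_one
  simp only [one_smul, add_sub_cancel, zero_smul, add_zero] at h
  have hderiv (t : ℝ) : ‖deriv (fun t : ℝ => u (q + t • (p - q))) t‖ₑ ≤
      ‖fderiv ℝ u (q + t • (p - q))‖ₑ * ‖p - q‖ₑ := by
    have h1 : HasDerivAt (fun t : ℝ => q + t • (p - q)) (p - q) t := by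
      simpa using ((hasDerivAt_id t).smul_const (p - q)).const_add q
    have h2 := ((hu.differentiable one_ne_zero _).hasFDerivAt.comp_hasDerivAt t h1).deriv
    simp only [Function.comp_def] at h2
    rw [h2]
    exact ContinuousLinearMap.le_opENorm _ _
  have hcont : Continuous fun t : ℝ => ‖fderiv ℝ u (q + t • (p - q))‖ₑ :=
    ((hu.continuous_fderiv one_ne_zero).comp hγ.continuous).enorm
  calc ‖u p - u q‖ₑ ^ 2
      ≤ (∫⁻ t in Icc (0 : ℝ) 1, ‖fderiv ℝ u (q + t • (p - q))‖ₑ * ‖p - q‖ₑ) ^ 2 := by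
        gcongr
        exact h.trans (lintegral_mono hderiv)
    _ = ‖p - q‖ₑ ^ 2 * (∫⁻ t in Icc (0 : ℝ) 1, ‖fderiv ℝ u (q + t • (p - q))‖ₑ) ^ 2 := by
        rw [lintegral_mul_const _ hcont.measurable, mul_pow, mul_comm]
    _ ≤ _ := by
        gcongr
        exact sq_lintegral_le_lintegral_sq hcont.measurable.aemeasurable

theorem isPreconnected_ball_diff_closedBall (hE : 1 < Module.rank ℝ E) {a : ℝ} (ha : 0 ≤ a)
    (b : ℝ) : IsPreconnected (ball (0 : E) b \ closedBall 0 a) := by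
  have h : ball (0 : E) b \ closedBall 0 a =
      (fun z : ℝ × E => z.1 • z.2) '' (Ioo a b ×ˢ sphere 0 1) := by
    ext x
    simp only [Set.mem_sdiff, mem_ball_zero_iff, mem_closedBall_zero_iff, not_le, mem_image, mem_prod,
      mem_Ioo, mem_sphere_zero_iff_norm, Prod.exists]
    constructor
    · rintro ⟨h1, h2⟩
      have hx : ‖x‖ ≠ 0 := (ha.trans_lt h2).ne'
      refine ⟨‖x‖, ‖x‖⁻¹ • x, ⟨⟨h2, h1⟩, ?_⟩, ?_⟩
      · rw [norm_smul, norm_inv, norm_norm, inv_mul_cancel₀ hx]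
      · rw [smul_smul, mul_inv_cancel₀ hx, one_smul]
    · rintro ⟨t, y, ⟨⟨h1, h2⟩, h3⟩, rfl⟩
      rw [norm_smul, h3, mul_one, Real.norm_of_nonneg (ha.trans h1.le)]
      exact ⟨h2, h1⟩
  rw [h]
  exact (isPreconnected_Ioo.prod (isPreconnected_sphere hE 0 1)).image _
    (continuous_fst.smul continuous_snd).continuousOn

variable [FiniteDimensional ℝ E] [MeasurableSpace E] [BorelSpace E]
  (μ : Measure E) [μ.IsAddHaarMeasure]

theorem lintegral_comp_smul_addHaar {g : E → ℝ≥0∞} (hg : Measurable g) {s : ℝ} (hs : 0 < s) :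
    ∫⁻ x, g (s • x) ∂μ = ENNReal.ofReal ((s ^ finrank ℝ E)⁻¹) * ∫⁻ x, g x ∂μ := by
  rw [← lintegral_map hg (measurable_const_smul s), Measure.map_addHaar_smul μ hs.ne',
    lintegral_smul_measure, abs_of_pos (by positivity), smul_eq_mul]

theorem Convex.setLIntegral_comp_homothety_le {B : Set E} (hB : Convex ℝ B)
    (hBm : MeasurableSet B) {g : E → ℝ≥0∞} (hg : Measurable g) {q : E} (hq : q ∈ B)
    {s : ℝ} (hs : 1 / 2 ≤ s) (hs1 : s ≤ 1) :
    ∫⁻ p in B, g (q + s • (p - q)) ∂μ ≤ 2 ^ finrank ℝ E * ∫⁻ p in B, g p ∂μ := by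
  have hs0 : 0 < s := by linarith
  calc ∫⁻ p in B, g (q + s • (p - q)) ∂μ
      ≤ ∫⁻ p, B.indicator g (q + s • (p - q)) ∂μ := by
        rw [← lintegral_indicator hBm]
        refine lintegral_mono fun p => ?_
        by_cases hp : p ∈ B
        · have : q + s • (p - q) ∈ B := hB.add_smul_sub_mem hq hp ⟨hs0.le, hs1⟩
          simp [hp, this]
        · simp [hp]
    _ = ∫⁻ p, B.indicator g (q + s • p) ∂μ :=
        lintegral_sub_right_eq_self (fun p => B.indicator g (q + s • p)) q
    _ = ENNReal.ofReal ((s ^ finrank ℝ E)⁻¹) * ∫⁻ p in B, g p ∂μ := by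
        rw [lintegral_comp_smul_addHaar μ
          (g := fun x => B.indicator g (q + x)) ((hg.indicator hBm).comp (measurable_const_add q))
          hs0, lintegral_add_left_eq_self, lintegral_indicator hBm]
    _ ≤ _ := by
        gcongr
        rw [← inv_pow]
        refine (ENNReal.ofReal_le_ofReal (pow_le_pow_left₀ (by positivity)
          (inv_anti₀ (by norm_num) hs) _)).trans (by simp)

theorem Convex.lintegral_lintegral_enorm_sub_sq_le {B : Set E} (hB : Convex ℝ B)
    (hBm : MeasurableSet B) {u : E → ℝ} (hu : ContDiff ℝ 1 u) :
    ∫⁻ p in B, ∫⁻ q in B, ‖u p - u q‖ₑ ^ 2 ∂μ ∂μ ≤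
      ediam B ^ 2 * (2 ^ finrank ℝ E * μ B) * ∫⁻ x in B, ‖fderiv ℝ u x‖ₑ ^ 2 ∂μ := by
  set g : E → ℝ≥0∞ := fun x => ‖fderiv ℝ u x‖ₑ ^ 2
  have hgc : Continuous g := (ENNReal.continuous_pow 2).comp (hu.continuous_fderiv one_ne_zero).enorm
  have hg : Measurable g := hgc.measurable
  have key (t : ℝ) (ht : t ∈ Icc (0 : ℝ) 1) :
      ∫⁻ p in B, ∫⁻ q in B, g (q + t • (p - q)) ∂μ ∂μ ≤
        2 ^ finrank ℝ E * μ B * ∫⁻ x in B, g x ∂μ := by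
    rcases le_total (1 / 2) t with h | h
    · rw [lintegral_lintegral_swap (by
        apply Continuous.aemeasurable; unfold Function.uncurry; fun_prop)]
      calc _ ≤ ∫⁻ _ in B, 2 ^ finrank ℝ E * ∫⁻ p in B, g p ∂μ ∂μ :=
            setLIntegral_mono' hBm fun q hq =>
              hB.setLIntegral_comp_homothety_le μ hBm hg hq h ht.2
        _ = _ := by rw [setLIntegral_const]; ring
    · calc _ ≤ ∫⁻ _ in B, 2 ^ finrank ℝ E * ∫⁻ p in B, g p ∂μ ∂μ := by
            refine setLIntegral_mono' hBm fun p hp => ?_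
            have := hB.setLIntegral_comp_homothety_le μ hBm hg hp
              (s := 1 - t) (by linarith) (by linarith [ht.1])
            convert this using 4 with q
            module
        _ = _ := by rw [setLIntegral_const]; ring
  calc ∫⁻ p in B, ∫⁻ q in B, ‖u p - u q‖ₑ ^ 2 ∂μ ∂μ
      ≤ ∫⁻ p in B, ∫⁻ q in B, ediam B ^ 2 *
          (∫⁻ t in Icc (0 : ℝ) 1, g (q + t • (p - q))) ∂μ ∂μ := by
        refine setLIntegral_mono' hBm fun p hp => setLIntegral_mono' hBm fun q hq => ?_
        refine (enorm_sub_sq_le_lintegral_segment hu p q).trans ?_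
        gcongr
        rw [← edist_eq_enorm_sub]
        exact edist_le_ediam_of_mem hp hq
    _ = ediam B ^ 2 * ∫⁻ t in Icc (0 : ℝ) 1, ∫⁻ p in B, ∫⁻ q in B, g (q + t • (p - q)) ∂μ ∂μ := by
        have hF : Continuous fun z : (E × ℝ) × E => g (z.2 + z.1.2 • (z.1.1 - z.2)) := by fun_prop
        have hI : Measurable fun z : E × ℝ => ∫⁻ q in B, g (q + z.2 • (z.1 - q)) ∂μ :=
          hF.measurable.lintegral_prod_right'
        have hJ (p : E) : ∫⁻ q in B, ediam B ^ 2 *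
            (∫⁻ t in Icc (0 : ℝ) 1, g (q + t • (p - q))) ∂μ =
            ediam B ^ 2 * ∫⁻ t in Icc (0 : ℝ) 1, ∫⁻ q in B, g (q + t • (p - q)) ∂μ := by
          have hG : Continuous fun z : E × ℝ => g (z.1 + z.2 • (p - z.1)) := by fun_prop
          rw [lintegral_const_mul _ hG.measurable.lintegral_prod_right',
            lintegral_lintegral_swap hG.measurable.aemeasurable]
        simp_rw [hJ]
        rw [lintegral_const_mul _ hI.lintegral_prod_right',
          lintegral_lintegral_swap hI.aemeasurable]
    _ ≤ ediam B ^ 2 * ∫⁻ t in Icc (0 : ℝ) 1, 2 ^ finrank ℝ E * μ B * ∫⁻ x in B, g x ∂μ := by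
        gcongr _ * ?_
        exact setLIntegral_mono' measurableSet_Icc key
    _ = _ := by simp [mul_assoc]

theorem ENNReal.add_sq_le_two_mul_sq_add (a b : ℝ≥0∞) : (a + b) ^ 2 ≤ 2 * a ^ 2 + 2 * b ^ 2 := by
  have := ENNReal.rpow_add_le_mul_rpow_add_rpow a b one_le_two
  norm_num at this
  rwa [mul_add] at this

theorem enorm_sub_sq_le_two_mul (a b c : ℝ) :
    ‖a - c‖ₑ ^ 2 ≤ 2 * ‖a - b‖ₑ ^ 2 + 2 * ‖b - c‖ₑ ^ 2 := by
  refine le_trans ?_ (ENNReal.add_sq_le_two_mul_sq_add _ _)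
  gcongr
  simp only [← edist_eq_enorm_sub]
  exact edist_triangle a b c

theorem measure_mul_setLIntegral_enorm_sub_sq_le {B D : Set E} (hB : Convex ℝ B)
    (hBm : MeasurableSet B) (hDB : D ⊆ B) {u : E → ℝ} (hu : ContDiff ℝ 1 u) (c : ℝ) :
    μ D * ∫⁻ x in B, ‖u x - c‖ₑ ^ 2 ∂μ ≤
      2 * (ediam B ^ 2 * (2 ^ finrank ℝ E * μ B) * ∫⁻ x in B, ‖fderiv ℝ u x‖ₑ ^ 2 ∂μ) +
        2 * (μ B * ∫⁻ x in D, ‖u x - c‖ₑ ^ 2 ∂μ) := by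
  have huc := hu.continuous
  have h1 (p : E) : Continuous fun q => ‖u p - u q‖ₑ ^ 2 :=
    (ENNReal.continuous_pow 2).comp (by fun_prop)
  have h2 : Continuous fun q => ‖u q - c‖ₑ ^ 2 := (ENNReal.continuous_pow 2).comp (by fun_prop)
  have h3 : Continuous fun z : E × E => ‖u z.1 - u z.2‖ₑ ^ 2 :=
    (ENNReal.continuous_pow 2).comp (by fun_prop)
  calc μ D * ∫⁻ x in B, ‖u x - c‖ₑ ^ 2 ∂μ
      = ∫⁻ p in B, ∫⁻ _ in D, ‖u p - c‖ₑ ^ 2 ∂μ ∂μ := by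
        simp only [setLIntegral_const]
        rw [lintegral_mul_const _ h2.measurable, mul_comm]
    _ ≤ ∫⁻ p in B, ∫⁻ q in D, (2 * ‖u p - u q‖ₑ ^ 2 + 2 * ‖u q - c‖ₑ ^ 2) ∂μ ∂μ :=
        lintegral_mono fun p => lintegral_mono fun q => enorm_sub_sq_le_two_mul _ _ _
    _ = ∫⁻ p in B, (2 * ∫⁻ q in D, ‖u p - u q‖ₑ ^ 2 ∂μ + 2 * ∫⁻ q in D, ‖u q - c‖ₑ ^ 2 ∂μ) ∂μ := by
        refine lintegral_congr fun p => ?_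
        rw [lintegral_add_left ((h1 p).measurable.const_mul 2),
          lintegral_const_mul _ (h1 p).measurable, lintegral_const_mul _ h2.measurable]
    _ = 2 * ∫⁻ p in B, ∫⁻ q in D, ‖u p - u q‖ₑ ^ 2 ∂μ ∂μ +
          2 * (μ B * ∫⁻ q in D, ‖u q - c‖ₑ ^ 2 ∂μ) := by
        rw [lintegral_add_right _ measurable_const, setLIntegral_const,
          lintegral_const_mul _ h3.measurable.lintegral_prod_right']
        ring
    _ ≤ 2 * ∫⁻ p in B, ∫⁻ q in B, ‖u p - u q‖ₑ ^ 2 ∂μ ∂μ +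
          2 * (μ B * ∫⁻ q in D, ‖u q - c‖ₑ ^ 2 ∂μ) := by
        gcongr
    _ ≤ _ := by
        gcongr
        exact hB.lintegral_lintegral_enorm_sub_sq_le μ hBm hu

theorem exists_setLIntegral_ball_enorm_sub_sq_le (x : E) (r : ℝ) {D : Set E}
    (hD : IsOpen D) (hDx : (ball x r ∩ D).Nonempty) :
    ∃ C : ℝ≥0∞, C ≠ ∞ ∧ ∀ u : E → ℝ, ContDiff ℝ 1 u → ∀ c : ℝ,
      ∫⁻ y in ball x r, ‖u y - c‖ₑ ^ 2 ∂μ ≤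
        C * (∫⁻ y in ball x r, ‖fderiv ℝ u y‖ₑ ^ 2 ∂μ + ∫⁻ y in D, ‖u y - c‖ₑ ^ 2 ∂μ) := by
  set B := ball x r
  set m := μ (B ∩ D)
  have hm0 : m ≠ 0 := ((isOpen_ball.inter hD).measure_pos μ hDx).ne'
  have hBt : μ B ≠ ∞ := measure_ball_lt_top.ne
  have hmt : m ≠ ∞ := measure_ne_top_of_subset inter_subset_left hBt
  have hdiam : ediam B ≠ ∞ := isBounded_ball.ediam_ne_top
  set a := 2 * (ediam B ^ 2 * (2 ^ finrank ℝ E * μ B))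
  set b := 2 * μ B
  have ha : a ≠ ∞ := by finiteness
  have hb : b ≠ ∞ := by finiteness
  refine ⟨m⁻¹ * (a + b), by finiteness, fun u hu c => ?_⟩
  have h := measure_mul_setLIntegral_enorm_sub_sq_le μ (convex_ball x r) measurableSet_ball
    (inter_subset_left (t := D)) hu c
  set I := ∫⁻ y in B, ‖u y - c‖ₑ ^ 2 ∂μ
  set G := ∫⁻ y in B, ‖fderiv ℝ u y‖ₑ ^ 2 ∂μ
  set J := ∫⁻ y in D, ‖u y - c‖ₑ ^ 2 ∂μ
  have hJ : ∫⁻ y in B ∩ D, ‖u y - c‖ₑ ^ 2 ∂μ ≤ J := lintegral_mono_set inter_subset_right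
  calc I = m⁻¹ * (m * I) := by rw [← mul_assoc, ENNReal.inv_mul_cancel hm0 hmt, one_mul]
    _ ≤ m⁻¹ * (a * G + b * J) := by
        gcongr
        refine h.trans ?_
        simp only [a, b, mul_assoc]
        gcongr
    _ ≤ m⁻¹ * ((a + b) * (G + J)) := by
        gcongr
        rw [add_mul]
        gcongr
        · exact le_self_add
        · exact le_add_self
    _ = _ := by ring

theorem exists_setLIntegral_ball_enorm_sub_apply_sq_le (x : E) {r : ℝ} (hr : 0 < r) :
    ∃ C : ℝ≥0∞, C ≠ ∞ ∧ ∀ u : E → ℝ, ContDiff ℝ 1 u → ∃ c : ℝ,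
      ∫⁻ y in ball x r, ‖u y - c‖ₑ ^ 2 ∂μ ≤ C * ∫⁻ y in ball x r, ‖fderiv ℝ u y‖ₑ ^ 2 ∂μ := by
  set B := ball x r
  have hm0 : μ B ≠ 0 := (measure_ball_pos μ x hr).ne'
  have hBt : μ B ≠ ∞ := measure_ball_lt_top.ne
  have hdiam : ediam B ≠ ∞ := isBounded_ball.ediam_ne_top
  refine ⟨(μ B)⁻¹ * (ediam B ^ 2 * (2 ^ finrank ℝ E * μ B)), by finiteness, fun u hu => ?_⟩
  have h := (convex_ball x r).lintegral_lintegral_enorm_sub_sq_le μ measurableSet_ball hu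
  have huc := hu.continuous
  have h3 : Continuous fun z : E × E => ‖u z.1 - u z.2‖ₑ ^ 2 :=
    (ENNReal.continuous_pow 2).comp (by fun_prop)
  obtain ⟨q, -, hq⟩ := exists_le_setLAverage hm0 hBt
    (h3.measurable.lintegral_prod_right' (ν := μ.restrict B)).aemeasurable
  refine ⟨u q, ?_⟩
  simp only [← edist_eq_enorm_sub, edist_comm _ (u q)] at h hq ⊢
  refine hq.trans ?_
  rw [setLAverage_eq, ENNReal.div_eq_inv_mul, mul_assoc]
  gcongr

/-- **Poincaré inequality** on a compact subset of a connected open set. -/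
theorem IsPreconnected.exists_setLIntegral_enorm_sub_sq_le {A K : Set E} (hA : IsPreconnected A)
    (hAo : IsOpen A) (hK : IsCompact K) (hKA : K ⊆ A) :
    ∃ C : ℝ≥0∞, C ≠ ∞ ∧ ∀ u : E → ℝ, ContDiff ℝ 1 u → ∃ c : ℝ,
      ∫⁻ y in K, ‖u y - c‖ₑ ^ 2 ∂μ ≤ C * ∫⁻ y in A, ‖fderiv ℝ u y‖ₑ ^ 2 ∂μ := by
  rcases A.eq_empty_or_nonempty with rfl | ⟨x₀, hx₀⟩
  · exact ⟨0, by simp, fun u _ => ⟨0, by simp [subset_empty_iff.1 hKA]⟩⟩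
  obtain ⟨r₀, hr₀, hB₀⟩ := Metric.isOpen_iff.1 hAo x₀ hx₀
  obtain ⟨C₀, hC₀, h₀⟩ := exists_setLIntegral_ball_enorm_sub_apply_sq_le μ x₀ hr₀
  choose! c hc using h₀
  let P : Set E → Prop := fun S => ∃ C : ℝ≥0∞, C ≠ ∞ ∧ ∀ u : E → ℝ, ContDiff ℝ 1 u →
    ∫⁻ y in S, ‖u y - c u‖ₑ ^ 2 ∂μ ≤ C * ∫⁻ y in A, ‖fderiv ℝ u y‖ₑ ^ 2 ∂μ
  have hmono {S T : Set E} (hST : S ⊆ T) (hT : P T) : P S := by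
    obtain ⟨C, hC, h⟩ := hT
    exact ⟨C, hC, fun u hu => (lintegral_mono_set hST).trans (h u hu)⟩
  let U : Set E := {x | ∃ r > 0, P (ball x r)}
  have hU : IsOpen U := by
    refine Metric.isOpen_iff.2 fun x ⟨r, hr, hx⟩ => ⟨r, hr, fun y hy => ?_⟩
    exact ⟨r - dist y x, sub_pos.2 hy, hmono (ball_subset_ball' (by simp)) hx⟩
  have hAU : A ⊆ U := by
    refine hA.subset_of_closure_inter_subset hU ⟨x₀, hx₀, r₀, hr₀, C₀, hC₀, fun u hu => ?_⟩ ?_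
    · refine (hc u hu).trans ?_
      gcongr
    · rintro x ⟨hx, hxA⟩
      obtain ⟨r, hr, hxr⟩ := Metric.isOpen_iff.1 hAo x hxA
      obtain ⟨y, ⟨s, hs, C, hC, hy⟩, hyx⟩ := Metric.mem_closure_iff.1 hx r hr
      obtain ⟨C', hC', h'⟩ := exists_setLIntegral_ball_enorm_sub_sq_le μ x r
        (isOpen_ball (x := y) (ε := s)) ⟨y, by rwa [mem_ball'], mem_ball_self hs⟩
      refine ⟨r, hr, C' * (1 + C), by finiteness, fun u hu => (h' u hu _).trans ?_⟩
      rw [mul_assoc, add_mul, one_mul]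
      gcongr
      exact hy u hu
  obtain ⟨C, hC, h⟩ : P K := by
    refine hK.induction_on (p := P) ⟨0, by simp, fun u _ => by simp⟩ (fun S T hST => hmono hST)
      ?_ fun x hx => ?_
    · rintro S T ⟨C, hC, hS⟩ ⟨C', hC', hT⟩
      refine ⟨C + C', by finiteness, fun u hu => (lintegral_union_le _ _ _).trans ?_⟩
      rw [add_mul]
      exact add_le_add (hS u hu) (hT u hu)
    · obtain ⟨r, hr, hx⟩ := hAU (hKA hx)
      exact ⟨ball x r, mem_nhdsWithin_of_mem_nhds (ball_mem_nhds x hr), hx⟩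
  exact ⟨C, hC, fun u hu => ⟨c u, h u hu⟩⟩

theorem exists_extension_energy_le (hE : 1 < Module.rank ℝ E) :
    ∃ C : ℝ≥0∞, C ≠ ∞ ∧ ∀ u : E → ℝ, ContDiff ℝ 1 u → ∃ v : E → ℝ, ContDiff ℝ 1 v ∧
      (∀ x ∉ closedBall (0 : E) 3, v x = u x) ∧
      ∫⁻ x in ball 0 4, ‖fderiv ℝ v x‖ₑ ^ 2 ∂μ ≤
        C * ∫⁻ x in ball 0 4 \ closedBall 0 1, ‖fderiv ℝ u x‖ₑ ^ 2 ∂μ := by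
  set A : Set E := ball 0 4 \ closedBall 0 1
  set K : Set E := closedBall 0 3 \ ball 0 2
  have hKA : K ⊆ A := fun x hx => by
    simp only [A, K, Set.mem_sdiff, mem_ball_zero_iff, mem_closedBall_zero_iff, not_lt, not_le] at hx ⊢
    constructor <;> linarith
  have hAo : IsOpen A := isOpen_ball.sdiff isClosed_closedBall
  have hKc : IsCompact K := (isCompact_closedBall 0 3).diff isOpen_ball
  obtain ⟨C, hC, hpoinc⟩ := (isPreconnected_ball_diff_closedBall hE zero_le_one
    4).exists_setLIntegral_enorm_sub_sq_le μ hAo hKc hKA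
  let f : ContDiffBump (0 : E) := ⟨2, 3, by norm_num, by norm_num⟩
  have hf : ContDiff ℝ 1 f := f.contDiff
  obtain ⟨M, hM⟩ := (hf.continuous_fderiv one_ne_zero).bounded_above_of_compact_support
    (f.hasCompactSupport.fderiv ℝ)
  have hM' (x : E) : ‖fderiv ℝ f x‖ₑ ≤ ENNReal.ofReal M := by
    rw [← ofReal_norm]
    exact ENNReal.ofReal_le_ofReal (hM x)
  refine ⟨2 + 2 * (ENNReal.ofReal M ^ 2 * C), by finiteness, fun u hu => ?_⟩
  obtain ⟨c, hc⟩ := hpoinc u hu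
  have hv : ContDiff ℝ 1 fun x => u x - f x * (u x - c) := by fun_prop
  refine ⟨fun x => u x - f x * (u x - c), hv, fun x hx => ?_, ?_⟩
  · have : f x = 0 := f.zero_of_le_dist (by
      rw [mem_closedBall, not_le] at hx
      exact hx.le)
    simp [this]
  set v : E → ℝ := fun x => u x - f x * (u x - c)
  have hball : ∀ x ∈ ball (0 : E) 2, fderiv ℝ v x = 0 ∧ fderiv ℝ f x = 0 := by
    intro x hx
    have h1 : f =ᶠ[nhds x] fun _ => 1 := by
      filter_upwards [isOpen_ball.mem_nhds hx] with y hy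
      exact f.one_of_mem_closedBall (ball_subset_closedBall hy)
    have h2 : v =ᶠ[nhds x] fun _ => c := by
      filter_upwards [h1] with y hy
      simp [v, hy]
    exact ⟨by rw [h2.fderiv_eq]; simp, by rw [h1.fderiv_eq]; simp⟩
  have hout : ∀ x ∉ closedBall (0 : E) 3, fderiv ℝ f x = 0 := by
    intro x hx
    have h1 : f =ᶠ[nhds x] fun _ => 0 := by
      filter_upwards [isClosed_closedBall.isOpen_compl.mem_nhds hx] with y hy
      rw [mem_compl_iff, mem_closedBall, not_le] at hy
      exact f.zero_of_le_dist hy.le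
    rw [h1.fderiv_eq]; simp
  have hpt (x : E) : ‖fderiv ℝ v x‖ₑ ^ 2 ≤ 2 * ‖fderiv ℝ u x‖ₑ ^ 2 +
      2 * (ENNReal.ofReal M ^ 2 * K.indicator (fun x => ‖u x - c‖ₑ ^ 2) x) := by
    have hud := hu.differentiable one_ne_zero x
    have hfd := hf.differentiable one_ne_zero x
    have hfv : fderiv ℝ v x =
        (1 - f x) • fderiv ℝ u x - (u x - c) • fderiv ℝ f x := by
      have := (hud.hasFDerivAt.sub (hfd.hasFDerivAt.mul (hud.hasFDerivAt.sub_const c))).fderiv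
      refine Eq.trans this ?_
      module
    have h0 : ‖(u x - c) • fderiv ℝ f x‖ₑ ^ 2 ≤
        ENNReal.ofReal M ^ 2 * K.indicator (fun x => ‖u x - c‖ₑ ^ 2) x := by
      by_cases hx : x ∈ K
      · rw [indicator_of_mem hx, enorm_smul, mul_pow, mul_comm]
        gcongr
        exact hM' x
      · have : fderiv ℝ f x = 0 := by
          by_cases h3 : x ∈ closedBall (0 : E) 3
          · exact (hball x (by_contra fun h => hx ⟨h3, h⟩)).2
          · exact hout x h3
        simp [this, ← ofReal_norm]
    have h1 : ‖(1 - f x) • fderiv ℝ u x‖ₑ ≤ ‖fderiv ℝ u x‖ₑ := by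
      rw [enorm_smul]
      refine mul_le_of_le_one_left' ?_
      rw [← ofReal_norm, ENNReal.ofReal_le_one, Real.norm_eq_abs, abs_le]
      constructor <;> linarith [f.nonneg (x := x), f.le_one (x := x)]
    calc ‖fderiv ℝ v x‖ₑ ^ 2
        ≤ (‖(1 - f x) • fderiv ℝ u x‖ₑ + ‖(u x - c) • fderiv ℝ f x‖ₑ) ^ 2 := by
          rw [hfv]
          gcongr
          exact enorm_sub_le
      _ ≤ 2 * ‖(1 - f x) • fderiv ℝ u x‖ₑ ^ 2 + 2 * ‖(u x - c) • fderiv ℝ f x‖ₑ ^ 2 :=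
          ENNReal.add_sq_le_two_mul_sq_add _ _
      _ ≤ _ := by gcongr
  have hu2 := hu.measurable_enorm_fderiv_sq
  have huc := hu.continuous
  have h2 : Measurable fun q => ‖u q - c‖ₑ ^ 2 :=
    ((ENNReal.continuous_pow 2).comp (by fun_prop : Continuous fun q => ‖u q - c‖ₑ)).measurable
  calc ∫⁻ x in ball 0 4, ‖fderiv ℝ v x‖ₑ ^ 2 ∂μ
      ≤ ∫⁻ x in closedBall 0 1 ∪ A, ‖fderiv ℝ v x‖ₑ ^ 2 ∂μ := by
        refine lintegral_mono_set fun x hx => ?_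
        by_cases h : x ∈ closedBall (0 : E) 1
        · exact Or.inl h
        · exact Or.inr ⟨hx, h⟩
    _ ≤ ∫⁻ x in closedBall 0 1, ‖fderiv ℝ v x‖ₑ ^ 2 ∂μ + ∫⁻ x in A, ‖fderiv ℝ v x‖ₑ ^ 2 ∂μ :=
        lintegral_union_le _ _ _
    _ = ∫⁻ x in A, ‖fderiv ℝ v x‖ₑ ^ 2 ∂μ := by
        rw [setLIntegral_congr_fun measurableSet_closedBall (g := fun _ => 0), lintegral_zero,
          zero_add]
        intro x hx
        simp [(hball x (closedBall_subset_ball (by norm_num) hx)).1, ← ofReal_norm]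
    _ ≤ ∫⁻ x in A, (2 * ‖fderiv ℝ u x‖ₑ ^ 2 +
          2 * (ENNReal.ofReal M ^ 2 * K.indicator (fun x => ‖u x - c‖ₑ ^ 2) x)) ∂μ :=
        lintegral_mono hpt
    _ = 2 * ∫⁻ x in A, ‖fderiv ℝ u x‖ₑ ^ 2 ∂μ +
          2 * (ENNReal.ofReal M ^ 2 * ∫⁻ x in K, ‖u x - c‖ₑ ^ 2 ∂μ) := by
        rw [lintegral_add_left (hu2.const_mul 2), lintegral_const_mul _ hu2,
          lintegral_const_mul _ ((h2.indicator hKc.measurableSet).const_mul _),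
          lintegral_const_mul _ (h2.indicator hKc.measurableSet),
          setLIntegral_indicator hKc.measurableSet, inter_eq_left.2 hKA]
    _ ≤ 2 * ∫⁻ x in A, ‖fderiv ℝ u x‖ₑ ^ 2 ∂μ +
          2 * (ENNReal.ofReal M ^ 2 * (C * ∫⁻ x in A, ‖fderiv ℝ u x‖ₑ ^ 2 ∂μ)) := by
        gcongr
    _ = _ := by ring

theorem ContDiff.setLIntegral_fderiv_comp_smul {u : E → ℝ} (hu : ContDiff ℝ 1 u) {ρ : ℝ}
    (hρ : 0 < ρ) {T : Set E} (hT : MeasurableSet T) :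
    ∫⁻ x in (ρ • ·) ⁻¹' T, ‖fderiv ℝ (fun y => u (ρ • y)) x‖ₑ ^ 2 ∂μ =
      ENNReal.ofReal ρ ^ 2 * ENNReal.ofReal ((ρ ^ finrank ℝ E)⁻¹) *
        ∫⁻ x in T, ‖fderiv ℝ u x‖ₑ ^ 2 ∂μ := by
  have hu2 := hu.measurable_enorm_fderiv_sq
  have hfd (x : E) : ‖fderiv ℝ (fun y => u (ρ • y)) x‖ₑ ^ 2 =
      ENNReal.ofReal ρ ^ 2 * ‖fderiv ℝ u (ρ • x)‖ₑ ^ 2 := by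
    rw [fderiv_comp_smul, enorm_smul, mul_pow, ← ofReal_norm, Real.norm_of_nonneg hρ.le]
  simp_rw [hfd]
  rw [← lintegral_indicator (measurable_const_smul ρ hT)]
  have := lintegral_comp_smul_addHaar μ ((hu2.const_mul (ENNReal.ofReal ρ ^ 2)).indicator hT) hρ
  refine Eq.trans ?_ (this.trans ?_)
  · rfl
  · rw [lintegral_indicator hT, lintegral_const_mul _ hu2]
    ring

theorem exists_extension_energy_le_of_scale (hE : 1 < Module.rank ℝ E) :
    ∃ C : ℝ≥0∞, C ≠ ∞ ∧ ∀ ρ : ℝ, 0 < ρ → ∀ u : E → ℝ, ContDiff ℝ 1 u →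
      ∃ v : E → ℝ, ContDiff ℝ 1 v ∧ (∀ x ∉ closedBall (0 : E) (3 * ρ), v x = u x) ∧
      ∫⁻ x in ball 0 (4 * ρ), ‖fderiv ℝ v x‖ₑ ^ 2 ∂μ ≤
        C * ∫⁻ x in ball 0 (4 * ρ) \ closedBall 0 ρ, ‖fderiv ℝ u x‖ₑ ^ 2 ∂μ := by
  obtain ⟨C, hC, h⟩ := exists_extension_energy_le μ hE
  refine ⟨C, hC, fun ρ hρ u hu => ?_⟩
  obtain ⟨w, hw, hwu, hle⟩ := h (fun y => u (ρ • y)) (by fun_prop)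
  have hv : ContDiff ℝ 1 fun x => w (ρ⁻¹ • x) := by fun_prop
  refine ⟨fun x => w (ρ⁻¹ • x), hv, fun x hx => ?_, ?_⟩
  · have := hwu (ρ⁻¹ • x) (by
      rw [mem_closedBall_zero_iff, not_le] at hx ⊢
      rw [norm_smul, norm_inv, Real.norm_of_nonneg hρ.le, lt_inv_mul_iff₀ hρ]
      linarith)
    simpa [smul_smul, hρ.ne'] using this
  have hball : ball (0 : E) 4 = (ρ • ·) ⁻¹' ball 0 (4 * ρ) := by
    ext x
    simp [norm_smul, abs_of_pos hρ, mul_comm ρ, hρ]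
  have hcball : closedBall (0 : E) 1 = (ρ • ·) ⁻¹' closedBall 0 ρ := by
    ext x
    simp [norm_smul, abs_of_pos hρ, mul_comm ρ, hρ]
  have hww : w = fun y => (fun x => w (ρ⁻¹ • x)) (ρ • y) := by
    ext y
    simp [smul_smul, hρ.ne']
  rw [hcball, hball, ← preimage_sdiff, hu.setLIntegral_fderiv_comp_smul μ hρ
    (measurableSet_ball.diff measurableSet_closedBall)] at hle
  nth_rw 1 [hww] at hle
  rw [hv.setLIntegral_fderiv_comp_smul μ hρ measurableSet_ball, mul_left_comm] at hle
  refine (ENNReal.mul_le_mul_iff_right ?_ ?_).1 hle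
  · have : 0 < ρ ^ finrank ℝ E := by positivity
    simp [hρ, this]
  · finiteness

theorem exists_extension_energy_le_of_small_hole (hE : 1 < Module.rank ℝ E) :
    ∃ C : ℝ≥0∞, C ≠ ∞ ∧ ∀ N : ℕ, 0 < N → ∀ ε r : ℝ, 0 < ε → r ≤ ε / 4 ^ N → ∀ Ω : Set E,
      ball 0 ε ⊆ Ω → ∀ u : E → ℝ, ContDiff ℝ 1 u →
      ∃ v : E → ℝ, ContDiff ℝ 1 v ∧ (∀ x ∉ Ω, v x = u x) ∧
      N * ∫⁻ x in Ω, ‖fderiv ℝ v x‖ₑ ^ 2 ∂μ ≤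
        (N + C) * ∫⁻ x in Ω \ closedBall 0 r, ‖fderiv ℝ u x‖ₑ ^ 2 ∂μ := by
  obtain ⟨C, hC, hext⟩ := exists_extension_energy_le_of_scale μ hE
  refine ⟨C, hC, fun N hN ε r hε hr Ω hΩ u hu => ?_⟩
  set ρ : ℕ → ℝ := fun k => ε / 4 ^ (k + 1) with hρ_def
  have hρ (k : ℕ) : 0 < ρ k := by positivity
  have h4 (k : ℕ) : 4 * ρ k = ε / 4 ^ k := by simp only [hρ_def, pow_succ]; field_simp
  have hanti {j k : ℕ} (hjk : j ≤ k) : ε / 4 ^ k ≤ ε / 4 ^ j := by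
    gcongr
    norm_num
  have hrρ {k : ℕ} (hk : k < N) : r ≤ ρ k := hr.trans (hanti hk)
  have hball (k : ℕ) : ball (0 : E) (4 * ρ k) ⊆ Ω := by
    refine (ball_subset_ball ?_).trans hΩ
    simpa [h4] using hanti (Nat.zero_le k)
  set A : ℕ → Set E := fun k => ball 0 (4 * ρ k) \ closedBall 0 (ρ k)
  set e : Set E → ℝ≥0∞ := fun S => ∫⁻ x in S, ‖fderiv ℝ u x‖ₑ ^ 2 ∂μ with he
  have hdisj : Pairwise (Function.onFun Disjoint A) := by
    refine (pairwise_disjoint_on A).2 fun j k hjk => Set.disjoint_left.2 fun x hx hx' => ?_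
    have h1 := hx'.1
    have h2 := hx.2
    rw [mem_ball, h4] at h1
    rw [mem_closedBall, not_le] at h2
    exact absurd (h2.trans h1) (not_lt.2 (hanti hjk))
  have hsum : ∑ k ∈ Finset.range N, e (A k) ≤ e (Ω \ closedBall 0 r) := by
    rw [he, ← lintegral_biUnion_finset (hdisj.set_pairwise _)
      fun k _ => measurableSet_ball.diff measurableSet_closedBall]
    refine lintegral_mono_set (iUnion₂_subset fun k hk => ?_)
    exact sdiff_le_sdiff (hball k) (closedBall_subset_closedBall (hrρ (Finset.mem_range.1 hk)))
  obtain ⟨k, hk, hmin⟩ := Finset.exists_min_image (Finset.range N) (fun k => e (A k))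
    ⟨0, Finset.mem_range.2 hN⟩
  have hNk : N * e (A k) ≤ e (Ω \ closedBall 0 r) := by
    refine le_trans ?_ hsum
    simpa using Finset.card_nsmul_le_sum _ _ _ hmin
  obtain ⟨v, hv, hvu, hle⟩ := hext (ρ k) (hρ k) u hu
  have hρk := hρ k
  have hrk := hrρ (Finset.mem_range.1 hk)
  have h34 : closedBall (0 : E) (3 * ρ k) ⊆ ball 0 (4 * ρ k) :=
    closedBall_subset_ball (by linarith)
  refine ⟨v, hv, fun x hx => hvu x fun h => hx (hball k (h34 h)), ?_⟩
  have hout : ∫⁻ x in Ω \ ball 0 (4 * ρ k), ‖fderiv ℝ v x‖ₑ ^ 2 ∂μ ≤ e (Ω \ closedBall 0 r) := by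
    have hvu' : ∀ x ∈ (ball (0 : E) (4 * ρ k))ᶜ, fderiv ℝ v x = fderiv ℝ u x := by
      intro x hx
      refine Filter.EventuallyEq.fderiv_eq ?_
      filter_upwards [isClosed_closedBall.isOpen_compl.mem_nhds fun h => hx (h34 h)] with y hy
      exact hvu y hy
    calc ∫⁻ x in Ω \ ball 0 (4 * ρ k), ‖fderiv ℝ v x‖ₑ ^ 2 ∂μ = e (Ω \ ball 0 (4 * ρ k)) := by
          change _ = ∫⁻ x in Ω \ ball 0 (4 * ρ k), ‖fderiv ℝ u x‖ₑ ^ 2 ∂μ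
          rw [sdiff_eq, inter_comm, ← Measure.restrict_restrict measurableSet_ball.compl]
          exact setLIntegral_congr_fun measurableSet_ball.compl fun x hx => by
            simp only [hvu' x hx]
      _ ≤ _ := lintegral_mono_set
          (sdiff_le_sdiff le_rfl (closedBall_subset_ball (by linarith)))
  calc N * ∫⁻ x in Ω, ‖fderiv ℝ v x‖ₑ ^ 2 ∂μ
      ≤ N * (∫⁻ x in ball 0 (4 * ρ k), ‖fderiv ℝ v x‖ₑ ^ 2 ∂μ +
          ∫⁻ x in Ω \ ball 0 (4 * ρ k), ‖fderiv ℝ v x‖ₑ ^ 2 ∂μ) := by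
        gcongr
        refine le_trans (lintegral_mono_set ?_) (lintegral_union_le _ _ _)
        rw [union_sdiff_self]
        exact subset_union_right
    _ ≤ N * (C * e (A k) + e (Ω \ closedBall 0 r)) := by gcongr
    _ = N * e (Ω \ closedBall 0 r) + C * (N * e (A k)) := by ring
    _ ≤ N * e (Ω \ closedBall 0 r) + C * e (Ω \ closedBall 0 r) := by gcongr
    _ = _ := by rw [add_mul]

theorem ContDiff.integrableOn_norm_fderiv_sq {u : E → ℝ} (hu : ContDiff ℝ 1 u) {Ω : Set E}
    (hΩ : Bornology.IsBounded Ω) : IntegrableOn (fun x => ‖fderiv ℝ u x‖ ^ 2) Ω μ := by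
  have hc : Continuous fun x => ‖fderiv ℝ u x‖ ^ 2 :=
    (hu.continuous_fderiv one_ne_zero).norm.pow 2
  exact (hc.continuousOn.integrableOn_compact hΩ.isCompact_closure).mono_set subset_closure

theorem ContDiff.ofReal_setIntegral_norm_fderiv_sq {u : E → ℝ} (hu : ContDiff ℝ 1 u) {Ω : Set E}
    (hΩ : Bornology.IsBounded Ω) :
    ENNReal.ofReal (∫ x in Ω, ‖fderiv ℝ u x‖ ^ 2 ∂μ) = ∫⁻ x in Ω, ‖fderiv ℝ u x‖ₑ ^ 2 ∂μ := by
  rw [ofReal_integral_eq_lintegral_ofReal (hu.integrableOn_norm_fderiv_sq μ hΩ)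
    (Eventually.of_forall fun x => by positivity)]
  simp only [ENNReal.ofReal_pow (norm_nonneg _), ofReal_norm]

theorem exists_extension_integral_le_of_small_hole (hE : 1 < Module.rank ℝ E) :
    ∃ C : ℝ, 0 ≤ C ∧ ∀ N : ℕ, 0 < N → ∀ ε r : ℝ, 0 < ε → r ≤ ε / 4 ^ N → ∀ Ω : Set E,
      ball 0 ε ⊆ Ω → Bornology.IsBounded Ω → ∀ u : E → ℝ, ContDiff ℝ 1 u →
      ∃ v : E → ℝ, ContDiff ℝ 1 v ∧ (∀ x ∉ Ω, v x = u x) ∧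
      ∫ x in Ω, ‖fderiv ℝ v x‖ ^ 2 ∂μ ≤
        (1 + C / N) * ∫ x in Ω \ closedBall 0 r, ‖fderiv ℝ u x‖ ^ 2 ∂μ := by
  obtain ⟨C, hC, h⟩ := exists_extension_energy_le_of_small_hole μ hE
  refine ⟨C.toReal, ENNReal.toReal_nonneg, fun N hN ε r hε hr Ω hΩ hb u hu => ?_⟩
  obtain ⟨v, hv, hvu, hle⟩ := h N hN ε r hε hr Ω hΩ u hu
  refine ⟨v, hv, hvu, ?_⟩
  rw [← hv.ofReal_setIntegral_norm_fderiv_sq μ hb,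
    ← hu.ofReal_setIntegral_norm_fderiv_sq μ (hb.subset sdiff_subset), ← ENNReal.ofReal_toReal hC,
    ← ENNReal.ofReal_natCast, ← ENNReal.ofReal_add (by positivity) (by positivity),
    ← ENNReal.ofReal_mul (by positivity), ← ENNReal.ofReal_mul (by positivity),
    ENNReal.ofReal_le_ofReal_iff
      (mul_nonneg (by positivity) (integral_nonneg fun x => by positivity))] at hle
  have hN' : (0 : ℝ) < N := by exact_mod_cast hN
  have h1 : 1 + C.toReal / N = (N + C.toReal) / N := by field_simp
  rw [h1, div_mul_eq_mul_div, le_div_iff₀ hN', mul_comm]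
  exact hle

end Poincare

theorem steklovNeumannMu1_le_mul {n : ℕ} {Ω Ω' Γ : Set (EuclideanSpace ℝ (Fin n))}
    (hΓ : MeasurableSet Γ) {a : ℝ} (ha : 0 ≤ a)
    (h : ∀ u : EuclideanSpace ℝ (Fin n) → ℝ, ContDiff ℝ 1 u →
      ∃ v : EuclideanSpace ℝ (Fin n) → ℝ, ContDiff ℝ 1 v ∧ Set.EqOn v u Γ ∧
        ∫ x in Ω, ‖fderiv ℝ v x‖ ^ 2 ≤ a * ∫ x in Ω', ‖fderiv ℝ u x‖ ^ 2) :
    steklovNeumannMu1 Ω Γ ≤ a * steklovNeumannMu1 Ω' Γ := by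
  unfold steklovNeumannMu1
  set S' : Set ℝ := {t : ℝ | ∃ u : EuclideanSpace ℝ (Fin n) → ℝ, ContDiff ℝ 1 u ∧
    (∫ x in Γ, u x ∂(μH[(n : ℝ) - 1])) = 0 ∧
    (∫ x in Γ, (u x) ^ 2 ∂(μH[(n : ℝ) - 1])) ≠ 0 ∧
    t = (∫ x in Ω', ‖fderiv ℝ u x‖ ^ 2) / ∫ x in Γ, (u x) ^ 2 ∂(μH[(n : ℝ) - 1])}
  rcases S'.eq_empty_or_nonempty with he | hne
  · rw [he, Real.sInf_empty, mul_zero]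
    refine (congrArg sInf (Set.eq_empty_iff_forall_notMem.2 ?_)).trans Real.sInf_empty |>.le
    rintro t ⟨u, hu, h1, h2, -⟩
    exact he.subset ⟨u, hu, h1, h2, rfl⟩
  · rw [← smul_eq_mul, ← Real.sInf_smul_of_nonneg ha]
    refine le_csInf hne.smul_set ?_
    rintro _ ⟨_, ⟨u, hu, h1, h2, rfl⟩, rfl⟩
    obtain ⟨v, hv, hvu, hle⟩ := h u hu
    have hv1 : ∫ x in Γ, v x ∂(μH[(n : ℝ) - 1]) = ∫ x in Γ, u x ∂(μH[(n : ℝ) - 1]) :=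
      setIntegral_congr_fun hΓ hvu
    have hv2 : ∫ x in Γ, (v x) ^ 2 ∂(μH[(n : ℝ) - 1]) = ∫ x in Γ, (u x) ^ 2 ∂(μH[(n : ℝ) - 1]) :=
      setIntegral_congr_fun hΓ fun x hx => by simp only [hvu hx]
    refine csInf_le_of_le ⟨0, ?_⟩ ⟨v, hv, hv1.trans h1, hv2 ▸ h2, rfl⟩ ?_
    · rintro _ ⟨w, -, -, -, rfl⟩
      positivity
    · simp only [hv2, smul_eq_mul, ← mul_div_assoc]
      gcongr

/-- As the radius of the spherical hole tends to `0`, the first nonzero Steklov–Neumann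
eigenvalue of `Ω_out \ B̄_r` converges to the first nonzero Steklov eigenvalue of
`Ω_out`. -/
theorem stmt17 (n : ℕ) (hn : 2 ≤ n) (Ωout : Set (EuclideanSpace ℝ (Fin n)))
    (hopen : IsOpen Ωout) (hbdd : Bornology.IsBounded Ωout) (hconn : IsConnected Ωout)
    (h0 : (0 : EuclideanSpace ℝ (Fin n)) ∈ Ωout) :
    Tendsto (fun r : ℝ =>
        steklovNeumannMu1 (Ωout \ Metric.closedBall 0 r) (frontier Ωout))
      (nhdsWithin 0 (Set.Ioi 0))
      (nhds (steklovNeumannMu1 Ωout (frontier Ωout))) := by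
  have hE : 1 < Module.rank ℝ (EuclideanSpace ℝ (Fin n)) := by
    rw [← Module.finrank_eq_rank, finrank_euclideanSpace_fin]
    exact_mod_cast hn
  obtain ⟨C, hC, hext⟩ := exists_extension_integral_le_of_small_hole
    (volume : Measure (EuclideanSpace ℝ (Fin n))) hE
  obtain ⟨ε, hε, hball⟩ := Metric.isOpen_iff.1 hopen 0 h0
  have hΓ : MeasurableSet (frontier Ωout) := isClosed_frontier.measurableSet
  set σ := steklovNeumannMu1 Ωout (frontier Ωout)
  have hupper (r : ℝ) : steklovNeumannMu1 (Ωout \ Metric.closedBall 0 r) (frontier Ωout) ≤ σ := by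
    rw [← one_mul σ]
    refine steklovNeumannMu1_le_mul hΓ zero_le_one fun u hu => ⟨u, hu, fun _ _ => rfl, ?_⟩
    rw [one_mul]
    exact setIntegral_mono_set (hu.integrableOn_norm_fderiv_sq volume hbdd)
      (Eventually.of_forall fun x => by positivity) Set.sdiff_subset.eventuallyLE
  have hlower (N : ℕ) (hN : 0 < N) (r : ℝ) (hr : r ≤ ε / 4 ^ N) :
      σ ≤ (1 + C / N) * steklovNeumannMu1 (Ωout \ Metric.closedBall 0 r) (frontier Ωout) := by
    refine steklovNeumannMu1_le_mul hΓ (by positivity) fun u hu => ?_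
    obtain ⟨v, hv, hvu, hle⟩ := hext N hN ε r hε hr Ωout hball hbdd u hu
    refine ⟨v, hv, fun x hx => hvu x fun hxΩ => ?_, hle⟩
    exact Set.disjoint_left.1 (disjoint_frontier_iff_isOpen.2 hopen) hx hxΩ
  refine Metric.tendsto_nhds.2 fun δ hδ => ?_
  obtain ⟨N, hN⟩ := exists_nat_gt (C * σ / δ)
  have hN1 : (0 : ℝ) < (N + 1 : ℕ) := by positivity
  have hsmall : C / (N + 1 : ℕ) * σ < δ := by
    rw [div_lt_iff₀ hδ] at hN
    rw [div_mul_eq_mul_div, div_lt_iff₀ hN1]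
    push_cast
    nlinarith
  filter_upwards [mem_nhdsWithin_of_mem_nhds
    (Iic_mem_nhds (show 0 < ε / 4 ^ (N + 1) by positivity))] with r hr
  have h1 := hupper r
  have h2 := hlower (N + 1) N.succ_pos r hr
  have h3 := mul_le_mul_of_nonneg_left h1 (show 0 ≤ C / (N + 1 : ℕ) by positivity)
  rw [Real.dist_eq, abs_lt]
  constructor <;> nlinarith
end

section
/- Let $\Omega_{out} \subset \mathbb{R}^n$ be an open bounded convex set with $\overline{B_r} \subset \Omega_{out}$, $\Omega_r = \Omega_{out}\setminus\overline{B_r}$, and suppose $\Omega_{out}$ is not a ball. Let $R_P > 0$ be the radius of the ball with the same perimeter as $\Omega_{out}$, and $A_{r,R_P} = B_{R_P}\setminus\overline{B_r}$. Then there exists $r_2^P > 0$, depending only on $\Omega_{out}$, such that for every $r \in (0, r_2^P)$: $\mu_1(\Omega_r) \leq \mu_1(A_{r,R_P})$, and the inequality is strict. -/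
open Real MeasureTheory Metric

section HausdorffSphere

open Set Module Measure
open scoped Pointwise ENNReal NNReal RealInnerProductSpace

theorem LipschitzOnWith.euclideanHausdorffMeasure_image_le {X Y : Type*} [EMetricSpace X]
    [EMetricSpace Y] [MeasurableSpace X] [BorelSpace X] [MeasurableSpace Y] [BorelSpace Y]
    {K : ℝ≥0} {f : X → Y} {s : Set X} (h : LipschitzOnWith K f s) (d : ℕ) :
    μHE[d] (f '' s) ≤ (K : ℝ≥0∞) ^ d * μHE[d] s := by
  simp only [euclideanHausdorffMeasure_def, Measure.smul_apply, ENNReal.smul_def, smul_eq_mul]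
  rw [mul_left_comm]
  gcongr
  simpa using h.hausdorffMeasure_image_le (d := d) (by positivity)

/-- If `f` does not decrease distances on `s`, it does not decrease the Hausdorff measure. -/
theorem euclideanHausdorffMeasure_le_of_expanding {X Y : Type*} [MetricSpace X]
    [MetricSpace Y] [MeasurableSpace X] [BorelSpace X] [MeasurableSpace Y] [BorelSpace Y]
    {f : X → Y} {s : Set X} {t : Set Y} (hf : MapsTo f s t)
    (h : ∀ x ∈ s, ∀ y ∈ s, dist x y ≤ dist (f x) (f y)) (d : ℕ) :
    μHE[d] s ≤ μHE[d] t := by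
  rcases isEmpty_or_nonempty X with hX | hX
  · simp [Set.eq_empty_of_isEmpty s]
  have hinj : InjOn f s := fun x hx y hy hxy ↦ by
    have := h x hx y hy
    rw [hxy, dist_self] at this
    exact dist_le_zero.1 this
  have hinv : ∀ x ∈ s, Function.invFunOn f s (f x) = x := fun x hx ↦ hinj.leftInvOn_invFunOn hx
  have hlip : LipschitzOnWith 1 (Function.invFunOn f s) (f '' s) := by
    refine LipschitzOnWith.of_dist_le_mul ?_
    rintro _ ⟨x, hx, rfl⟩ _ ⟨y, hy, rfl⟩
    rw [hinv x hx, hinv y hy]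
    simpa using h x hx y hy
  have himg : Function.invFunOn f s '' (f '' s) = s := by
    rw [image_image]
    exact (image_congr hinv).trans (image_id' s)
  calc μHE[d] s = μHE[d] (Function.invFunOn f s '' (f '' s)) := by rw [himg]
    _ ≤ ((1 : ℝ≥0) : ℝ≥0∞) ^ d * μHE[d] (f '' s) := hlip.euclideanHausdorffMeasure_image_le d
    _ ≤ μHE[d] t := by simpa using measure_mono hf.image_subset

variable {E : Type*} [NormedAddCommGroup E] [InnerProductSpace ℝ E] [FiniteDimensional ℝ E]
  [MeasurableSpace E] [BorelSpace E] {m : ℕ}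

/-- The volume of the cone with apex `0` over a subset of an affine hyperplane at distance one. -/
theorem euclideanHausdorffMeasure_eq_volume_cone (hE : finrank ℝ E = m + 1) {p : E}
    (hp : ‖p‖ = 1) {s : Set E} (hs : MeasurableSet s) (hsp : ∀ x ∈ s, ⟪p, x⟫ = 1) :
    μHE[m] s = (m + 1) * volume (Ioo (0 : ℝ) 1 • s) := by
  have hp0 : p ≠ 0 := norm_ne_zero_iff.1 (by simp [hp])
  have hcone : Ioo (0 : ℝ) 1 • s = {y | ⟪p, y⟫ ∈ Ioo (0 : ℝ) 1 ∧ ⟪p, y⟫⁻¹ • y ∈ s} := by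
    ext y
    simp only [mem_smul, mem_ofPred_eq]
    constructor
    · rintro ⟨c, hc, x, hx, rfl⟩
      have : ⟪p, c • x⟫ = c := by rw [inner_smul_right, hsp x hx, mul_one]
      rw [this, smul_smul, inv_mul_cancel₀ hc.1.ne', one_smul]
      exact ⟨hc, hx⟩
    · rintro ⟨h1, h2⟩
      exact ⟨_, h1, _, h2, by rw [smul_smul, mul_inv_cancel₀ h1.1.ne', one_smul]⟩
  have hmeas : MeasurableSet (Ioo (0 : ℝ) 1 • s) := by
    rw [hcone]
    have h1 : Measurable fun y : E ↦ ⟪p, y⟫ := by fun_prop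
    exact (h1 measurableSet_Ioo).inter ((h1.inv.smul measurable_id) hs)
  have hslice : ∀ x : ℝ, μHE[m] (Ioo (0 : ℝ) 1 • s ∩ (AffineSubspace.mk' (x • p +ᵥ (0 : E)) (ℝ ∙ p)ᗮ
      : AffineSubspace ℝ E)) = (Ioo (0 : ℝ) 1).indicator (fun x ↦ ENNReal.ofReal (x ^ m) * μHE[m] s) x := by
    intro x
    have hset : (Ioo (0 : ℝ) 1 • s ∩ (AffineSubspace.mk' (x • p +ᵥ (0 : E)) (ℝ ∙ p)ᗮ
      : AffineSubspace ℝ E)) = {y | ⟪p, y⟫ = x ∧ x ∈ Ioo (0 : ℝ) 1 ∧ x⁻¹ • y ∈ s} := by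
      ext y
      rw [hcone]
      simp only [vadd_eq_add, add_zero, mem_inter_iff, mem_ofPred_eq, SetLike.mem_coe,
        AffineSubspace.mem_mk', vsub_eq_sub, Submodule.mem_orthogonal_singleton_iff_inner_right,
        inner_sub_right, inner_smul_right, real_inner_self_eq_norm_sq, hp]
      constructor
      · rintro ⟨⟨h1, h2⟩, h3⟩
        obtain rfl : ⟪p, y⟫ = x := by linarith
        exact ⟨rfl, h1, h2⟩
      · rintro ⟨rfl, h1, h2⟩
        exact ⟨⟨h1, h2⟩, by ring⟩
    rw [hset]
    by_cases hx : x ∈ Ioo (0 : ℝ) 1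
    · have : {y | ⟪p, y⟫ = x ∧ x ∈ Ioo (0 : ℝ) 1 ∧ x⁻¹ • y ∈ s} = x • s := by
        ext y
        rw [mem_smul_set_iff_inv_smul_mem₀ hx.1.ne']
        refine ⟨fun h ↦ h.2.2, fun h ↦ ⟨?_, hx, h⟩⟩
        have := hsp _ h
        rw [inner_smul_right] at this
        field_simp [hx.1.ne'] at this
        exact this
      rw [this, euclideanHausdorffMeasure_smul₀ _ hx.1.ne', indicator_of_mem hx,
        ENNReal.smul_def, smul_eq_mul]
      congr 1
      rw [ENNReal.ofReal_pow hx.1.le, ENNReal.coe_pow, ← Real.enorm_of_nonneg hx.1.le]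
      rfl
    · rw [indicator_of_notMem hx]
      have : {y | ⟪p, y⟫ = x ∧ x ∈ Ioo (0 : ℝ) 1 ∧ x⁻¹ • y ∈ s} = ∅ := by
        ext y; simp only [mem_ofPred_eq, mem_empty_iff_false, iff_false]; tauto
      rw [this, measure_empty]
  have key := EuclideanGeometry.euclideanHausdorffMeasure_eq_lintegral (0 : E) hp0 hmeas
  rw [hE, Nat.add_sub_cancel] at key
  simp_rw [hslice] at key
  rw [lintegral_indicator measurableSet_Ioo, lintegral_mul_const _ (by fun_prop),
    ← ofReal_integral_eq_lintegral_ofReal, ← integral_Ioc_eq_integral_Ioo,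
    ← intervalIntegral.integral_of_le zero_le_one, integral_pow] at key
  · have hv : (volume : Measure E) = μHE[m + 1] := by
      rw [← InnerProductSpace.euclideanHausdorffMeasure_eq_volume, hE]
    rw [hv, key, ← mul_assoc, ← mul_assoc]
    have h1 : ‖p‖ₑ = 1 := by rw [← ofReal_norm, hp]; simp
    rw [h1, mul_one]
    have : ((m : ℝ≥0∞) + 1) = ENNReal.ofReal (m + 1) := by
      rw [ENNReal.ofReal_add (by positivity) zero_le_one]; simp
    rw [this, ← ENNReal.ofReal_mul (by positivity)]
    have : ((m : ℝ) + 1) * ((1 ^ (m + 1) - 0 ^ (m + 1)) / (m + 1)) = 1 := by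
      field_simp; simp
    rw [this]; simp
  · exact (continuous_pow m).integrableOn_Icc.mono_set Ioo_subset_Icc_self
  · exact (ae_restrict_iff' measurableSet_Ioo).2 (ae_of_all _ fun x hx ↦ by
      simpa using pow_nonneg hx.1.le m)

end HausdorffSphere

section CapComparison

open Set Module Measure
open scoped Pointwise ENNReal NNReal RealInnerProductSpace

variable {E : Type*} [NormedAddCommGroup E] [InnerProductSpace ℝ E] [FiniteDimensional ℝ E]
  [MeasurableSpace E] [BorelSpace E] {m : ℕ}

/-- Distortion of the central projection from a spherical cap of radius `δ` to its tangent plane. -/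
noncomputable def capDistortion (δ : ℝ) : ℝ := 1 / (1 - δ) + δ / (1 - δ) ^ 2

theorem euclideanHausdorffMeasure_cap_bounds (hE : finrank ℝ E = m + 1) {p : E} (hp : ‖p‖ = 1)
    {δ : ℝ} (hδ : 0 < δ) (hδ1 : δ < 1) {s : Set E} (hs : MeasurableSet s)
    (hs1 : ∀ x ∈ s, ‖x‖ = 1) (hsp : ∀ x ∈ s, ‖x - p‖ ≤ δ) :
    μHE[m] s ≤ ENNReal.ofReal (capDistortion δ ^ (m + 1)) * ((m + 1) * volume (Ioo (0 : ℝ) 1 • s)) ∧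
    (m + 1) * volume (Ioo (0 : ℝ) 1 • s) ≤ ENNReal.ofReal (capDistortion δ ^ (m + 1)) * μHE[m] s := by
  have hδ' : 0 < 1 - δ := by linarith
  have hL1 : 1 / (1 - δ) ≤ capDistortion δ := by
    unfold capDistortion; linarith [show 0 ≤ δ / (1 - δ) ^ 2 by positivity]
  have hL0 : 1 ≤ 1 / (1 - δ) := by rw [le_div_iff₀ hδ']; linarith
  have ht : ∀ x ∈ s, 1 - δ ≤ ⟪p, x⟫ := by
    intro x hx
    have h1 : ⟪p, p - x⟫ ≤ ‖p‖ * ‖p - x‖ := real_inner_le_norm _ _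
    rw [inner_sub_right, real_inner_self_eq_norm_sq, hp, norm_sub_rev] at h1
    linarith [hsp x hx]
  have ht1 : ∀ x ∈ s, ⟪p, x⟫ ≤ 1 := by
    intro x hx
    have := real_inner_le_norm p x
    rwa [hp, hs1 x hx, mul_one] at this
  set T : Set E := {y | ⟪p, y⟫ = 1 ∧ ‖y‖⁻¹ • y ∈ s} with hT
  have hTmeas : MeasurableSet T := by
    have h1 : Measurable fun y : E ↦ ⟪p, y⟫ := by fun_prop
    have h2 : Measurable fun y : E ↦ ‖y‖⁻¹ • y := by fun_prop
    exact (h1 (measurableSet_singleton 1)).inter (h2 hs)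
  have hmaps : MapsTo (fun x : E ↦ ⟪p, x⟫⁻¹ • x) s T := by
    intro x hx
    have h0 : 0 < ⟪p, x⟫ := hδ'.trans_le (ht x hx)
    refine ⟨?_, ?_⟩
    · simp only [inner_smul_right]; exact inv_mul_cancel₀ h0.ne'
    · simp only [norm_smul, norm_inv, Real.norm_eq_abs, abs_of_pos h0, hs1 x hx, mul_one, inv_inv]
      rwa [smul_smul, mul_inv_cancel₀ h0.ne', one_smul]
  have hTeq : (fun x : E ↦ ⟪p, x⟫⁻¹ • x) '' s = T := by
    refine hmaps.image_subset.antisymm fun y hy ↦ ⟨_, hy.2, ?_⟩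
    have hy0 : ‖y‖ ≠ 0 := by
      intro h
      have := hy.1
      rw [norm_eq_zero.1 h, inner_zero_right] at this
      exact zero_ne_one this
    simp only [inner_smul_right, hy.1, mul_one, inv_inv, smul_smul, mul_inv_cancel₀ hy0, one_smul]
  have hexp : μHE[m] s ≤ μHE[m] T := by
    refine euclideanHausdorffMeasure_le_of_expanding hmaps (fun x hx y hy ↦ ?_) m
    rw [dist_eq_norm, dist_eq_norm]
    refine (pow_le_pow_iff_left₀ (norm_nonneg _) (norm_nonneg _) two_ne_zero).1 ?_
    have ha : 1 ≤ ⟪p, x⟫⁻¹ := (one_le_inv₀ (hδ'.trans_le (ht x hx))).2 (ht1 x hx)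
    have hb : 1 ≤ ⟪p, y⟫⁻¹ := (one_le_inv₀ (hδ'.trans_le (ht y hy))).2 (ht1 y hy)
    have hc : ⟪x, y⟫ ≤ 1 := by
      have := real_inner_le_norm x y
      rwa [hs1 x hx, hs1 y hy, mul_one] at this
    rw [norm_sub_sq_real, norm_sub_sq_real, norm_smul, norm_smul, real_inner_smul_left,
      real_inner_smul_right, hs1 x hx, hs1 y hy]
    simp only [Real.norm_eq_abs, mul_one, sq_abs]
    generalize ⟪p, x⟫⁻¹ = a at *
    generalize ⟪p, y⟫⁻¹ = b at *
    nlinarith [mul_nonneg (sub_nonneg.2 hc) (show 0 ≤ a * b - 1 by nlinarith), sq_nonneg (a - b)]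
  have hlip : μHE[m] T ≤ ENNReal.ofReal (capDistortion δ) ^ m * μHE[m] s := by
    rw [← hTeq]
    refine LipschitzOnWith.euclideanHausdorffMeasure_image_le (K := (capDistortion δ).toNNReal) ?_ m
    refine LipschitzOnWith.of_dist_le_mul fun x hx y hy ↦ ?_
    rw [Real.coe_toNNReal _ (by linarith), dist_eq_norm, dist_eq_norm]
    have hx0 : 0 < ⟪p, x⟫ := hδ'.trans_le (ht x hx)
    have hy0 : 0 < ⟪p, y⟫ := hδ'.trans_le (ht y hy)
    have h1 : |⟪p, x⟫ - ⟪p, y⟫| ≤ δ * ‖x - y‖ := by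
      have h2 : ⟪p, x⟫ - ⟪p, y⟫ = ⟪p - (1 / 2 : ℝ) • (x + y), x - y⟫ := by
        simp only [inner_sub_left, inner_sub_right, real_inner_smul_left, inner_add_left,
          real_inner_self_eq_norm_sq, hs1 x hx, hs1 y hy, real_inner_comm y x]
        ring
      have h3 : ‖p - (1 / 2 : ℝ) • (x + y)‖ ≤ δ := by
        have : p - (1 / 2 : ℝ) • (x + y) = -((1 / 2 : ℝ) • ((x - p) + (y - p))) := by module
        rw [this, norm_neg, norm_smul]
        have := norm_add_le (x - p) (y - p)
        norm_num
        linarith [hsp x hx, hsp y hy]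
      rw [h2]
      exact (abs_real_inner_le_norm _ _).trans (by gcongr)
    have h4 : ⟪p, x⟫⁻¹ • x - ⟪p, y⟫⁻¹ • y
        = ⟪p, x⟫⁻¹ • (x - y) + (⟪p, x⟫⁻¹ - ⟪p, y⟫⁻¹) • y := by module
    have h5 : |⟪p, x⟫⁻¹ - ⟪p, y⟫⁻¹| ≤ δ * ‖x - y‖ / (1 - δ) ^ 2 := by
      rw [inv_sub_inv hx0.ne' hy0.ne', abs_div, abs_of_pos (mul_pos hx0 hy0), abs_sub_comm]
      refine div_le_div₀ (by positivity) h1 (by positivity) ?_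
      nlinarith [ht x hx, ht y hy]
    have h6 : ⟪p, x⟫⁻¹ ≤ 1 / (1 - δ) := by
      rw [one_div]; exact inv_anti₀ hδ' (ht x hx)
    rw [h4]
    refine (norm_add_le _ _).trans ?_
    rw [norm_smul, norm_smul, hs1 y hy, mul_one, Real.norm_eq_abs, Real.norm_eq_abs,
      abs_of_pos (inv_pos.2 hx0)]
    calc ⟪p, x⟫⁻¹ * ‖x - y‖ + |⟪p, x⟫⁻¹ - ⟪p, y⟫⁻¹|
        ≤ 1 / (1 - δ) * ‖x - y‖ + δ * ‖x - y‖ / (1 - δ) ^ 2 := by gcongr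
      _ = capDistortion δ * ‖x - y‖ := by unfold capDistortion; ring
  have hcone := euclideanHausdorffMeasure_eq_volume_cone hE hp hTmeas (fun x hx ↦ hx.1)
  have hsub1 : Ioo (0 : ℝ) 1 • s ⊆ Ioo (0 : ℝ) 1 • T := by
    rintro _ ⟨c, hc, x, hx, rfl⟩
    have h0 : 0 < ⟪p, x⟫ := hδ'.trans_le (ht x hx)
    refine ⟨c * ⟪p, x⟫, ⟨mul_pos hc.1 h0, ?_⟩, _, hmaps hx, ?_⟩
    · nlinarith [ht1 x hx, hc.1, hc.2]
    · simp only [smul_smul]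
      rw [mul_assoc, mul_inv_cancel₀ h0.ne', mul_one]
  have hsub2 : Ioo (0 : ℝ) 1 • T ⊆ (1 / (1 - δ)) • Ioo (0 : ℝ) 1 • s := by
    rw [← hTeq]
    rintro _ ⟨c, hc, _, ⟨x, hx, rfl⟩, rfl⟩
    have h0 : 0 < ⟪p, x⟫ := hδ'.trans_le (ht x hx)
    refine ⟨(c * ((1 - δ) * ⟪p, x⟫⁻¹)) • x, ⟨_, ⟨?_, ?_⟩, x, hx, rfl⟩, ?_⟩
    · exact mul_pos hc.1 (by positivity)
    · have : (1 - δ) * ⟪p, x⟫⁻¹ ≤ 1 := by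
        rw [← div_eq_mul_inv, div_le_one h0]; exact ht x hx
      have h3 : 0 ≤ (1 - δ) * ⟪p, x⟫⁻¹ := by positivity
      nlinarith [hc.1, hc.2]
    · simp only [smul_smul]
      congr 1
      field_simp
  constructor
  · refine hexp.trans ?_
    rw [hcone, mul_left_comm]
    gcongr
    refine (measure_mono hsub2).trans ?_
    rw [addHaar_smul, hE]
    gcongr
    rw [abs_of_pos (by positivity)]
    gcongr
  · calc (m + 1) * volume (Ioo (0 : ℝ) 1 • s) ≤ (m + 1) * volume (Ioo (0 : ℝ) 1 • T) := by gcongr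
      _ = μHE[m] T := hcone.symm
      _ ≤ _ := hlip
      _ ≤ _ := by
        rw [ENNReal.ofReal_pow (by linarith)]
        gcongr
        · exact ENNReal.one_le_ofReal.2 (by linarith)
        · exact Nat.le_succ m

/-- To compare two measures it suffices to compare them on the members of a countable cover. -/
theorem measure_le_of_countable_cover {X : Type*} [MeasurableSpace X] {μ ν : Measure X}
    {U : ℕ → Set X} (hU : ∀ i, MeasurableSet (U i)) (hcov : ⋃ i, U i = univ)
    (h : ∀ i, ∀ s ⊆ U i, MeasurableSet s → μ s ≤ ν s) : μ ≤ ν := by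
  refine Measure.le_iff.2 fun s hs ↦ ?_
  have hdm : ∀ i, MeasurableSet (disjointed U i) := fun i ↦ MeasurableSet.disjointed hU i
  have key : ∀ ρ : Measure X, ρ s = ∑' i, ρ (s ∩ disjointed U i) := by
    intro ρ
    rw [← measure_iUnion _ (fun i ↦ hs.inter (hdm i)), ← inter_iUnion, iUnion_disjointed, hcov,
      inter_univ]
    exact fun i j hij ↦ ((disjoint_disjointed U) hij).mono inter_subset_right inter_subset_right
  rw [key μ, key ν]
  exact ENNReal.tsum_le_tsum fun i ↦ h i _
    (inter_subset_right.trans (disjointed_subset U i)) (hs.inter (hdm i))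

theorem tendsto_capDistortion (k : ℕ) :
    Filter.Tendsto (fun δ : ℝ ↦ ENNReal.ofReal (capDistortion δ ^ k)) (nhdsWithin 0 (Ioi 0))
      (nhds 1) := by
  have h : ContinuousAt (fun δ : ℝ ↦ capDistortion δ ^ k) 0 := by
    unfold capDistortion
    have h1 : (1 - (0 : ℝ)) ≠ 0 := by norm_num
    have h2 : (1 - (0 : ℝ)) ^ 2 ≠ 0 := by norm_num
    fun_prop (disch := assumption)
  have := ENNReal.tendsto_ofReal (h.tendsto.mono_left (nhdsWithin_le_nhds (s := Ioi 0)))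
  simpa [capDistortion] using this

/-- The Hausdorff measure on the unit sphere is the surface measure. -/
theorem comap_euclideanHausdorffMeasure_sphere (hE : finrank ℝ E = m + 1) :
    (μHE[m] : Measure E).comap ((↑) : sphere (0 : E) 1 → E) = (volume : Measure E).toSphere := by
  have hemb : MeasurableEmbedding ((↑) : sphere (0 : E) 1 → E) :=
    MeasurableEmbedding.subtype_coe isClosed_sphere.measurableSet
  have hne : Nonempty (sphere (0 : E) 1) := by
    have : Nontrivial E := nontrivial_of_finrank_pos (R := ℝ) (by omega)
    exact (NormedSpace.sphere_nonempty.2 zero_le_one).to_subtype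
  have hcov : ∀ δ : ℝ, 0 < δ → ⋃ i, closedBall (TopologicalSpace.denseSeq (sphere (0 : E) 1) i) δ
      = univ := by
    intro δ hδ
    refine eq_univ_of_forall fun x ↦ ?_
    obtain ⟨i, hi⟩ := (TopologicalSpace.denseRange_denseSeq (sphere (0 : E) 1)).exists_dist_lt x hδ
    exact mem_iUnion.2 ⟨i, mem_closedBall.2 hi.le⟩
  have main : ∀ δ : ℝ, 0 < δ → δ < 1 → ∀ i, ∀ s ⊆
      closedBall (TopologicalSpace.denseSeq (sphere (0 : E) 1) i) δ, MeasurableSet s →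
      (μHE[m] : Measure E).comap ((↑) : sphere (0 : E) 1 → E) s
        ≤ (ENNReal.ofReal (capDistortion δ ^ (m + 1)) • (volume : Measure E).toSphere) s ∧
      (volume : Measure E).toSphere s ≤ (ENNReal.ofReal (capDistortion δ ^ (m + 1)) •
        (μHE[m] : Measure E).comap ((↑) : sphere (0 : E) 1 → E)) s := by
    intro δ hδ hδ1 i s hsi hs
    rw [Measure.smul_apply, Measure.smul_apply, hemb.comap_apply, toSphere_apply' _ hs, hE]
    push_cast
    refine euclideanHausdorffMeasure_cap_bounds hE
      (p := (TopologicalSpace.denseSeq (sphere (0 : E) 1) i : E))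
      (by simp) hδ hδ1 (hemb.measurableSet_image.2 hs)
      (by rintro _ ⟨x, -, rfl⟩; simp) ?_
    rintro _ ⟨x, hx, rfl⟩
    simpa [Subtype.dist_eq, dist_eq_norm] using hsi hx
  have hev : ∀ᶠ δ in nhdsWithin (0 : ℝ) (Ioi 0), 0 < δ ∧ δ < 1 :=
    Ioo_mem_nhdsGT one_pos
  have lim : ∀ a : ℝ≥0∞, Filter.Tendsto (fun δ : ℝ ↦ ENNReal.ofReal (capDistortion δ ^ (m + 1)) * a)
      (nhdsWithin 0 (Ioi 0)) (nhds a) := by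
    intro a
    have := ENNReal.Tendsto.mul_const (b := a) (tendsto_capDistortion (m + 1)) (Or.inl one_ne_zero)
    rwa [one_mul] at this
  refine le_antisymm (Measure.le_iff.2 fun s hs ↦ ?_) (Measure.le_iff.2 fun s hs ↦ ?_)
  · refine ge_of_tendsto (lim _) (hev.mono fun δ hδ ↦ ?_)
    exact measure_le_of_countable_cover (fun i ↦ isClosed_closedBall.measurableSet)
      (hcov δ hδ.1) (fun i s hsi hs ↦ (main δ hδ.1 hδ.2 i s hsi hs).1) s
  · refine ge_of_tendsto (lim _) (hev.mono fun δ hδ ↦ ?_)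
    exact measure_le_of_countable_cover (fun i ↦ isClosed_closedBall.measurableSet)
      (hcov δ hδ.1) (fun i s hsi hs ↦ (main δ hδ.1 hδ.2 i s hsi hs).2) s

end CapComparison

section ConvexBoundary

open Set Module Measure
open scoped Pointwise ENNReal NNReal RealInnerProductSpace Topology

variable {E : Type*} [NormedAddCommGroup E] [InnerProductSpace ℝ E]

/-- Bounded open convex sets containing the origin. -/
structure IsPointedConvexDomain (Ω : Set E) : Prop where
  isOpen : IsOpen Ω
  isBounded : Bornology.IsBounded Ω
  convex : Convex ℝ Ω
  zero_mem : (0 : E) ∈ Ω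

/-- The radial function of a star-shaped set. -/
noncomputable def radialFun (Ω : Set E) (θ : sphere (0 : E) 1) : ℝ := (gauge Ω (θ : E))⁻¹

/-- The boundary point in a given direction. -/
noncomputable def boundaryPoint (Ω : Set E) (θ : sphere (0 : E) 1) : E := radialFun Ω θ • (θ : E)

theorem norm_smul_sub_smul_le {x y : E} (hx : ‖x‖ = 1) (hy : ‖y‖ = 1) {τ a b : ℝ} (hτ : 0 ≤ τ)
    (ha : τ ≤ a) (hb : τ ≤ b) : ‖τ • x - τ • y‖ ≤ ‖a • x - b • y‖ := by
  refine (pow_le_pow_iff_left₀ (norm_nonneg _) (norm_nonneg _) two_ne_zero).1 ?_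
  have hc : ⟪x, y⟫ ≤ 1 := by
    have := real_inner_le_norm x y
    rwa [hx, hy, mul_one] at this
  rw [norm_sub_sq_real, norm_sub_sq_real]
  simp only [norm_smul, real_inner_smul_left, real_inner_smul_right, hx, hy, Real.norm_eq_abs,
    mul_one, sq_abs]
  have : τ * τ ≤ a * b := mul_le_mul ha hb hτ (hτ.trans ha)
  nlinarith [mul_nonneg (sub_nonneg.2 hc) (sub_nonneg.2 this), sq_nonneg (a - b)]

namespace IsPointedConvexDomain

variable {Ω : Set E} (h : IsPointedConvexDomain Ω)
include h

theorem mem_nhds : Ω ∈ 𝓝 (0 : E) := h.isOpen.mem_nhds h.zero_mem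

theorem gauge_pos {x : E} (hx : x ≠ 0) : 0 < gauge Ω x :=
  (_root_.gauge_pos (absorbent_nhds_zero h.mem_nhds)
    (NormedSpace.isVonNBounded_of_isBounded ℝ h.isBounded)).2 hx

theorem gauge_sphere_pos (θ : sphere (0 : E) 1) : 0 < gauge Ω (θ : E) :=
  h.gauge_pos (ne_zero_of_mem_unit_sphere θ)

theorem radialFun_pos (θ : sphere (0 : E) 1) : 0 < radialFun Ω θ := inv_pos.2 (h.gauge_sphere_pos θ)

theorem continuous_radialFun : Continuous (radialFun Ω) :=
  ((continuous_gauge h.convex h.mem_nhds).comp continuous_subtype_val).inv₀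
    fun θ ↦ (h.gauge_sphere_pos θ).ne'

theorem continuous_boundaryPoint : Continuous (boundaryPoint Ω) :=
  h.continuous_radialFun.smul continuous_subtype_val

theorem norm_boundaryPoint (θ : sphere (0 : E) 1) : ‖boundaryPoint Ω θ‖ = radialFun Ω θ := by
  rw [boundaryPoint, norm_smul, Real.norm_of_nonneg (h.radialFun_pos θ).le,
    norm_eq_of_mem_sphere, mul_one]

theorem boundaryPoint_injective : Function.Injective (boundaryPoint Ω) := by
  intro θ η hθη
  have h1 := h.norm_boundaryPoint θ
  rw [hθη, h.norm_boundaryPoint η] at h1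
  rw [boundaryPoint, boundaryPoint, h1] at hθη
  exact Subtype.ext (smul_right_injective E (h.radialFun_pos θ).ne' hθη)

theorem smul_mem_iff (θ : sphere (0 : E) 1) {t : ℝ} (ht : 0 ≤ t) :
    t • (θ : E) ∈ Ω ↔ t < radialFun Ω θ := by
  conv_lhs => rw [← h.isOpen.interior_eq]
  rw [← gauge_lt_one_iff_mem_interior h.convex h.mem_nhds, gauge_smul_of_nonneg ht, radialFun,
    smul_eq_mul, ← one_div, lt_div_iff₀ (h.gauge_sphere_pos θ)]

theorem range_boundaryPoint : range (boundaryPoint Ω) = frontier Ω := by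
  ext x
  rw [← gauge_eq_one_iff_mem_frontier h.convex h.mem_nhds]
  constructor
  · rintro ⟨θ, rfl⟩
    rw [boundaryPoint, gauge_smul_of_nonneg (h.radialFun_pos θ).le, radialFun, smul_eq_mul,
      inv_mul_cancel₀ (h.gauge_sphere_pos θ).ne']
  · intro hx
    have hx0 : x ≠ 0 := by rintro rfl; simp at hx
    have hn : 0 < ‖x‖ := norm_pos_iff.2 hx0
    refine ⟨⟨‖x‖⁻¹ • x, ?_⟩, ?_⟩
    · simp [norm_smul, hn.ne']
    · simp only [boundaryPoint, radialFun]
      rw [gauge_smul_of_nonneg (inv_nonneg.2 hn.le), hx, smul_eq_mul, mul_one, inv_inv, smul_smul,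
        mul_inv_cancel₀ hn.ne', one_smul]

theorem exists_unit_normal [FiniteDimensional ℝ E] {x : E} (hx : x ∈ frontier Ω) :
    ∃ v : E, ‖v‖ = 1 ∧ ∀ z ∈ closure Ω, ⟪v, z⟫ ≤ ⟪v, x⟫ := by
  have hxn : x ∉ Ω := by
    rw [frontier, h.isOpen.interior_eq] at hx
    exact hx.2
  obtain ⟨f, hf⟩ := geometric_hahn_banach_open_point h.convex h.isOpen hxn
  obtain ⟨v, rfl⟩ := (InnerProductSpace.toDual ℝ E).surjective f
  simp only [InnerProductSpace.toDual_apply_apply] at hf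
  have hv : 0 < ‖v‖ := by
    rw [norm_pos_iff]
    rintro rfl
    simpa using hf 0 h.zero_mem
  refine ⟨‖v‖⁻¹ • v, by simp [norm_smul, hv.ne'], fun z hz ↦ ?_⟩
  have : ⟪v, z⟫ ≤ ⟪v, x⟫ := by
    have hcl : closure Ω ⊆ {z | ⟪v, z⟫ ≤ ⟪v, x⟫} :=
      closure_minimal (fun z hz ↦ (hf z hz).le)
        (isClosed_le (by fun_prop) (by fun_prop))
    exact hcl hz
  simp only [real_inner_smul_left]
  gcongr

variable [FiniteDimensional ℝ E] [MeasurableSpace E] [BorelSpace E] {m : ℕ}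

theorem measurableEmbedding_boundaryPoint : MeasurableEmbedding (boundaryPoint Ω) :=
  h.continuous_boundaryPoint.measurableEmbedding h.boundaryPoint_injective

omit h in
theorem toSphere_eq_euclideanHausdorffMeasure (hE : finrank ℝ E = m + 1)
    (s : Set (sphere (0 : E) 1)) : (volume : Measure E).toSphere s = μHE[m] (Subtype.val '' s) := by
  rw [← comap_euclideanHausdorffMeasure_sphere hE]
  exact (MeasurableEmbedding.subtype_coe isClosed_sphere.measurableSet).comap_apply _ _

omit h in
theorem pow_mul_toSphere (hE : finrank ℝ E = m + 1) {τ : ℝ} (hτ : 0 < τ)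
    (s : Set (sphere (0 : E) 1)) :
    ENNReal.ofReal (τ ^ m) * (volume : Measure E).toSphere s
      = μHE[m] ((fun θ : sphere (0 : E) 1 ↦ τ • (θ : E)) '' s) := by
  have : (fun θ : sphere (0 : E) 1 ↦ τ • (θ : E)) '' s = τ • (Subtype.val '' s) := by
    rw [← image_smul, image_image]
  rw [this, euclideanHausdorffMeasure_smul₀ _ hτ.ne', ENNReal.smul_def, smul_eq_mul,
    toSphere_eq_euclideanHausdorffMeasure hE, ENNReal.ofReal_pow hτ.le, ENNReal.coe_pow,
    ← Real.enorm_of_nonneg hτ.le]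
  rfl

theorem pow_mul_toSphere_le (hE : finrank ℝ E = m + 1) {τ : ℝ} (hτ : 0 < τ)
    {s : Set (sphere (0 : E) 1)} (hs : ∀ θ ∈ s, τ ≤ radialFun Ω θ) :
    ENNReal.ofReal (τ ^ m) * (volume : Measure E).toSphere s
      ≤ (μHE[m]).comap (boundaryPoint Ω) s := by
  rw [h.measurableEmbedding_boundaryPoint.comap_apply, pow_mul_toSphere hE hτ]
  refine euclideanHausdorffMeasure_le_of_expanding (f := fun x ↦ (gauge Ω x)⁻¹ • x) ?_ ?_ m
  · rintro _ ⟨θ, hθ, rfl⟩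
    refine ⟨θ, hθ, ?_⟩
    simp only [gauge_smul_of_nonneg hτ.le, smul_eq_mul, boundaryPoint, radialFun, smul_smul]
    rw [mul_inv_rev, mul_assoc, inv_mul_cancel₀ hτ.ne', mul_one]
  · rintro _ ⟨θ, hθ, rfl⟩ _ ⟨η, hη, rfl⟩
    have key : ∀ θ : sphere (0 : E) 1, (gauge Ω (τ • (θ : E)))⁻¹ • τ • (θ : E)
        = radialFun Ω θ • (θ : E) := by
      intro θ
      simp only [gauge_smul_of_nonneg hτ.le, smul_eq_mul, radialFun, smul_smul]
      rw [mul_inv_rev, mul_assoc, inv_mul_cancel₀ hτ.ne', mul_one]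
    simp only [key, dist_eq_norm]
    exact norm_smul_sub_smul_le (norm_eq_of_mem_sphere _) (norm_eq_of_mem_sphere _) hτ.le
      (hs θ hθ) (hs η hη)

/-- Inside a ball, the boundary of a convex set has at most the area of the part of the sphere
lying outside the set. -/
theorem comap_boundaryPoint_radialFun_lt_le (hE : finrank ℝ E = m + 1) {τ : ℝ} (hτ : 0 < τ) :
    (μHE[m]).comap (boundaryPoint Ω) {θ | radialFun Ω θ < τ}
      ≤ ENNReal.ofReal (τ ^ m) * (volume : Measure E).toSphere {θ | radialFun Ω θ < τ} := by
  rw [h.measurableEmbedding_boundaryPoint.comap_apply, pow_mul_toSphere hE hτ]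
  have hex : ∀ x ∈ boundaryPoint Ω '' {θ | radialFun Ω θ < τ}, ∃ v : E, ∃ s : ℝ, 0 ≤ s ∧
      (∀ z ∈ closure Ω, ⟪v, z⟫ ≤ ⟪v, x⟫) ∧
      x + s • v ∈ (fun θ : sphere (0 : E) 1 ↦ τ • (θ : E)) '' {θ | radialFun Ω θ < τ} := by
    rintro _ ⟨θ, hθ, rfl⟩
    obtain ⟨v, hv, hvz⟩ := h.exists_unit_normal (x := boundaryPoint Ω θ)
      (h.range_boundaryPoint ▸ mem_range_self θ)
    have hnorm : ‖boundaryPoint Ω θ‖ < τ := by rw [h.norm_boundaryPoint]; exact hθ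
    have hcont : Continuous fun s : ℝ ↦ ‖boundaryPoint Ω θ + s • v‖ := by fun_prop
    obtain ⟨s, hs, hsτ⟩ : τ ∈ (fun s : ℝ ↦ ‖boundaryPoint Ω θ + s • v‖) '' Icc 0 (2 * τ) := by
      refine intermediate_value_Icc (by positivity) hcont.continuousOn ⟨?_, ?_⟩
      · simpa using hnorm.le
      · have := norm_sub_norm_le ((2 * τ) • v) (-boundaryPoint Ω θ)
        rw [sub_neg_eq_add, add_comm _ (boundaryPoint Ω θ), norm_neg, norm_smul, hv,
          Real.norm_of_nonneg (by positivity)] at this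
        linarith
    simp only at hsτ
    refine ⟨v, s, hs.1, hvz, ⟨τ⁻¹ • (boundaryPoint Ω θ + s • v), ?_⟩, ?_, ?_⟩
    · rw [mem_sphere_zero_iff_norm, norm_smul, hsτ, Real.norm_of_nonneg (by positivity),
        inv_mul_cancel₀ hτ.ne']
    · have hs0 : 0 < s := by
        refine lt_of_le_of_ne hs.1 ?_
        rintro rfl
        simp only [zero_smul, add_zero] at hsτ
        exact hnorm.ne hsτ
      have hout : boundaryPoint Ω θ + s • v ∉ closure Ω := by
        intro hmem
        have := hvz _ hmem
        rw [inner_add_right, real_inner_smul_right, real_inner_self_eq_norm_sq, hv] at this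
        linarith
      rw [← gauge_le_one_iff_mem_closure h.convex h.mem_nhds, not_le] at hout
      simp only [mem_ofPred_eq, radialFun]
      rw [gauge_smul_of_nonneg (inv_nonneg.2 hτ.le), smul_eq_mul, mul_inv, inv_inv]
      exact mul_lt_of_lt_one_right hτ (inv_lt_one_of_one_lt₀ hout)
    · simp [smul_smul, hτ.ne']
  choose! v s hs hvz hmaps using hex
  refine euclideanHausdorffMeasure_le_of_expanding (f := fun x ↦ x + s x • v x) hmaps ?_ m
  intro x hx y hy
  have hsub : ∀ x ∈ boundaryPoint Ω '' {θ | radialFun Ω θ < τ}, x ∈ closure Ω := by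
    rintro _ ⟨θ, -, rfl⟩
    exact frontier_subset_closure (h.range_boundaryPoint ▸ mem_range_self θ)
  rw [dist_eq_norm, dist_eq_norm]
  refine (pow_le_pow_iff_left₀ (norm_nonneg _) (norm_nonneg _) two_ne_zero).1 ?_
  have h1 : 0 ≤ ⟪x - y, v x⟫ := by
    rw [real_inner_comm, inner_sub_right]
    linarith [hvz x hx y (hsub y hy)]
  have h2 : ⟪x - y, v y⟫ ≤ 0 := by
    rw [real_inner_comm, inner_sub_right]
    linarith [hvz y hy x (hsub x hx)]
  have h3 : x + s x • v x - (y + s y • v y) = (x - y) + (s x • v x - s y • v y) := by abel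
  rw [h3, norm_add_sq_real, inner_sub_right, real_inner_smul_right, real_inner_smul_right]
  nlinarith [mul_nonneg (hs x hx) h1, mul_nonneg (hs y hy) (neg_nonneg.2 h2),
    sq_nonneg ‖s x • v x - s y • v y‖]

/-- The area of the boundary dominates the area element of a graph parallel to the sphere. -/
theorem withDensity_radialFun_pow_le (hE : finrank ℝ E = m + 1) (hm : m ≠ 0) :
    (volume : Measure E).toSphere.withDensity (fun θ ↦ ENNReal.ofReal (radialFun Ω θ ^ m))
      ≤ (μHE[m]).comap (boundaryPoint Ω) := by
  refine Measure.le_iff.2 fun s hs ↦ ?_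
  rw [withDensity_apply _ hs, lintegral]
  refine iSup₂_le fun φ hφ ↦ ?_
  rw [SimpleFunc.lintegral]
  calc ∑ c ∈ φ.range, c * (volume : Measure E).toSphere.restrict s (φ ⁻¹' {c})
      ≤ ∑ c ∈ φ.range, (μHE[m]).comap (boundaryPoint Ω) (φ ⁻¹' {c} ∩ s) := by
        refine Finset.sum_le_sum fun c _ ↦ ?_
        rw [Measure.restrict_apply (φ.measurableSet_preimage _)]
        rcases eq_or_ne c 0 with rfl | hc
        · simp
        have hle : ∀ θ ∈ φ ⁻¹' {c} ∩ s, c ≤ ENNReal.ofReal (radialFun Ω θ ^ m) := by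
          rintro θ ⟨rfl, -⟩
          exact hφ θ
        rcases (φ ⁻¹' {c} ∩ s).eq_empty_or_nonempty with he | ⟨θ₀, hθ₀⟩
        · simp [he]
        have hctop : c ≠ ∞ := ((hle θ₀ hθ₀).trans_lt ENNReal.ofReal_lt_top).ne
        have hd : 0 < c.toReal := ENNReal.toReal_pos hc hctop
        have hpow : (c.toReal ^ ((m : ℝ)⁻¹)) ^ m = c.toReal := Real.rpow_inv_natCast_pow hd.le hm
        have := h.pow_mul_toSphere_le hE (Real.rpow_pos_of_pos hd _) (s := φ ⁻¹' {c} ∩ s)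
          (τ := c.toReal ^ ((m : ℝ)⁻¹)) fun θ hθ ↦ by
            rw [← pow_le_pow_iff_left₀ (by positivity) (h.radialFun_pos θ).le hm, hpow]
            exact ENNReal.toReal_le_of_le_ofReal (pow_nonneg (h.radialFun_pos θ).le _) (hle θ hθ)
        rwa [hpow, ENNReal.ofReal_toReal hctop] at this
    _ ≤ (μHE[m]).comap (boundaryPoint Ω) s := by
        rw [← measure_biUnion_finset]
        · exact measure_mono (iUnion₂_subset fun _ _ ↦ inter_subset_right)
        · intro c _ d _ hcd
          exact Disjoint.mono inter_subset_left inter_subset_left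
            (Disjoint.preimage _ (disjoint_singleton.2 hcd))
        · exact fun c _ ↦ (φ.measurableSet_preimage _).inter hs

end IsPointedConvexDomain

end ConvexBoundary

section Polar

open Set Module Measure
open scoped Pointwise ENNReal NNReal RealInnerProductSpace Topology

variable {E : Type*} [NormedAddCommGroup E] [InnerProductSpace ℝ E] [FiniteDimensional ℝ E]
  [MeasurableSpace E] [BorelSpace E] {m : ℕ}

/-- Integration in polar coordinates. -/
theorem lintegral_eq_lintegral_polar (hE : finrank ℝ E = m + 1) {f : E → ℝ≥0∞} (hf : Measurable f) :
    ∫⁻ x, f x = ∫⁻ θ : sphere (0 : E) 1, ∫⁻ r in Ioi (0 : ℝ),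
      ENNReal.ofReal (r ^ m) * f (r • (θ : E)) ∂volume ∂(volume : Measure E).toSphere := by
  have hnt : Nontrivial E := nontrivial_of_finrank_pos (R := ℝ) (by omega)
  have hmp := (volume : Measure E).measurePreserving_homeomorphUnitSphereProd
  rw [hE, Nat.add_sub_cancel] at hmp
  have h0 : ∫⁻ x, f x = ∫⁻ x : ({0}ᶜ : Set E), f (x : E) ∂((volume : Measure E).comap Subtype.val) := by
    rw [lintegral_subtype_comap (measurableSet_singleton _).compl f, restrict_compl_singleton]
  have h1 : ∀ x : ({0}ᶜ : Set E), f (x : E) = (fun q : sphere (0 : E) 1 × Ioi (0 : ℝ) ↦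
      f ((q.2 : ℝ) • (q.1 : E))) (homeomorphUnitSphereProd E x) := by
    intro x
    have : (x : E) ≠ 0 := x.2
    simp [smul_smul, this]
  have hmeas : Measurable (fun q : sphere (0 : E) 1 × Ioi (0 : ℝ) ↦ f ((q.2 : ℝ) • (q.1 : E))) := by
    fun_prop
  rw [h0, lintegral_congr h1, hmp.lintegral_comp hmeas, lintegral_prod _ hmeas.aemeasurable]
  refine lintegral_congr fun θ ↦ ?_
  rw [volumeIoiPow, lintegral_withDensity_eq_lintegral_mul _ (by fun_prop) (by fun_prop)]
  exact lintegral_subtype_comap measurableSet_Ioi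
    (fun r ↦ ENNReal.ofReal (r ^ m) * f (r • (θ : E)))

theorem IsPointedConvexDomain.volume_eq_lintegral {Ω : Set E} (h : IsPointedConvexDomain Ω)
    (hE : finrank ℝ E = m + 1) : (m + 1) * volume Ω
      = ∫⁻ θ, ENNReal.ofReal (radialFun Ω θ ^ (m + 1)) ∂(volume : Measure E).toSphere := by
  have h1 : volume Ω = ∫⁻ x, Ω.indicator 1 x := by
    rw [lintegral_indicator_one h.isOpen.measurableSet]
  rw [h1, lintegral_eq_lintegral_polar hE (measurable_one.indicator h.isOpen.measurableSet),
    ← lintegral_const_mul' _ _ (by finiteness)]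
  refine lintegral_congr fun θ ↦ ?_
  have h2 : ∫⁻ r in Ioi (0 : ℝ), ENNReal.ofReal (r ^ m) * Ω.indicator 1 (r • (θ : E))
      = ∫⁻ r in Ioo 0 (radialFun Ω θ), ENNReal.ofReal (r ^ m) := by
    rw [← lintegral_indicator measurableSet_Ioi, ← lintegral_indicator measurableSet_Ioo]
    refine lintegral_congr fun r ↦ ?_
    by_cases hr : 0 < r
    · by_cases hr2 : r < radialFun Ω θ
      · simp [hr, hr2, (h.smul_mem_iff θ hr.le).2 hr2]
      · simp [hr, hr2, h.smul_mem_iff θ hr.le]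
    · simp [hr]
  rw [h2, ← ofReal_integral_eq_lintegral_ofReal, ← integral_Ioc_eq_integral_Ioo,
    ← intervalIntegral.integral_of_le (h.radialFun_pos θ).le, integral_pow]
  · have : ((m : ℝ≥0∞) + 1) = ENNReal.ofReal (m + 1) := by
      rw [ENNReal.ofReal_add (by positivity) zero_le_one]; simp
    rw [this, ← ENNReal.ofReal_mul (by positivity)]
    congr 1
    field_simp
    simp
  · exact (continuous_pow m).integrableOn_Icc.mono_set Ioo_subset_Icc_self
  · exact (ae_restrict_iff' measurableSet_Ioo).2 (ae_of_all _ fun x hx ↦ by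
      simpa using pow_nonneg hx.1.le m)

end Polar

section Moment

open Set Module Measure
open scoped Pointwise ENNReal NNReal RealInnerProductSpace Topology

theorem pow_tangent_le {x y : ℝ} (hx : 0 < x) (hy : 0 ≤ y) (k : ℕ) :
    x ^ (k + 1) + (k + 1) * x ^ k * (y - x) ≤ y ^ (k + 1) := by
  have h := one_add_mul_le_pow (a := y / x - 1) (by linarith [div_nonneg hy hx.le]) (k + 1)
  have h2 := mul_le_mul_of_nonneg_left h (pow_pos hx (k + 1)).le
  rw [← mul_pow] at h2
  have h3 : x * (1 + (y / x - 1)) = y := by field_simp; ring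
  rw [h3] at h2
  refine le_trans (le_of_eq ?_) h2
  push_cast
  rw [pow_succ]
  field_simp

/-- The integrand (per unit solid angle) controlling the deficit in the second moment inequality. -/
noncomputable def momentDeficit (m : ℕ) (R x : ℝ) : ℝ :=
  max (x ^ 2 - R ^ 2 / m) 0 * x ^ m
    - 2 / (m + 2) * ((R / √m) ^ (m + 2) - min x (R / √m) ^ (m + 2)) + R ^ 2 / m * R ^ m - R * x ^ (m + 1)

theorem momentDeficit_pos {m : ℕ} (hm : m ≠ 0) {R x : ℝ} (hR : 0 < R) (hx : 0 < x) (hxR : x ≠ R) :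
    0 < momentDeficit m R x := by
  obtain ⟨k, rfl⟩ : ∃ k, m = k + 1 := ⟨m - 1, by omega⟩
  unfold momentDeficit
  have hk : (0 : ℝ) < ((k + 1 : ℕ) : ℝ) := by positivity
  have hq : (R / √((k + 1 : ℕ) : ℝ)) ^ 2 = R ^ 2 / ((k + 1 : ℕ) : ℝ) := by
    rw [div_pow, sq_sqrt hk.le]
  have hqR : R / √((k + 1 : ℕ) : ℝ) ≤ R := by
    refine div_le_self hR.le ?_
    rw [Real.one_le_sqrt]
    exact_mod_cast Nat.le_add_left 1 k
  have hq0 : 0 < R / √((k + 1 : ℕ) : ℝ) := by positivity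
  generalize R / √((k + 1 : ℕ) : ℝ) = q at *
  rw [← hq]
  have hRk : R ^ 2 = (k + 1) * q ^ 2 := by
    rw [hq]; push_cast; field_simp
  rcases le_or_gt q x with hqx | hqx
  · rw [min_eq_right hqx, max_eq_left (by nlinarith), sub_self, mul_zero, sub_zero]
    have h1 := pow_tangent_le hx hR.le k
    have h2 : 0 < x ^ k * ((x - R) * (x ^ 2 - R ^ 2)) := by
      refine mul_pos (by positivity) ?_
      have : (x - R) * (x ^ 2 - R ^ 2) = (x - R) ^ 2 * (x + R) := by ring
      rw [this]
      have : 0 < (x - R) ^ 2 := by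
        have := sub_ne_zero.2 hxR
        positivity
      positivity
    have h3 := mul_le_mul_of_nonneg_left h1 (sq_nonneg q)
    have h4 : x ^ k * ((x - R) * (x ^ 2 - (k + 1) * q ^ 2)) =
      (x ^ 2 - q ^ 2) * x ^ (k + 1) + q ^ 2 * (x ^ (k + 1) + (k + 1) * x ^ k * (R - x))
        - R * x ^ (k + 1 + 1) := by ring
    rw [hRk, h4] at h2
    linarith
  · rw [min_eq_left hqx.le, max_eq_right (by nlinarith), zero_mul, zero_sub]
    have h1 := mul_le_mul_of_nonneg_left (pow_tangent_le hx hq0.le (k + 1)) hq0.le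
    have h2 : q ^ k ≤ R ^ k := by gcongr
    have h3 : q ^ (k + 2) * R ≤ q ^ 2 * R ^ (k + 1) := by
      have : q ^ 2 * R * q ^ k ≤ q ^ 2 * R * R ^ k := by gcongr
      calc q ^ (k + 2) * R = q ^ 2 * R * q ^ k := by ring
        _ ≤ _ := this
        _ = _ := by ring
    have h5 : 0 < (k + 2) * x ^ (k + 1) * (q - x) ^ 2 := by
      have : 0 < q - x := by linarith
      positivity
    have h6 : (0 : ℝ) ≤ (q ^ (k + 2) - x ^ (k + 2)) := by
      have : x ^ (k + 2) ≤ q ^ (k + 2) := by gcongr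
      linarith
    have h7 : q * (q ^ (k + 2) - x ^ (k + 2)) ≤ R * (q ^ (k + 2) - x ^ (k + 2)) := by gcongr
    have h8 : (2 / (((k + 1 : ℕ) : ℝ) + 2)) * (q ^ (k + 1 + 2) - x ^ (k + 1 + 2))
        < q * (q ^ (k + 2) - x ^ (k + 2)) := by
      push_cast at h1 ⊢
      have hk3 : (0 : ℝ) < k + 1 + 2 := by positivity
      rw [div_mul_eq_mul_div, div_lt_iff₀ hk3]
      have h9 : 0 ≤ k * x ^ (k + 2) * (q - x) := by
        have : 0 < q - x := by linarith
        positivity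
      have hk0 : (0 : ℝ) ≤ k := by positivity
      have h10 := mul_le_mul_of_nonneg_left h1 hk0
      ring_nf at h1 h5 h9 h10 ⊢
      nlinarith [mul_pos h5 hk3]
    have e1 : R * q ^ (k + 2) = q ^ (k + 2) * R := by ring
    have e2 : x ^ (k + 1 + 1) = x ^ (k + 2) := rfl
    rw [e2]
    linarith

theorem momentDeficit_self {m : ℕ} (hm : m ≠ 0) {R : ℝ} (hR : 0 < R) : momentDeficit m R R = 0 := by
  have h1 : (1 : ℝ) ≤ m := by exact_mod_cast Nat.one_le_iff_ne_zero.2 hm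
  have hqR : R / √m ≤ R := div_le_self hR.le (by rwa [Real.one_le_sqrt])
  have h2 : R ^ 2 / m ≤ R ^ 2 := div_le_self (by positivity) h1
  rw [momentDeficit, min_eq_right hqR, max_eq_left (by linarith)]
  ring

theorem continuous_momentDeficit (m : ℕ) (R : ℝ) : Continuous (momentDeficit m R) := by
  unfold momentDeficit
  fun_prop

theorem integral_two_mul_max_pow {q a : ℝ} (haq : a ≤ q) (ha : 0 ≤ a) (k : ℕ) :
    ∫ t in (0 : ℝ)..(q - a), 2 * max (q - t) 0 ^ (k + 1)
      = 2 / (k + 2) * (q ^ (k + 2) - a ^ (k + 2)) := by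
  have h1 : ∫ t in (0 : ℝ)..(q - a), 2 * max (q - t) 0 ^ (k + 1)
      = ∫ t in (0 : ℝ)..(q - a), 2 * (q - t) ^ (k + 1) := by
    refine intervalIntegral.integral_congr fun t ht ↦ ?_
    rw [uIcc_of_le (by linarith)] at ht
    rw [max_eq_left (by linarith [ht.2])]
  rw [h1, intervalIntegral.integral_const_mul,
    intervalIntegral.integral_comp_sub_left (fun x ↦ x ^ (k + 1)) q, integral_pow]
  push_cast
  rw [sub_sub_cancel, sub_zero]
  ring

variable {E : Type*} [NormedAddCommGroup E] [InnerProductSpace ℝ E] [FiniteDimensional ℝ E]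
  [MeasurableSpace E] [BorelSpace E] {m : ℕ}

namespace IsPointedConvexDomain

variable {Ω : Set E} (h : IsPointedConvexDomain Ω)
include h

theorem lintegral_min_radialFun_le (hE : finrank ℝ E = m + 1) {q : ℝ} (hq : 0 ≤ q) :
    ∫⁻ θ, ENNReal.ofReal (q ^ 2 - min (radialFun Ω θ) q ^ 2) ∂((μHE[m]).comap (boundaryPoint Ω))
      ≤ ∫⁻ θ, ENNReal.ofReal (2 / (m + 2) * (q ^ (m + 2) - min (radialFun Ω θ) q ^ (m + 2)))
        ∂(volume : Measure E).toSphere := by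
  have key : ∀ (k : ℕ) (ν : Measure (sphere (0 : E) 1)),
      ∫⁻ θ, ENNReal.ofReal (2 / (k + 2) * (q ^ (k + 2) - min (radialFun Ω θ) q ^ (k + 2))) ∂ν
        = ∫⁻ t in Ioi 0, ν {θ | t < q - min (radialFun Ω θ) q}
            * ENNReal.ofReal (2 * max (q - t) 0 ^ (k + 1)) := by
    intro k ν
    rw [← lintegral_comp_eq_lintegral_meas_lt_mul]
    · refine lintegral_congr fun θ ↦ ?_
      rw [integral_two_mul_max_pow (min_le_right _ _) (le_min (h.radialFun_pos θ).le hq)]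
    · exact ae_of_all _ fun θ ↦ sub_nonneg.2 (min_le_right _ _)
    · exact (continuous_const.sub (h.continuous_radialFun.min continuous_const)).aemeasurable
    · exact fun t _ ↦ Continuous.intervalIntegrable (by fun_prop) _ _
    · exact ae_of_all _ fun t ↦ by positivity
  rw [key m]
  have h0 := key 0 ((μHE[m]).comap (boundaryPoint Ω))
  rw [show (2 : ℝ) / ((0 : ℕ) + 2) = 1 by norm_num] at h0
  simp only [one_mul, zero_add, pow_one] at h0
  rw [h0]
  refine setLIntegral_mono' measurableSet_Ioi fun t ht ↦ ?_
  have hset : {θ : sphere (0 : E) 1 | t < q - min (radialFun Ω θ) q}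
      = {θ | radialFun Ω θ < q - t} := by
    ext θ
    simp only [mem_ofPred_eq]
    rw [lt_sub_comm, min_lt_iff, or_iff_left]
    simpa using (mem_Ioi.1 ht).le
  rw [hset]
  rcases le_or_gt q t with hqt | hqt
  · have : {θ : sphere (0 : E) 1 | radialFun Ω θ < q - t} = ∅ := by
      refine eq_empty_iff_forall_notMem.2 fun θ hθ ↦ ?_
      have := h.radialFun_pos θ
      simp only [mem_ofPred_eq] at hθ
      linarith
    simp [this]
  · have hτ : 0 < q - t := by linarith
    rw [max_eq_left hτ.le]
    refine (mul_le_mul_left (h.comap_boundaryPoint_radialFun_lt_le hE hτ) _).trans_eq ?_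
    rw [pow_succ, mul_comm (ENNReal.ofReal _), mul_assoc, ← ENNReal.ofReal_mul (by positivity)]
    congr 2
    ring

omit [FiniteDimensional ℝ E] [MeasurableSpace E] [BorelSpace E] in
theorem eq_ball_of_radialFun_eq {R : ℝ} (hR : 0 < R) (hρ : ∀ θ, radialFun Ω θ = R) :
    Ω = ball 0 R := by
  ext x
  rcases eq_or_ne x 0 with rfl | hx
  · simp [h.zero_mem, hR]
  · have hx' : 0 < ‖x‖ := norm_pos_iff.2 hx
    have := h.smul_mem_iff ⟨‖x‖⁻¹ • x, by simp [norm_smul, hx'.ne']⟩ hx'.le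
    rw [hρ] at this
    simpa [smul_smul, hx'.ne'] using this

/-- Weighted isoperimetric inequality for the second moment of the boundary. -/
theorem mul_volume_lt_integral_norm_sq (hE : finrank ℝ E = m + 1) (hm : m ≠ 0) {R : ℝ} (hR : 0 < R)
    (hper : μHE[m] (frontier Ω) = ENNReal.ofReal (R ^ m) * (volume : Measure E).toSphere univ)
    (hne : Ω ≠ ball 0 R) :
    R * ((m + 1) * volume.real Ω) < ∫ x in frontier Ω, ‖x‖ ^ 2 ∂μHE[m] := by
  have hme := h.measurableEmbedding_boundaryPoint
  set ν := (μHE[m]).comap (boundaryPoint Ω) with hν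
  set σ := (volume : Measure E).toSphere with hσ
  set ρ := radialFun Ω with hρdef
  have hρ := h.continuous_radialFun
  have hρ0 := h.radialFun_pos
  have hνuniv : ν univ = ENNReal.ofReal (R ^ m) * σ univ := by
    rw [hν, hme.comap_apply, image_univ, h.range_boundaryPoint, hper]
  have : IsFiniteMeasure ν := ⟨by rw [hνuniv]; finiteness⟩
  have hInt : ∀ (κ : Measure (sphere (0 : E) 1)) [IsFiniteMeasure κ] {f : sphere (0 : E) 1 → ℝ},
      Continuous f → Integrable f κ := fun κ _ f hf ↦
    hf.integrable_of_hasCompactSupport (HasCompactSupport.of_compactSpace f)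
  have hM : ∫ x in frontier Ω, ‖x‖ ^ 2 ∂μHE[m] = ∫ θ, ρ θ ^ 2 ∂ν := by
    rw [← h.range_boundaryPoint, ← hme.map_comap, hme.integral_map]
    simp_rw [h.norm_boundaryPoint]
    rfl
  have hvol : (m + 1) * volume.real Ω = ∫ θ, ρ θ ^ (m + 1) ∂σ := by
    have h1 := h.volume_eq_lintegral hE
    rw [← ofReal_integral_eq_lintegral_ofReal (hInt _ (by fun_prop))
      (ae_of_all _ fun θ ↦ (pow_pos (hρ0 θ) _).le)] at h1
    have h2 := congrArg ENNReal.toReal h1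
    rw [ENNReal.toReal_ofReal (integral_nonneg fun θ ↦ (pow_pos (hρ0 θ) _).le),
      ENNReal.toReal_mul] at h2
    rw [← h2, Measure.real]
    congr 1
  have hm0 : (0 : ℝ) < m := by exact_mod_cast Nat.pos_of_ne_zero hm
  set q := R / √m with hq
  have hq0 : 0 < q := by positivity
  have hq2 : R ^ 2 / m = q ^ 2 := by rw [hq, div_pow, sq_sqrt hm0.le]
  have hA : ∫ θ, max (ρ θ ^ 2 - q ^ 2) 0 * ρ θ ^ m ∂σ ≤ ∫ θ, max (ρ θ ^ 2 - q ^ 2) 0 ∂ν := by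
    have h1 := integral_mono_measure (h.withDensity_radialFun_pow_le hE hm)
      (f := fun θ ↦ max (ρ θ ^ 2 - q ^ 2) 0) (ae_of_all _ fun θ ↦ le_max_right _ _)
      (hInt ν (by fun_prop))
    rw [integral_withDensity_eq_integral_toReal_smul (by fun_prop) (by simp)] at h1
    refine le_trans (le_of_eq (integral_congr_ae (ae_of_all _ fun θ ↦ ?_))) h1
    simp only [smul_eq_mul]
    rw [ENNReal.toReal_ofReal (pow_pos (hρ0 θ) _).le, mul_comm]
  have hmin0 : ∀ θ, 0 ≤ min (ρ θ) q := fun θ ↦ le_min (hρ0 θ).le hq0.le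
  have hnn : ∀ (k : ℕ) θ, 0 ≤ q ^ k - min (ρ θ) q ^ k := fun k θ ↦
    sub_nonneg.2 (pow_le_pow_left₀ (hmin0 θ) (min_le_right _ _) k)
  have hB : ∫ θ, (q ^ 2 - min (ρ θ) q ^ 2) ∂ν
      ≤ ∫ θ, 2 / (m + 2) * (q ^ (m + 2) - min (ρ θ) q ^ (m + 2)) ∂σ := by
    have h1 := h.lintegral_min_radialFun_le hE hq0.le
    have h3 : ∀ θ, 0 ≤ 2 / ((m : ℝ) + 2) * (q ^ (m + 2) - min (ρ θ) q ^ (m + 2)) :=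
      fun θ ↦ mul_nonneg (by positivity) (hnn _ θ)
    rwa [← ofReal_integral_eq_lintegral_ofReal (hInt _ (by fun_prop)) (ae_of_all _ (hnn 2)),
      ← ofReal_integral_eq_lintegral_ofReal (hInt _ (by fun_prop)) (ae_of_all _ h3),
      ENNReal.ofReal_le_ofReal_iff (integral_nonneg h3)] at h1
  have hsplit : ∫ θ, ρ θ ^ 2 ∂ν = ∫ θ, max (ρ θ ^ 2 - q ^ 2) 0 ∂ν
      - ∫ θ, (q ^ 2 - min (ρ θ) q ^ 2) ∂ν + q ^ 2 * (R ^ m * σ.real univ) := by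
    have h1 : ν.real univ = R ^ m * σ.real univ := by
      rw [Measure.real, hνuniv, ENNReal.toReal_mul, ENNReal.toReal_ofReal (by positivity),
        Measure.real]
    rw [← h1, ← integral_sub (hInt _ (by fun_prop)) (hInt _ (by fun_prop)),
      mul_comm, ← smul_eq_mul, ← integral_const (μ := ν),
      ← integral_add (hInt _ (by fun_prop)) (hInt _ (by fun_prop))]
    refine integral_congr_ae (ae_of_all _ fun θ ↦ ?_)
    have := hρ0 θ
    simp only
    rcases le_total (ρ θ) q with hle | hle
    · rw [min_eq_left hle, max_eq_right (by nlinarith)]; ring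
    · rw [min_eq_right hle, max_eq_left (by nlinarith)]; ring
  have hpos : 0 < ∫ θ, momentDeficit m R (ρ θ) ∂σ := by
    obtain ⟨θ₀, hθ₀⟩ : ∃ θ, ρ θ ≠ R := by
      by_contra! hcon
      exact hne (h.eq_ball_of_radialFun_eq hR hcon)
    refine Continuous.integral_pos_of_hasCompactSupport_nonneg_nonzero
      ((continuous_momentDeficit m R).comp hρ) (HasCompactSupport.of_compactSpace _)
      (fun θ ↦ ?_) (x := θ₀) (momentDeficit_pos hm hR (hρ0 θ₀) hθ₀).ne'
    rcases eq_or_ne (ρ θ) R with he | he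
    · simp only
      rw [he, momentDeficit_self hm hR]; rfl
    · exact (momentDeficit_pos hm hR (hρ0 θ) he).le
  have hexp : ∫ θ, momentDeficit m R (ρ θ) ∂σ = ∫ θ, max (ρ θ ^ 2 - q ^ 2) 0 * ρ θ ^ m ∂σ
      - ∫ θ, 2 / (m + 2) * (q ^ (m + 2) - min (ρ θ) q ^ (m + 2)) ∂σ
      + q ^ 2 * (R ^ m * σ.real univ) - R * ∫ θ, ρ θ ^ (m + 1) ∂σ := by
    have h1 : q ^ 2 * (R ^ m * σ.real univ) = ∫ θ, q ^ 2 * R ^ m ∂σ := by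
      rw [integral_const, smul_eq_mul]; ring
    rw [h1, ← integral_const_mul, ← integral_sub (hInt _ (by fun_prop)) (hInt _ (by fun_prop)),
      ← integral_add (hInt _ (by fun_prop)) (hInt _ (by fun_prop)),
      ← integral_sub (hInt _ (by fun_prop)) (hInt _ (by fun_prop))]
    refine integral_congr_ae (ae_of_all _ fun θ ↦ ?_)
    simp only [momentDeficit, ← hq, hq2]
  rw [hM, hvol, hsplit]
  linarith

end IsPointedConvexDomain

end Moment

section Barycenter

open Set Module Measure
open scoped Pointwise ENNReal NNReal RealInnerProductSpace Topology

variable {E : Type*} [NormedAddCommGroup E] [InnerProductSpace ℝ E] [FiniteDimensional ℝ E]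
  [MeasurableSpace E] [BorelSpace E] {m : ℕ}

omit [InnerProductSpace ℝ E] [FiniteDimensional ℝ E] in
theorem Continuous.integrableOn_of_isCompact {F : Type*} [NormedAddCommGroup F]
    [SecondCountableTopology F] {f : E → F}
    (hf : Continuous f) {K : Set E} (hK : IsCompact K) {μ : Measure E} (hμ : μ K ≠ ∞) :
    IntegrableOn f K μ := by
  obtain ⟨C, hC⟩ := hK.exists_bound_of_continuousOn hf.continuousOn
  refine Measure.integrableOn_of_bounded hμ hf.aestronglyMeasurable (M := C) ?_
  exact (ae_restrict_iff' hK.measurableSet).2 (ae_of_all _ hC)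

namespace IsPointedConvexDomain

variable {Ω : Set E} (h : IsPointedConvexDomain Ω)
include h

omit [MeasurableSpace E] [BorelSpace E] in
theorem isCompact_frontier : IsCompact (frontier Ω) :=
  h.isBounded.isCompact_closure.of_isClosed_subset isClosed_frontier frontier_subset_closure

/-- The barycenter of the boundary of a convex domain lies in the domain. -/
theorem average_frontier_mem (hE : finrank ℝ E = m + 1) (hm : m ≠ 0)
    (hfin : μHE[m] (frontier Ω) ≠ ∞) (hpos : μHE[m] (frontier Ω) ≠ 0) :
    ⨍ x in frontier Ω, x ∂μHE[m] ∈ Ω := by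
  set c := ⨍ x in frontier Ω, x ∂μHE[m] with hc
  have : IsFiniteMeasure ((μHE[m] : Measure E).restrict (frontier Ω)) :=
    ⟨by simpa using hfin.lt_top⟩
  have : NeZero ((μHE[m] : Measure E).restrict (frontier Ω)) := ⟨by simpa using hpos⟩
  by_contra hcon
  obtain ⟨f, hf⟩ := geometric_hahn_banach_open_point h.convex h.isOpen hcon
  have hfc : 0 < f c := by simpa using hf 0 h.zero_mem
  have hle : ∀ x ∈ frontier Ω, f x ≤ f c := fun x hx ↦
    closure_minimal (fun y hy ↦ (hf y hy).le) (isClosed_le f.continuous continuous_const)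
      (frontier_subset_closure hx)
  have hInt : IntegrableOn (fun x ↦ x) (frontier Ω) μHE[m] :=
    continuous_id.integrableOn_of_isCompact h.isCompact_frontier hfin
  have hzero : ∫ x in frontier Ω, (f c - f x) ∂μHE[m] = 0 := by
    rw [integral_sub (integrable_const _) (f.integrable_comp hInt), f.integral_comp_comm hInt,
      integral_const, ← measure_smul_average, ← hc, map_smul, sub_self]
  rw [integral_eq_zero_iff_of_nonneg_ae
    ((ae_restrict_iff' h.isCompact_frontier.measurableSet).2
      (ae_of_all _ fun x hx ↦ sub_nonneg.2 (hle x hx)))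
    ((integrable_const _).sub (f.integrable_comp hInt))] at hzero
  have hnull : (μHE[m]) (boundaryPoint Ω '' {θ | f (θ : E) < 0}) = 0 := by
    rw [Filter.EventuallyEq, ae_restrict_iff' h.isCompact_frontier.measurableSet] at hzero
    refine measure_mono_null ?_ (ae_iff.1 hzero)
    rintro _ ⟨θ, hθ, rfl⟩
    have h1 : boundaryPoint Ω θ ∈ frontier Ω := by
      rw [← h.range_boundaryPoint]; exact mem_range_self θ
    have h2 : f (boundaryPoint Ω θ) < 0 := by
      rw [boundaryPoint, map_smul]
      exact mul_neg_of_pos_of_neg (h.radialFun_pos θ) hθ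
    simp only [mem_ofPred_eq, Pi.zero_apply, Classical.not_imp]
    exact ⟨h1, by linarith⟩
  rw [← h.measurableEmbedding_boundaryPoint.comap_apply] at hnull
  have hnull2 := withDensity_absolutelyContinuous'
    (μ := (volume : Measure E).toSphere) (f := fun θ ↦ ENNReal.ofReal (radialFun Ω θ ^ m))
    (by have := h.continuous_radialFun; fun_prop)
    (ae_of_all _ fun θ ↦ by simpa using pow_pos (h.radialFun_pos θ) m)
    (le_antisymm ((h.withDensity_radialFun_pow_le hE hm _).trans hnull.le) zero_le)
  have hopen : IsOpen {θ : sphere (0 : E) 1 | f (θ : E) < 0} :=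
    isOpen_lt (by fun_prop) continuous_const
  have hnt : Nontrivial E := nontrivial_of_finrank_pos (R := ℝ) (by omega)
  have hemp := (hopen.measure_eq_zero_iff _).1 hnull2
  have hc0 : c ≠ 0 := by
    intro hc0
    simp [hc0] at hfc
  have : (⟨-‖c‖⁻¹ • c, by simp [norm_smul, hc0]⟩ : sphere (0 : E) 1) ∈
      {θ : sphere (0 : E) 1 | f (θ : E) < 0} := by
    have : 0 < ‖c‖⁻¹ := by positivity
    simpa using mul_pos this hfc
  rw [hemp] at this
  exact this

/-- A test function for the Steklov quotient of a convex domain which is not a ball. -/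
theorem exists_test_function (hE : finrank ℝ E = m + 1) (hm : m ≠ 0) {R : ℝ} (hR : 0 < R)
    (hper : μHE[m] (frontier Ω) = ENNReal.ofReal (R ^ m) * (volume : Measure E).toSphere univ)
    (hne : ∀ c r, Ω ≠ ball c r) :
    ∃ u : E → ℝ, ContDiff ℝ 1 u ∧ ∫ x in frontier Ω, u x ∂μHE[m] = 0 ∧
      R * ∫ x in Ω, ‖fderiv ℝ u x‖ ^ 2 < ∫ x in frontier Ω, u x ^ 2 ∂μHE[m] := by
  have hnt : Nontrivial E := nontrivial_of_finrank_pos (R := ℝ) (by omega)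
  have hfin : μHE[m] (frontier Ω) ≠ ∞ := by rw [hper]; finiteness
  have hpos : μHE[m] (frontier Ω) ≠ 0 := by
    rw [hper]
    refine mul_ne_zero (by simpa using pow_pos hR m) ?_
    have := hnt
    obtain ⟨x, hx⟩ := NormedSpace.sphere_nonempty (x := (0 : E)) (r := 1) |>.2 zero_le_one
    exact (isOpen_univ.measure_pos _ ⟨⟨x, hx⟩, mem_univ _⟩).ne'
  have : IsFiniteMeasure ((μHE[m] : Measure E).restrict (frontier Ω)) :=
    ⟨by simpa using hfin.lt_top⟩
  have hcΩ := h.average_frontier_mem hE hm hfin hpos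
  set c := ⨍ x in frontier Ω, x ∂μHE[m] with hc
  let τ : E ≃ᵢ E := IsometryEquiv.addRight c
  have hτ : ∀ x, τ x = x + c := fun x ↦ rfl
  have hτm : MeasurePreserving τ μHE[m] μHE[m] := τ.measurePreserving_euclideanHausdorffMeasure m
  have hτe : MeasurableEmbedding τ := τ.toHomeomorph.measurableEmbedding
  have hfr : frontier (τ ⁻¹' Ω) = τ ⁻¹' frontier Ω := (τ.toHomeomorph.preimage_frontier Ω).symm
  have h' : IsPointedConvexDomain (τ ⁻¹' Ω) :=
    { isOpen := h.isOpen.preimage τ.continuous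
      isBounded := by
        have := τ.symm.isometry.lipschitz.isBounded_image h.isBounded
        rwa [IsometryEquiv.image_symm] at this
      convex := h.convex.translate_preimage_left c
      zero_mem := by simpa [hτ] using hcΩ }
  have hmom := h'.mul_volume_lt_integral_norm_sq hE hm hR
    (by rw [hfr, hτm.measure_preimage_emb hτe, hper]) (by
      intro he
      refine hne c R ?_
      rw [← image_preimage_eq Ω τ.surjective, he, τ.image_ball, hτ, zero_add])
  have hvol : volume.real (τ ⁻¹' Ω) = volume.real Ω := by
    rw [Measure.real, Measure.real]
    congr 1
    exact measure_preimage_add_right volume c Ω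
  have hInt : ∀ x, ‖x‖ ^ 2 = ‖τ x - c‖ ^ 2 := fun x ↦ by simp [hτ]
  rw [hvol, hfr, setIntegral_congr_fun (g := fun x ↦ ‖τ x - c‖ ^ 2) (by
      exact hτe.measurable h.isCompact_frontier.measurableSet) (fun x _ ↦ hInt x),
    hτm.setIntegral_preimage_emb hτe (fun y ↦ ‖y - c‖ ^ 2)] at hmom
  let e := stdOrthonormalBasis ℝ E
  by_contra! hcon
  refine hmom.not_ge ?_
  have hbound : ∀ i, ∫ x in frontier Ω, ⟪e i, x - c⟫ ^ 2 ∂μHE[m] ≤ R * volume.real Ω := by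
    intro i
    have hder : ∀ x, fderiv ℝ (fun x ↦ ⟪e i, x - c⟫) x = innerSL ℝ (e i) := fun x ↦
      ((innerSL ℝ (e i)).hasFDerivAt.comp x ((hasFDerivAt_id x).sub_const c)).fderiv
    have h1 := hcon (fun x ↦ ⟪e i, x - c⟫)
      ((innerSL ℝ (e i)).contDiff.comp (contDiff_id.sub contDiff_const)) (by
      have hi : IntegrableOn (fun x : E ↦ x) (frontier Ω) μHE[m] :=
        continuous_id.integrableOn_of_isCompact h.isCompact_frontier hfin
      rw [integral_inner (f := fun x ↦ x - c) (hi.sub (integrable_const c)), integral_sub hi (integrable_const c),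
        integral_const, ← measure_smul_average, ← hc, sub_self, inner_zero_right])
    simp only [hder, innerSL_apply_norm, e.norm_eq_one] at h1
    simpa using h1
  calc ∫ x in frontier Ω, ‖x - c‖ ^ 2 ∂μHE[m]
      = ∑ i, ∫ x in frontier Ω, ⟪e i, x - c⟫ ^ 2 ∂μHE[m] := by
        rw [← integral_finsetSum _ fun i _ ↦ (Continuous.integrableOn_of_isCompact (by fun_prop)
          h.isCompact_frontier hfin)]
        simp_rw [e.sum_sq_inner_right]
    _ ≤ ∑ i : Fin (finrank ℝ E), R * volume.real Ω := Finset.sum_le_sum fun i _ ↦ hbound i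
    _ = R * ((m + 1) * volume.real Ω) := by
        rw [Finset.sum_const, Finset.card_univ, Fintype.card_fin, hE, nsmul_eq_mul]
        push_cast
        ring

end IsPointedConvexDomain

end Barycenter

section CircleInequality

open Set

theorem fourierCoeffOn_sub {a b : ℝ} (hab : a < b) {f g : ℝ → ℂ} (hf : Continuous f)
    (hg : Continuous g) (n : ℤ) : fourierCoeffOn hab (fun x ↦ f x - g x) n
      = fourierCoeffOn hab f n - fourierCoeffOn hab g n := by
  have hc : Continuous fun x : ℝ ↦ fourier (-n) (x : AddCircle (b - a)) :=
    (map_continuous _).comp (AddCircle.continuous_mk' _)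
  simp only [fourierCoeffOn_eq_integral, smul_sub]
  rw [← smul_sub, ← intervalIntegral.integral_sub]
  · exact (hc.smul hf).intervalIntegrable _ _
  · exact (hc.smul hg).intervalIntegrable _ _

theorem fourierCoeffOn_comp_add {f : ℝ → ℂ} (hf : Function.Periodic f (2 * π)) (t : ℝ) (n : ℤ) :
    fourierCoeffOn two_pi_pos (fun x ↦ f (x + t)) n
      = Complex.exp (n * t * Complex.I) * fourierCoeffOn two_pi_pos f n := by
  have hexp : ∀ x : ℝ, fourier (-n) (x : AddCircle (2 * π - 0))
      = Complex.exp (-(n * x * Complex.I)) := by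
    intro x
    rw [fourier_coe_apply]
    congr 1
    have : (π : ℂ) ≠ 0 := by exact_mod_cast pi_ne_zero
    push_cast
    rw [sub_zero]
    field_simp
  simp only [fourierCoeffOn_eq_integral, hexp, smul_eq_mul]
  have hper : Function.Periodic (fun x : ℝ ↦ Complex.exp (-(n * x * Complex.I)) * f x) (2 * π) := by
    intro x
    simp only
    rw [hf x]
    congr 1
    rw [Complex.exp_eq_exp_iff_exists_int]
    refine ⟨-n, ?_⟩
    push_cast
    ring
  have h1 : ∀ x : ℝ, Complex.exp (-(n * x * Complex.I)) * f (x + t)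
      = Complex.exp (n * t * Complex.I) *
        (Complex.exp (-(n * ((x + t : ℝ) : ℂ) * Complex.I)) * f (x + t)) := by
    intro x
    rw [← mul_assoc, ← Complex.exp_add]
    congr 2
    push_cast
    ring
  simp_rw [h1]
  rw [intervalIntegral.integral_const_mul, mul_smul_comm,
    intervalIntegral.integral_comp_add_right
      (fun x : ℝ ↦ Complex.exp (-(n * x * Complex.I)) * f x) t, zero_add, add_comm (2 * π) t,
    hper.intervalIntegral_add_eq t 0, zero_add]

theorem norm_exp_sub_one_sq_le (n : ℤ) :
    ‖Complex.exp (n * ((π / 2 : ℝ) : ℂ) * Complex.I) - 1‖ ^ 2 ≤ 2 * (n : ℝ) ^ 2 := by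
  have h1 : ‖Complex.exp (n * ((π / 2 : ℝ) : ℂ) * Complex.I) - 1‖ ^ 2
      = 2 - 2 * cos (n * (π / 2)) := by
    have : (n : ℂ) * ((π / 2 : ℝ) : ℂ) = ((n * (π / 2) : ℝ) : ℂ) := by push_cast; ring
    rw [this, ← Complex.normSq_eq_norm_sq, Complex.normSq_apply]
    simp only [Complex.sub_re, Complex.sub_im, Complex.exp_ofReal_mul_I_re,
      Complex.exp_ofReal_mul_I_im, Complex.one_re, Complex.one_im]
    nlinarith [sin_sq_add_cos_sq (n * (π / 2))]
  rw [h1]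
  rcases eq_or_ne n 0 with rfl | h0
  · simp
  rcases eq_or_ne n 1 with rfl | h1
  · simp
  rcases eq_or_ne n (-1) with rfl | h2
  · simp [cos_neg]
  have h3 : (4 : ℝ) ≤ (n : ℝ) ^ 2 := by
    have : (4 : ℤ) ≤ n ^ 2 := by
      rcases lt_or_ge n 0 with h | h
      · have : n ≤ -2 := by omega
        nlinarith
      · have : 2 ≤ n := by omega
        nlinarith
    exact_mod_cast this
  linarith [neg_one_le_cos (n * (π / 2))]

/-- A sharp `L²` bound for quarter-turn differences of a function on the circle. -/
theorem integral_sq_quarter_difference_le {F F' : ℝ → ℝ} (hF : ∀ s, HasDerivAt F (F' s) s)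
    (hF' : Continuous F') (hper : Function.Periodic F (2 * π)) :
    ∫ s in (0 : ℝ)..2 * π, (F (s + π / 2) - F s) ^ 2
      ≤ 2 * ∫ s in (0 : ℝ)..2 * π, F' s ^ 2 := by
  have hFc : Continuous F := continuous_iff_continuousAt.2 fun s ↦ (hF s).continuousAt
  set f : ℝ → ℂ := fun s ↦ (F s : ℂ) with hf
  set f' : ℝ → ℂ := fun s ↦ (F' s : ℂ) with hf'
  have hfc : Continuous f := Complex.continuous_ofReal.comp hFc
  have hfc' : Continuous f' := Complex.continuous_ofReal.comp hF'
  have hfp : Function.Periodic f (2 * π) := fun x ↦ by simp [hf, hper x]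
  have hpars : ∀ g : ℝ → ℂ, Continuous g →
      HasSum (fun i ↦ ‖fourierCoeffOn two_pi_pos g i‖ ^ 2)
        ((2 * π - 0)⁻¹ • ∫ x in (0 : ℝ)..2 * π, ‖g x‖ ^ 2) := fun g hg ↦ by
    obtain ⟨C, hC⟩ := (isCompact_Icc (a := 0) (b := 2 * π)).exists_bound_of_continuousOn
      hg.continuousOn
    exact hasSum_sq_fourierCoeffOn two_pi_pos (MemLp.of_bound hg.aestronglyMeasurable C
      ((ae_restrict_iff' measurableSet_Ioc).2
        (ae_of_all _ fun x hx ↦ hC x (Ioc_subset_Icc_self hx))))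
  have hs := hpars (fun x ↦ f (x + π / 2) - f x) (by fun_prop)
  have hs' := (hpars f' hfc').mul_left 2
  have hle := hasSum_le (fun n ↦ ?_) hs hs'
  · rw [smul_eq_mul, smul_eq_mul, mul_left_comm, mul_le_mul_iff_right₀ (by simp; positivity)] at hle
    simpa [hf, hf', ← Complex.ofReal_sub] using hle
  · rw [fourierCoeffOn_sub _ (by fun_prop) hfc, fourierCoeffOn_comp_add hfp, ← sub_one_mul,
      norm_mul, mul_pow]
    rcases eq_or_ne n 0 with rfl | hn
    · simp
    have hder := fourierCoeffOn_of_hasDerivAt two_pi_pos (f := f) (f' := f') hn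
      (fun x _ ↦ (hF x).ofReal_comp) (hfc'.intervalIntegrable _ _)
    have h2 : f (2 * π) - f 0 = 0 := by
      have := hfp 0
      rw [zero_add] at this
      rw [this, sub_self]
    rw [h2, mul_zero, zero_sub] at hder
    have h3 : ‖fourierCoeffOn two_pi_pos f' n‖ ^ 2
        = (n : ℝ) ^ 2 * ‖fourierCoeffOn two_pi_pos f n‖ ^ 2 := by
      have hn' : (n : ℂ) ≠ 0 := by exact_mod_cast hn
      have hpi : (π : ℂ) ≠ 0 := by exact_mod_cast pi_ne_zero
      have : fourierCoeffOn two_pi_pos f' n = Complex.I * n * fourierCoeffOn two_pi_pos f n := by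
        rw [hder]
        push_cast
        rw [sub_zero]
        field_simp
      rw [this]
      simp [mul_pow]
    rw [h3, ← mul_assoc]
    exact mul_le_mul_of_nonneg_right (norm_exp_sub_one_sq_le n) (by positivity)

end CircleInequality

section GaussianPolar

open Set Module Measure
open scoped ENNReal NNReal RealInnerProductSpace Topology

variable {E : Type*} [NormedAddCommGroup E] [InnerProductSpace ℝ E] [FiniteDimensional ℝ E]
  [MeasurableSpace E] [BorelSpace E] {m : ℕ}

theorem integral_volumeIoiPow (m : ℕ) (k : ℝ → ℝ) :
    ∫ r : Ioi (0 : ℝ), k r ∂volumeIoiPow m = ∫ r in Ioi (0 : ℝ), r ^ m * k r := by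
  rw [volumeIoiPow, integral_withDensity_eq_integral_toReal_smul (by fun_prop) (by simp),
    ← integral_subtype_comap measurableSet_Ioi]
  refine integral_congr_ae (ae_of_all _ fun r ↦ ?_)
  simp only [smul_eq_mul]
  rw [ENNReal.toReal_ofReal (pow_nonneg (mem_Ioi.1 r.2).le _)]

theorem integrable_volumeIoiPow {m : ℕ} {k : ℝ → ℝ}
    (hk : IntegrableOn (fun r ↦ r ^ m * k r) (Ioi (0 : ℝ))) :
    Integrable (fun r : Ioi (0 : ℝ) ↦ k r) (volumeIoiPow m) := by
  rw [volumeIoiPow, integrable_withDensity_iff_integrable_smul' (by fun_prop) (by simp)]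
  rw [integrableOn_iff_comap_subtypeVal measurableSet_Ioi] at hk
  refine hk.congr (ae_of_all _ fun r ↦ ?_)
  simp only [smul_eq_mul, Function.comp_apply]
  rw [ENNReal.toReal_ofReal (pow_nonneg (mem_Ioi.1 r.2).le _)]

theorem integral_separated_polar (hE : finrank ℝ E = m + 1) (g : E → ℝ) (k : ℝ → ℝ) :
    ∫ x : E, g (‖x‖⁻¹ • x) * k ‖x‖ = (∫ θ : sphere (0 : E) 1, g θ ∂(volume : Measure E).toSphere)
      * ∫ r in Ioi (0 : ℝ), r ^ m * k r := by
  have hnt : Nontrivial E := nontrivial_of_finrank_pos (R := ℝ) (by omega)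
  have hmp := (volume : Measure E).measurePreserving_homeomorphUnitSphereProd
  rw [hE, Nat.add_sub_cancel] at hmp
  have h0 : ∫ x : E, g (‖x‖⁻¹ • x) * k ‖x‖
      = ∫ x : ({0}ᶜ : Set E), g (‖(x : E)‖⁻¹ • (x : E)) * k ‖(x : E)‖
        ∂((volume : Measure E).comap Subtype.val) := by
    rw [integral_subtype_comap (measurableSet_singleton _).compl
      (fun x : E ↦ g (‖x‖⁻¹ • x) * k ‖x‖), restrict_compl_singleton]
  rw [h0, ← integral_volumeIoiPow, ← integral_prod_mul,
    ← hmp.integral_comp (Homeomorph.measurableEmbedding _)]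
  simp

theorem integrable_separated_polar (hE : finrank ℝ E = m + 1) {g : E → ℝ} {k : ℝ → ℝ}
    (hg : Continuous g) (hk : IntegrableOn (fun r ↦ r ^ m * k r) (Ioi (0 : ℝ))) :
    Integrable fun x : E ↦ g (‖x‖⁻¹ • x) * k ‖x‖ := by
  have hnt : Nontrivial E := nontrivial_of_finrank_pos (R := ℝ) (by omega)
  have hmp := (volume : Measure E).measurePreserving_homeomorphUnitSphereProd
  rw [hE, Nat.add_sub_cancel] at hmp
  have hg' : Integrable (fun θ : sphere (0 : E) 1 ↦ g θ) (volume : Measure E).toSphere :=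
    (hg.comp continuous_subtype_val).integrable_of_hasCompactSupport
      (HasCompactSupport.of_compactSpace _)
  have hprod := hg'.mul_prod (integrable_volumeIoiPow hk)
  rw [← restrict_compl_singleton (μ := volume) (0 : E), ← IntegrableOn,
    integrableOn_iff_comap_subtypeVal (measurableSet_singleton _).compl]
  rw [← hmp.integrable_comp_emb (Homeomorph.measurableEmbedding _)] at hprod
  exact hprod.congr (ae_of_all _ fun x ↦ by simp)

/-- The radial Gaussian moments. -/
noncomputable def gaussianMoment (j : ℕ) : ℝ := ∫ r in Ioi (0 : ℝ), r ^ j * exp (-(r ^ 2 / 2))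

theorem integrableOn_gaussianMoment (j : ℕ) :
    IntegrableOn (fun r ↦ r ^ j * exp (-(r ^ 2 / 2))) (Ioi (0 : ℝ)) := by
  have := integrableOn_rpow_mul_exp_neg_mul_sq (b := 1 / 2) (by norm_num) (s := j)
    (by linarith [(Nat.cast_nonneg j : (0 : ℝ) ≤ j)])
  simp only [rpow_natCast] at this
  refine this.congr_fun (fun r _ ↦ ?_) measurableSet_Ioi
  simp only
  congr 2
  ring

theorem gaussianMoment_pos (j : ℕ) : 0 < gaussianMoment j := by
  rw [gaussianMoment, setIntegral_pos_iff_support_of_nonneg_ae]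
  · have : Ioi (0 : ℝ) ⊆ Function.support (fun r ↦ r ^ j * exp (-(r ^ 2 / 2))) := fun r hr ↦ by
      have : (0 : ℝ) < r := hr
      rw [Function.mem_support]
      positivity
    rw [inter_eq_self_of_subset_right this]
    simp
  · exact (ae_restrict_iff' measurableSet_Ioi).2 (ae_of_all _ fun r hr ↦ by
      have : (0 : ℝ) < r := hr
      simp only [Pi.zero_apply]
      positivity)
  · exact integrableOn_gaussianMoment j

theorem gaussianMoment_add_two (j : ℕ) :
    gaussianMoment (j + 2) = (j + 1) * gaussianMoment j := by
  have key : ∀ j : ℕ, gaussianMoment j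
      = (1 / 2 : ℝ) ^ (-((j : ℝ) + 1) / 2) * (1 / 2) * Gamma (((j : ℝ) + 1) / 2) := by
    intro j
    rw [← integral_rpow_mul_exp_neg_mul_rpow two_pos
      (by linarith [(Nat.cast_nonneg j : (0 : ℝ) ≤ j)]) (by norm_num)]
    refine setIntegral_congr_fun measurableSet_Ioi fun r _ ↦ ?_
    simp only [rpow_natCast, rpow_two]
    congr 2
    ring
  rw [key, key]
  have h1 : (((j + 2 : ℕ) : ℝ) + 1) / 2 = ((j : ℝ) + 1) / 2 + 1 := by push_cast; ring
  have h2 : -(((j + 2 : ℕ) : ℝ) + 1) / 2 = -((j : ℝ) + 1) / 2 - 1 := by push_cast; ring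
  rw [h1, h2, Gamma_add_one (by positivity), rpow_sub_one (by norm_num)]
  ring

end GaussianPolar

section GaussianRotation

open Set Module Measure
open scoped ENNReal NNReal RealInnerProductSpace Topology

variable {E : Type*} [NormedAddCommGroup E] [InnerProductSpace ℝ E] [FiniteDimensional ℝ E]
  [MeasurableSpace E] [BorelSpace E] {m : ℕ}

/-- Rotation by the angle `s` in the product of two copies of `E`. -/
noncomputable def prodRotation (s : ℝ) (p : E × E) : E × E :=
  (cos s • p.1 + sin s • p.2, -sin s • p.1 + cos s • p.2)

omit [FiniteDimensional ℝ E] [MeasurableSpace E] [BorelSpace E] in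
theorem norm_sq_add_norm_sq_prodRotation (s : ℝ) (p : E × E) :
    ‖(prodRotation s p).1‖ ^ 2 + ‖(prodRotation s p).2‖ ^ 2 = ‖p.1‖ ^ 2 + ‖p.2‖ ^ 2 := by
  simp only [prodRotation, ← real_inner_self_eq_norm_sq, inner_add_left, inner_add_right,
    inner_smul_left, inner_smul_right, RCLike.conj_to_real, real_inner_comm p.1 p.2]
  linear_combination (⟪p.1, p.1⟫ + ⟪p.2, p.2⟫) * sin_sq_add_cos_sq s

theorem measurePreserving_prodRotation (s : ℝ) :
    MeasurePreserving (prodRotation s : E × E → E × E) := by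
  let rot : E × E →ₗ[ℝ] E × E :=
    { toFun := prodRotation s
      map_add' := fun p q ↦ by
        ext <;> simp only [prodRotation, Prod.fst_add, Prod.snd_add] <;> module
      map_smul' := fun c p ↦ by
        ext <;> simp only [prodRotation, Prod.smul_fst, Prod.smul_snd, RingHom.id_apply] <;>
          module }
  let e := WithLp.linearEquiv 2 ℝ (E × E)
  let L : WithLp 2 (E × E) →ₗᵢ[ℝ] WithLp 2 (E × E) :=
    { toLinearMap := e.symm.toLinearMap ∘ₗ rot ∘ₗ e.toLinearMap
      norm_map' := fun p ↦ by
        rw [← sq_eq_sq₀ (norm_nonneg _) (norm_nonneg _), WithLp.prod_norm_sq_eq_of_L2,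
          WithLp.prod_norm_sq_eq_of_L2]
        exact norm_sq_add_norm_sq_prodRotation s _ }
  have h1 := (L.toLinearIsometryEquiv rfl).measurePreserving
  exact ((WithLp.volume_preserving_ofLp (E) (E)).comp h1).comp
    (WithLp.volume_preserving_toLp E E)

omit [FiniteDimensional ℝ E] [MeasurableSpace E] [BorelSpace E] in
theorem continuous_uncurry_prodRotation :
    Continuous fun q : (E × E) × ℝ ↦ prodRotation q.2 q.1 := by
  unfold prodRotation
  fun_prop

theorem lintegral_lintegral_prodRotation {g : E × E → ℝ≥0∞} (hg : Measurable g) :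
    ∫⁻ p, ∫⁻ s in Ioc 0 (2 * π), g (prodRotation s p) = ENNReal.ofReal (2 * π) * ∫⁻ p, g p := by
  rw [lintegral_lintegral_swap]
  · have h (s : ℝ) : ∫⁻ p, g (prodRotation s p) = ∫⁻ p, g p :=
      (measurePreserving_prodRotation s).lintegral_comp hg
    simp only [h, lintegral_const, Measure.restrict_apply_univ, Real.volume_Ioc, sub_zero]
    rw [mul_comm]
  · exact (hg.comp continuous_uncurry_prodRotation.measurable).aemeasurable

theorem lintegral_le_of_lintegral_prodRotation_le {f g : E × E → ℝ≥0∞} (hf : Measurable f)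
    (hg : Measurable g) (h : ∀ᵐ p, ∫⁻ s in Ioc 0 (2 * π), f (prodRotation s p)
      ≤ ∫⁻ s in Ioc 0 (2 * π), g (prodRotation s p)) : ∫⁻ p, f p ≤ ∫⁻ p, g p := by
  have := lintegral_mono_ae h
  rw [lintegral_lintegral_prodRotation hf, lintegral_lintegral_prodRotation hg] at this
  exact (ENNReal.mul_le_mul_iff_right (ENNReal.ofReal_pos.2 two_pi_pos).ne'
    ENNReal.ofReal_ne_top).1 this

theorem ae_abs_inner_lt (hE : finrank ℝ E = m + 1) (hm : m ≠ 0) :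
    ∀ᵐ p : E × E, |⟪p.1, p.2⟫| < ‖p.1‖ * ‖p.2‖ := by
  have hmeas : MeasurableSet {p : E × E | |⟪p.1, p.2⟫| < ‖p.1‖ * ‖p.2‖} :=
    (isOpen_lt (by fun_prop) (by fun_prop)).measurableSet
  have hnt : Nontrivial E := nontrivial_of_finrank_pos (R := ℝ) (by omega)
  rw [Measure.volume_eq_prod]
  refine (Measure.ae_prod_mem_iff_ae_ae_mem hmeas).2 ?_
  filter_upwards [Measure.ae_ne volume (0 : E)] with x hx
  have hnull : volume ((Submodule.span ℝ {x} : Submodule ℝ E) : Set E) = 0 := by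
    refine Measure.addHaar_submodule _ _ fun htop ↦ ?_
    have := finrank_span_singleton (K := ℝ) hx
    rw [htop, finrank_top] at this
    omega
  filter_upwards [measure_eq_zero_iff_ae_notMem.1 hnull] with y hy
  refine lt_of_le_of_ne (abs_real_inner_le_norm x y) fun heq ↦ hy ?_
  have hy0 : y ≠ 0 := by
    rintro rfl
    exact hy (zero_mem _)
  obtain ⟨c, -, rfl⟩ := (norm_inner_eq_norm_iff (𝕜 := ℝ) hx hy0).1 heq
  exact Submodule.smul_mem _ _ (Submodule.mem_span_singleton_self x)

omit [FiniteDimensional ℝ E] [MeasurableSpace E] [BorelSpace E] in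
theorem prodRotation_fst_ne_zero {p : E × E} (hp : |⟪p.1, p.2⟫| < ‖p.1‖ * ‖p.2‖) (s : ℝ) :
    (prodRotation s p).1 ≠ 0 := by
  intro h0
  obtain ⟨x, y⟩ := p
  simp only [prodRotation] at h0 hp
  have h1 : cos s * ⟪x, x⟫ + sin s * ⟪x, y⟫ = 0 := by
    rw [← inner_smul_right, ← inner_smul_right, ← inner_add_right, h0, inner_zero_right]
  have h2 : cos s * ⟪x, y⟫ + sin s * ⟪y, y⟫ = 0 := by
    rw [real_inner_comm, ← inner_smul_right, ← inner_smul_right, ← inner_add_right, h0,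
      inner_zero_right]
  have h3 : ⟪x, y⟫ ^ 2 < ⟪x, x⟫ * ⟪y, y⟫ := by
    rw [real_inner_self_eq_norm_sq, real_inner_self_eq_norm_sq, ← mul_pow, ← sq_abs]
    exact pow_lt_pow_left₀ hp (abs_nonneg _) two_ne_zero
  have h4 : cos s * (⟪x, x⟫ * ⟪y, y⟫ - ⟪x, y⟫ ^ 2) = 0 := by
    linear_combination ⟪y, y⟫ * h1 - ⟪x, y⟫ * h2
  have h5 : sin s * (⟪x, x⟫ * ⟪y, y⟫ - ⟪x, y⟫ ^ 2) = 0 := by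
    linear_combination ⟪x, x⟫ * h2 - ⟪x, y⟫ * h1
  have h6 := (mul_eq_zero.1 h4).resolve_right (by linarith)
  have h7 := (mul_eq_zero.1 h5).resolve_right (by linarith)
  have := sin_sq_add_cos_sq s
  simp [h6, h7] at this

/-- The unnormalised Gaussian weight on a product. -/
noncomputable def gaussianWeight (p : E × E) : ℝ :=
  exp (-(‖p.1‖ ^ 2 / 2)) * exp (-(‖p.2‖ ^ 2 / 2))

omit [FiniteDimensional ℝ E] [MeasurableSpace E] [BorelSpace E] in
theorem gaussianWeight_prodRotation (s : ℝ) (p : E × E) :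
    gaussianWeight (prodRotation s p) = gaussianWeight p := by
  rw [gaussianWeight, gaussianWeight, ← exp_add, ← exp_add]
  congr 1
  linear_combination -norm_sq_add_norm_sq_prodRotation s p / 2

omit [FiniteDimensional ℝ E] [MeasurableSpace E] [BorelSpace E] in
theorem hasDerivAt_prodRotation_fst (s : ℝ) (p : E × E) :
    HasDerivAt (fun t ↦ (prodRotation t p).1) (prodRotation s p).2 s := by
  simp only [prodRotation]
  exact ((hasDerivAt_cos s).smul_const p.1).add ((hasDerivAt_sin s).smul_const p.2)

omit [FiniteDimensional ℝ E] [MeasurableSpace E] [BorelSpace E] in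
theorem prodRotation_add_pi_div_two_fst (s : ℝ) (p : E × E) :
    (prodRotation (s + π / 2) p).1 = (prodRotation s p).2 := by
  simp [prodRotation, cos_add_pi_div_two, sin_add_pi_div_two]

theorem lintegral_sq_difference_mul_gaussianWeight_le (hE : finrank ℝ E = m + 1) (hm : m ≠ 0)
    {U : E → ℝ} (hU : Continuous U) (hU' : ContDiffOn ℝ 1 U {0}ᶜ) :
    ∫⁻ p : E × E, ENNReal.ofReal ((U p.2 - U p.1) ^ 2 * gaussianWeight p)
      ≤ ∫⁻ p : E × E, ENNReal.ofReal (2 * (fderiv ℝ U p.1 p.2) ^ 2 * gaussianWeight p) := by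
  have hw : Continuous (gaussianWeight : E × E → ℝ) := by
    unfold gaussianWeight
    fun_prop
  have hfd : Measurable fun p : E × E ↦ fderiv ℝ U p.1 p.2 :=
    ContinuousLinearMap.measurable_apply₂ |>.comp
      (((measurable_fderiv ℝ U).comp measurable_fst).prodMk measurable_snd)
  refine lintegral_le_of_lintegral_prodRotation_le (by fun_prop)
    (((hfd.pow_const 2).const_mul 2).mul hw.measurable).ennreal_ofReal ?_
  filter_upwards [ae_abs_inner_lt hE hm] with p hp
  have hne := prodRotation_fst_ne_zero hp
  have hcr : Continuous fun s ↦ prodRotation s p := by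
    unfold prodRotation
    fun_prop
  have hopen : IsOpen ({0}ᶜ : Set E) := isOpen_compl_singleton
  have hF (s : ℝ) : HasDerivAt (fun t ↦ U (prodRotation t p).1)
      (fderiv ℝ U (prodRotation s p).1 (prodRotation s p).2) s :=
    ((hU'.differentiableOn one_ne_zero).differentiableAt
      (hopen.mem_nhds (hne s))).hasFDerivAt.comp_hasDerivAt s (hasDerivAt_prodRotation_fst s p)
  have hF' : Continuous fun s ↦ fderiv ℝ U (prodRotation s p).1 (prodRotation s p).2 :=
    ((hU'.continuousOn_fderiv_of_isOpen hopen le_rfl).comp_continuous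
      (continuous_fst.comp hcr) hne).clm_apply (continuous_snd.comp hcr)
  have key := integral_sq_quarter_difference_le hF hF' (fun s ↦ by simp [prodRotation])
  simp only [prodRotation_add_pi_div_two_fst] at key
  rw [← intervalIntegral.integral_const_mul] at key
  simp only [gaussianWeight_prodRotation]
  have hw0 : 0 ≤ gaussianWeight p := by
    unfold gaussianWeight
    positivity
  rw [← ofReal_integral_eq_lintegral_ofReal, ← ofReal_integral_eq_lintegral_ofReal]
  · refine ENNReal.ofReal_le_ofReal ?_
    rw [integral_mul_const, integral_mul_const]
    refine mul_le_mul_of_nonneg_right ?_ hw0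
    rwa [intervalIntegral.integral_of_le two_pi_pos.le,
      intervalIntegral.integral_of_le two_pi_pos.le] at key
  · exact ((continuous_const.mul (hF'.pow 2)).mul continuous_const).integrableOn_Ioc
  · exact ae_of_all _ fun s ↦ by positivity
  · have : Continuous fun s ↦ (U (prodRotation s p).2 - U (prodRotation s p).1) ^ 2
      * gaussianWeight p := by fun_prop
    exact this.integrableOn_Ioc
  · exact ae_of_all _ fun s ↦ by positivity

end GaussianRotation

section SpherePoincare

open Set Module Measure
open scoped ENNReal NNReal RealInnerProductSpace Topology Gradient

variable {E : Type*} [NormedAddCommGroup E] [InnerProductSpace ℝ E] [FiniteDimensional ℝ E]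
  [MeasurableSpace E] [BorelSpace E] {m : ℕ}

omit [MeasurableSpace E] [BorelSpace E] in
theorem Continuous.norm_mul_comp_normalize {u : E → ℝ} (hu : Continuous u) :
    Continuous fun x : E ↦ ‖x‖ * u (‖x‖⁻¹ • x) := by
  rw [continuous_iff_continuousAt]
  intro x
  rcases eq_or_ne x 0 with rfl | hx
  · obtain ⟨C, hC⟩ := (isCompact_closedBall (0 : E) 1).exists_bound_of_continuousOn hu.continuousOn
    rw [ContinuousAt, norm_zero, zero_mul]
    refine squeeze_zero_norm (a := fun x ↦ ‖x‖ * C) (fun y ↦ ?_) ?_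
    · rw [norm_mul, norm_norm]
      refine mul_le_mul_of_nonneg_left (hC _ ?_) (norm_nonneg _)
      rw [mem_closedBall_zero_iff, norm_smul, norm_inv, norm_norm]
      exact inv_mul_le_one
    · have : Continuous fun x : E ↦ ‖x‖ * C := by fun_prop
      simpa using this.tendsto 0
  · exact continuousAt_id.norm.mul (hu.continuousAt.comp
      ((continuousAt_id.norm.inv₀ (norm_ne_zero_iff.2 hx)).smul continuousAt_id))

omit [MeasurableSpace E] [BorelSpace E] [FiniteDimensional ℝ E] in
theorem ContDiff.contDiffOn_norm_mul_comp_normalize {u : E → ℝ} (hu : ContDiff ℝ 1 u) :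
    ContDiffOn ℝ 1 (fun x : E ↦ ‖x‖ * u (‖x‖⁻¹ • x)) {0}ᶜ := by
  have hn : ContDiffOn ℝ 1 (fun x : E ↦ ‖x‖) {0}ᶜ := contDiffOn_id.norm ℝ fun x hx ↦ hx
  exact hn.mul (hu.comp_contDiffOn
    ((hn.inv fun x hx ↦ norm_ne_zero_iff.2 hx).smul contDiffOn_id))

omit [MeasurableSpace E] [BorelSpace E] in
theorem ContDiff.fderiv_norm_mul_comp_normalize {u : E → ℝ} (hu : ContDiff ℝ 1 u) {x : E}
    (hx : x ≠ 0) (y : E) : fderiv ℝ (fun x : E ↦ ‖x‖ * u (‖x‖⁻¹ • x)) x y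
      = ⟪u (‖x‖⁻¹ • x) • (‖x‖⁻¹ • x) + (∇ u (‖x‖⁻¹ • x)
        - ⟪∇ u (‖x‖⁻¹ • x), ‖x‖⁻¹ • x⟫ • (‖x‖⁻¹ • x)), y⟫ := by
  have hx0 : ‖x‖ ≠ 0 := norm_ne_zero_iff.2 hx
  have hd : DifferentiableAt ℝ (fun x : E ↦ ‖x‖ * u (‖x‖⁻¹ • x)) x :=
    ((hu.contDiffOn_norm_mul_comp_normalize).differentiableOn one_ne_zero).differentiableAt
      (isOpen_compl_singleton.mem_nhds hx)
  have hl : HasDerivAt (fun t : ℝ ↦ x + t • y) y 0 := by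
    simpa using ((hasDerivAt_id (0 : ℝ)).smul_const y).const_add x
  have hsq : HasDerivAt (fun t : ℝ ↦ ‖x + t • y‖ ^ 2) (2 * ⟪x, y⟫) 0 := by
    simpa using hl.norm_sq
  have hn : HasDerivAt (fun t : ℝ ↦ ‖x + t • y‖) (⟪x, y⟫ / ‖x‖) 0 := by
    have := hsq.sqrt (by simpa using hx0)
    simp only [sqrt_sq (norm_nonneg _), zero_smul, add_zero] at this
    convert this using 1
    field_simp
  have hi : HasDerivAt (fun t : ℝ ↦ ‖x + t • y‖⁻¹) (-(⟪x, y⟫ / ‖x‖) / ‖x‖ ^ 2) 0 := by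
    have := hn.fun_inv (by simpa using hx0)
    simpa using this
  have hθ := hi.smul hl
  have hu0 : HasFDerivAt u (fderiv ℝ u (‖x‖⁻¹ • x)) (‖x + (0 : ℝ) • y‖⁻¹ • (x + (0 : ℝ) • y)) := by
    simpa using ((hu.differentiable one_ne_zero) (‖x‖⁻¹ • x)).hasFDerivAt
  have h1 := hn.mul (hu0.comp_hasDerivAt (0 : ℝ) hθ)
  have h2 := HasFDerivAt.comp_hasDerivAt (0 : ℝ)
    (f := fun t : ℝ ↦ x + t • y) (by simpa using hd.hasFDerivAt) hl
  rw [h2.unique h1]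
  simp only [zero_smul, add_zero, Function.comp, Pi.smul_apply', map_add, map_smul, smul_eq_mul, inner_add_left,
    inner_sub_left, inner_smul_left, inner_smul_right, RCLike.conj_to_real]
  have hg (z : E) : ⟪∇ u (‖x‖⁻¹ • x), z⟫ = fderiv ℝ u (‖x‖⁻¹ • x) z := by
    simp [gradient]
  simp only [hg]
  field_simp
  ring

omit [MeasurableSpace E] [BorelSpace E] in
theorem norm_sq_sphere_gradient (u : E → ℝ) {θ : E} (hθ : ‖θ‖ = 1) :
    ‖u θ • θ + (∇ u θ - ⟪∇ u θ, θ⟫ • θ)‖ ^ 2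
      = u θ ^ 2 + (‖fderiv ℝ u θ‖ ^ 2 - (fderiv ℝ u θ θ) ^ 2) := by
  have h1 : ‖fderiv ℝ u θ‖ = ‖∇ u θ‖ := by simp [gradient]
  have h2 : fderiv ℝ u θ θ = ⟪∇ u θ, θ⟫ := by simp [gradient]
  have h3 : ⟪θ, θ⟫ = 1 := by rw [real_inner_self_eq_norm_sq, hθ, one_pow]
  rw [h1, h2, ← real_inner_self_eq_norm_sq, ← real_inner_self_eq_norm_sq]
  simp only [inner_add_left, inner_add_right, inner_sub_left, inner_sub_right, inner_smul_left,
    inner_smul_right, RCLike.conj_to_real, real_inner_comm (∇ u θ) θ, h3]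
  ring

theorem integrable_norm_sq_mul_exp (hE : finrank ℝ E = m + 1) :
    Integrable fun y : E ↦ ‖y‖ ^ 2 * exp (-(‖y‖ ^ 2 / 2)) := by
  have := integrable_separated_polar hE (g := fun _ ↦ 1) (k := fun r ↦ r ^ 2 * exp (-(r ^ 2 / 2)))
    continuous_const (by simpa only [← mul_assoc, ← pow_add] using integrableOn_gaussianMoment (m + 2))
  simpa using this

theorem integral_norm_sq_mul_exp (hE : finrank ℝ E = m + 1) :
    ∫ y : E, ‖y‖ ^ 2 * exp (-(‖y‖ ^ 2 / 2))
      = (volume : Measure E).toSphere.real univ * gaussianMoment (m + 2) := by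
  have := integral_separated_polar hE (fun _ ↦ 1) (fun r ↦ r ^ 2 * exp (-(r ^ 2 / 2)))
  simp only [one_mul, ← mul_assoc, ← pow_add] at this
  simpa [gaussianMoment] using this

theorem integrable_inner_sq_mul_exp (hE : finrank ℝ E = m + 1) (a : E) :
    Integrable fun y : E ↦ ⟪a, y⟫ ^ 2 * exp (-(‖y‖ ^ 2 / 2)) := by
  refine ((integrable_norm_sq_mul_exp hE).const_mul (‖a‖ ^ 2)).mono'
    (Continuous.aestronglyMeasurable (by fun_prop)) (ae_of_all _ fun y ↦ ?_)
  rw [norm_of_nonneg (by positivity), ← mul_assoc, ← mul_pow]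
  refine mul_le_mul_of_nonneg_right ?_ (exp_pos _).le
  rw [← sq_abs]
  exact pow_le_pow_left₀ (abs_nonneg _) (abs_real_inner_le_norm _ _) 2

theorem integral_inner_sq_mul_exp_congr {a b : E} (hab : ‖a‖ = ‖b‖) :
    ∫ y : E, ⟪a, y⟫ ^ 2 * exp (-(‖y‖ ^ 2 / 2)) = ∫ y : E, ⟪b, y⟫ ^ 2 * exp (-(‖y‖ ^ 2 / 2)) := by
  let f := Submodule.reflection (ℝ ∙ (a - b))ᗮ
  have hf : f a = b := Submodule.reflection_sub hab
  rw [← f.measurePreserving.integral_comp f.toHomeomorph.measurableEmbedding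
    fun y ↦ ⟪b, y⟫ ^ 2 * exp (-(‖y‖ ^ 2 / 2))]
  simp only [← hf, LinearIsometryEquiv.inner_map_map, LinearIsometryEquiv.norm_map]

theorem integral_inner_sq_mul_exp (hE : finrank ℝ E = m + 1) (a : E) :
    ∫ y : E, ⟪a, y⟫ ^ 2 * exp (-(‖y‖ ^ 2 / 2))
      = ‖a‖ ^ 2 * ((volume : Measure E).toSphere.real univ * gaussianMoment m) := by
  let b := stdOrthonormalBasis ℝ E
  let i₀ : Fin (finrank ℝ E) := ⟨0, by omega⟩
  have hsum : ∑ i, ∫ y : E, ⟪b i, y⟫ ^ 2 * exp (-(‖y‖ ^ 2 / 2))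
      = (volume : Measure E).toSphere.real univ * gaussianMoment (m + 2) := by
    rw [← integral_norm_sq_mul_exp hE, ← integral_finsetSum _
      fun i _ ↦ integrable_inner_sq_mul_exp hE (b i)]
    refine integral_congr_ae (ae_of_all _ fun y ↦ ?_)
    simp only
    rw [← Finset.sum_mul, ← b.sum_sq_inner_right y]
  have hconst (i : Fin (finrank ℝ E)) : ∫ y : E, ⟪b i, y⟫ ^ 2 * exp (-(‖y‖ ^ 2 / 2))
      = ∫ y : E, ⟪b i₀, y⟫ ^ 2 * exp (-(‖y‖ ^ 2 / 2)) :=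
    integral_inner_sq_mul_exp_congr (by simp)
  simp only [hconst, Finset.sum_const, Finset.card_univ, Fintype.card_fin, nsmul_eq_mul, hE,
    gaussianMoment_add_two] at hsum
  push_cast at hsum
  have h0 : ∫ y : E, ⟪b i₀, y⟫ ^ 2 * exp (-(‖y‖ ^ 2 / 2))
      = (volume : Measure E).toSphere.real univ * gaussianMoment m := by
    refine mul_left_cancel₀ (by positivity : (m : ℝ) + 1 ≠ 0) ?_
    rw [hsum]
    ring
  rw [← h0, integral_inner_sq_mul_exp_congr (b := ‖a‖ • b i₀) (by simp [norm_smul]),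
    ← integral_const_mul]
  refine integral_congr_ae (ae_of_all _ fun y ↦ ?_)
  simp only [inner_smul_left, RCLike.conj_to_real]
  ring

theorem lintegral_fderiv_sq_mul_gaussianWeight (hE : finrank ℝ E = m + 1) {u : E → ℝ}
    (hu : ContDiff ℝ 1 u) : ∫⁻ p : E × E, ENNReal.ofReal
      (2 * (fderiv ℝ (fun x : E ↦ ‖x‖ * u (‖x‖⁻¹ • x)) p.1 p.2) ^ 2 * gaussianWeight p)
    = ENNReal.ofReal (2 * ((volume : Measure E).toSphere.real univ * gaussianMoment m)
      * ((∫ θ : sphere (0 : E) 1, u θ ^ 2 + (‖fderiv ℝ u θ‖ ^ 2 - (fderiv ℝ u θ θ) ^ 2)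
        ∂(volume : Measure E).toSphere) * gaussianMoment m)) := by
  have hfd : Measurable fun p : E × E ↦
      fderiv ℝ (fun x : E ↦ ‖x‖ * u (‖x‖⁻¹ • x)) p.1 p.2 :=
    ContinuousLinearMap.measurable_apply₂ |>.comp
      (((measurable_fderiv ℝ _).comp measurable_fst).prodMk measurable_snd)
  have hw : Continuous (gaussianWeight : E × E → ℝ) := by
    unfold gaussianWeight
    fun_prop
  have hfc : Continuous (fderiv ℝ u) := hu.continuous_fderiv one_ne_zero
  have hnt : Nontrivial E := nontrivial_of_finrank_pos (R := ℝ) (by omega)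
  let q : E → ℝ := fun θ ↦ u θ ^ 2 + (‖fderiv ℝ u θ‖ ^ 2 - (fderiv ℝ u θ θ) ^ 2)
  have hqc : Continuous q :=
    (hu.continuous.pow 2).add ((hfc.norm.pow 2).sub ((hfc.clm_apply continuous_id).pow 2))
  have hq0 (x : E) (hx : x ≠ 0) : 0 ≤ q (‖x‖⁻¹ • x) := by
    have : ‖‖x‖⁻¹ • x‖ = 1 := norm_smul_inv_norm (𝕜 := ℝ) hx
    simp only [q]
    rw [← norm_sq_sphere_gradient u this]
    positivity
  have hmeas : Measurable fun p : E × E ↦ ENNReal.ofReal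
      (2 * (fderiv ℝ (fun x : E ↦ ‖x‖ * u (‖x‖⁻¹ • x)) p.1 p.2) ^ 2 * gaussianWeight p) :=
    (((hfd.pow_const 2).const_mul 2).mul hw.measurable).ennreal_ofReal
  rw [Measure.volume_eq_prod, lintegral_prod _ hmeas.aemeasurable]
  have hinner : ∀ᵐ x : E, ∫⁻ y : E, ENNReal.ofReal
      (2 * (fderiv ℝ (fun x : E ↦ ‖x‖ * u (‖x‖⁻¹ • x)) x y) ^ 2 * gaussianWeight (x, y))
      = ENNReal.ofReal (2 * ((volume : Measure E).toSphere.real univ * gaussianMoment m)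
        * (q (‖x‖⁻¹ • x) * exp (-(‖x‖ ^ 2 / 2)))) := by
    filter_upwards [Measure.ae_ne volume (0 : E)] with x hx
    have hθ : ‖‖x‖⁻¹ • x‖ = 1 := norm_smul_inv_norm (𝕜 := ℝ) hx
    simp only [hu.fderiv_norm_mul_comp_normalize hx, gaussianWeight]
    set a := u (‖x‖⁻¹ • x) • (‖x‖⁻¹ • x) + (∇ u (‖x‖⁻¹ • x)
        - ⟪∇ u (‖x‖⁻¹ • x), ‖x‖⁻¹ • x⟫ • (‖x‖⁻¹ • x)) with ha
    have hre (y : E) : 2 * ⟪a, y⟫ ^ 2 * (exp (-(‖x‖ ^ 2 / 2)) * exp (-(‖y‖ ^ 2 / 2)))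
        = 2 * exp (-(‖x‖ ^ 2 / 2)) * (⟪a, y⟫ ^ 2 * exp (-(‖y‖ ^ 2 / 2))) := by ring
    simp only [hre]
    rw [← ofReal_integral_eq_lintegral_ofReal
      ((integrable_inner_sq_mul_exp hE a).const_mul _) (ae_of_all _ fun y ↦ by positivity),
      integral_const_mul, integral_inner_sq_mul_exp hE, norm_sq_sphere_gradient u hθ]
    congr 1
    simp only [q]
    ring
  rw [lintegral_congr_ae hinner, ← ofReal_integral_eq_lintegral_ofReal, integral_const_mul,
    integral_separated_polar hE q fun r ↦ exp (-(r ^ 2 / 2))]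
  · rfl
  · exact (integrable_separated_polar hE hqc (k := fun r ↦ exp (-(r ^ 2 / 2)))
      (integrableOn_gaussianMoment m)).const_mul _
  · filter_upwards [Measure.ae_ne volume (0 : E)] with x hx
    have h1 := hq0 x hx
    have h2 := (gaussianMoment_pos m).le
    simp only [Pi.zero_apply]
    positivity

theorem lintegral_sq_difference_mul_gaussianWeight (hE : finrank ℝ E = m + 1) {u : E → ℝ}
    (hu : Continuous u) (hu0 : ∫ θ : sphere (0 : E) 1, u θ ∂(volume : Measure E).toSphere = 0) :
    ∫⁻ p : E × E, ENNReal.ofReal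
      ((‖p.2‖ * u (‖p.2‖⁻¹ • p.2) - ‖p.1‖ * u (‖p.1‖⁻¹ • p.1)) ^ 2 * gaussianWeight p)
    = ENNReal.ofReal (2 * ((volume : Measure E).toSphere.real univ * gaussianMoment m)
      * ((∫ θ : sphere (0 : E) 1, u θ ^ 2 ∂(volume : Measure E).toSphere)
        * gaussianMoment (m + 2))) := by
  let W : E → ℝ := fun x ↦ 1 * exp (-(‖x‖ ^ 2 / 2))
  let V : E → ℝ := fun x ↦ u (‖x‖⁻¹ • x) * (‖x‖ * exp (-(‖x‖ ^ 2 / 2)))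
  let S : E → ℝ := fun x ↦ u (‖x‖⁻¹ • x) ^ 2 * (‖x‖ ^ 2 * exp (-(‖x‖ ^ 2 / 2)))
  have hW : Integrable W := integrable_separated_polar hE (g := fun _ ↦ 1)
    (k := fun r ↦ exp (-(r ^ 2 / 2))) continuous_const (integrableOn_gaussianMoment m)
  have hV : Integrable V := integrable_separated_polar hE (g := u)
    (k := fun r ↦ r * exp (-(r ^ 2 / 2))) hu (by
      simpa only [← mul_assoc, ← pow_succ] using integrableOn_gaussianMoment (m + 1))
  have hS : Integrable S := integrable_separated_polar hE (g := fun x ↦ u x ^ 2)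
    (k := fun r ↦ r ^ 2 * exp (-(r ^ 2 / 2))) (hu.pow 2) (by
      simpa only [← mul_assoc, ← pow_add] using integrableOn_gaussianMoment (m + 2))
  have iW : ∫ x, W x = (volume : Measure E).toSphere.real univ * gaussianMoment m := by
    have := integral_separated_polar hE (fun _ ↦ 1) (fun r ↦ exp (-(r ^ 2 / 2)))
    rw [integral_const, smul_eq_mul, mul_one] at this
    exact this
  have iV : ∫ x, V x = 0 := by
    have := integral_separated_polar hE u (fun r ↦ r * exp (-(r ^ 2 / 2)))
    rwa [hu0, zero_mul] at this
  have iS : ∫ x, S x = (∫ θ : sphere (0 : E) 1, u θ ^ 2 ∂(volume : Measure E).toSphere)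
      * gaussianMoment (m + 2) := by
    have := integral_separated_polar hE (fun x ↦ u x ^ 2) (fun r ↦ r ^ 2 * exp (-(r ^ 2 / 2)))
    simp only [← mul_assoc, ← pow_add] at this
    simpa only [S, gaussianMoment, ← mul_assoc] using this
  have hexp (p : E × E) :
      (‖p.2‖ * u (‖p.2‖⁻¹ • p.2) - ‖p.1‖ * u (‖p.1‖⁻¹ • p.1)) ^ 2 * gaussianWeight p
      = W p.1 * S p.2 - 2 * (V p.1 * V p.2) + S p.1 * W p.2 := by
    simp only [W, V, S, gaussianWeight]
    ring
  have h1 : Integrable fun p : E × E ↦ W p.1 * S p.2 := hW.mul_prod hS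
  have h2 : Integrable fun p : E × E ↦ 2 * (V p.1 * V p.2) := (hV.mul_prod hV).const_mul 2
  have h3 : Integrable fun p : E × E ↦ S p.1 * W p.2 := hS.mul_prod hW
  have hnn (p : E × E) : 0 ≤ W p.1 * S p.2 - 2 * (V p.1 * V p.2) + S p.1 * W p.2 := by
    rw [← hexp, gaussianWeight]
    positivity
  simp only [hexp]
  have h4 : Integrable fun p : E × E ↦ W p.1 * S p.2 - 2 * (V p.1 * V p.2) := h1.sub h2
  have h5 : Integrable fun p : E × E ↦ W p.1 * S p.2 - 2 * (V p.1 * V p.2) + S p.1 * W p.2 :=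
    h4.add h3
  rw [← ofReal_integral_eq_lintegral_ofReal h5 (ae_of_all _ hnn), integral_add h4 h3, integral_sub h1 h2, integral_const_mul,
    Measure.volume_eq_prod, integral_prod_mul, integral_prod_mul, integral_prod_mul, iW, iV, iS]
  congr 1
  ring

/-- Poincaré inequality on the unit sphere with the sharp constant. -/
theorem integral_sphere_sq_le (hE : finrank ℝ E = m + 1) (hm : m ≠ 0) {u : E → ℝ}
    (hu : ContDiff ℝ 1 u)
    (hu0 : ∫ θ : sphere (0 : E) 1, u θ ∂(volume : Measure E).toSphere = 0) :
    m * ∫ θ : sphere (0 : E) 1, u θ ^ 2 ∂(volume : Measure E).toSphere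
      ≤ ∫ θ : sphere (0 : E) 1, ‖fderiv ℝ u θ‖ ^ 2 - (fderiv ℝ u θ θ) ^ 2
        ∂(volume : Measure E).toSphere := by
  have hnt : Nontrivial E := nontrivial_of_finrank_pos (R := ℝ) (by omega)
  have hfc : Continuous (fderiv ℝ u) := hu.continuous_fderiv one_ne_zero
  have key := lintegral_sq_difference_mul_gaussianWeight_le hE hm
    (hu.continuous.norm_mul_comp_normalize) hu.contDiffOn_norm_mul_comp_normalize
  have hi1 : Integrable (fun θ : sphere (0 : E) 1 ↦ u θ ^ 2) (volume : Measure E).toSphere :=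
    ((hu.continuous.pow 2).comp continuous_subtype_val).integrable_of_hasCompactSupport
      (HasCompactSupport.of_compactSpace _)
  have hi2 : Integrable (fun θ : sphere (0 : E) 1 ↦ ‖fderiv ℝ u θ‖ ^ 2 - (fderiv ℝ u θ θ) ^ 2)
      (volume : Measure E).toSphere :=
    (((hfc.norm.pow 2).sub ((hfc.clm_apply continuous_id).pow 2)).comp
      continuous_subtype_val).integrable_of_hasCompactSupport
      (HasCompactSupport.of_compactSpace _)
  have hσ : 0 < (volume : Measure E).toSphere.real univ := by
    rw [Measure.toSphere_real_apply_univ, hE]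
    exact mul_pos (by positivity) (ENNReal.toReal_pos (measure_ball_pos _ _ one_pos).ne'
      measure_ball_lt_top.ne)
  have hg := gaussianMoment_pos m
  have hnn : 0 ≤ ∫ θ : sphere (0 : E) 1, u θ ^ 2 + (‖fderiv ℝ u θ‖ ^ 2 - (fderiv ℝ u θ θ) ^ 2)
      ∂(volume : Measure E).toSphere := by
    refine integral_nonneg fun θ ↦ ?_
    simp only [Pi.zero_apply]
    rw [← norm_sq_sphere_gradient u (norm_eq_of_mem_sphere θ)]
    positivity
  rw [lintegral_sq_difference_mul_gaussianWeight hE hu.continuous hu0,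
    lintegral_fderiv_sq_mul_gaussianWeight hE hu, ENNReal.ofReal_le_ofReal_iff (by positivity),
    gaussianMoment_add_two] at key
  have key2 := le_of_mul_le_mul_left key (by positivity)
  rw [← mul_assoc] at key2
  have key3 := le_of_mul_le_mul_right key2 hg
  rw [integral_add hi1 hi2] at key3
  linarith

end SpherePoincare

section AnnulusEstimate

open Set Module Measure
open scoped ENNReal NNReal RealInnerProductSpace Topology

variable {E : Type*} [NormedAddCommGroup E] [InnerProductSpace ℝ E] [FiniteDimensional ℝ E]
  [MeasurableSpace E] [BorelSpace E] {m : ℕ}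

/-- The integral of `f` over the sphere of radius `ρ`, in the normalisation of the unit sphere. -/
noncomputable def sphereIntegral (f : E → ℝ) (ρ : ℝ) : ℝ :=
  ∫ θ : sphere (0 : E) 1, f (ρ • (θ : E)) ∂(volume : Measure E).toSphere

theorem Continuous.integrable_toSphere {f : sphere (0 : E) 1 → ℝ} (hf : Continuous f) :
    Integrable f (volume : Measure E).toSphere :=
  hf.integrable_of_hasCompactSupport (HasCompactSupport.of_compactSpace _)

theorem Continuous.sphereIntegral {f : E → ℝ} (hf : Continuous f) :
    Continuous (sphereIntegral f) := by
  have := continuous_parametric_integral_of_continuous (μ := (volume : Measure E).toSphere)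
    (f := fun (ρ : ℝ) (θ : sphere (0 : E) 1) ↦ f (ρ • (θ : E)))
    (by unfold Function.uncurry; fun_prop) (isCompact_univ (X := sphere (0 : E) 1))
  simp only [Measure.restrict_univ] at this
  exact this

theorem hasDerivAt_sphereIntegral {f : E → ℝ} (hf : ContDiff ℝ 1 f) (ρ : ℝ) :
    HasDerivAt (sphereIntegral f)
      (∫ θ : sphere (0 : E) 1, fderiv ℝ f (ρ • (θ : E)) θ ∂(volume : Measure E).toSphere) ρ := by
  have hfc : Continuous (fderiv ℝ f) := hf.continuous_fderiv one_ne_zero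
  have hF' : Continuous fun p : ℝ × sphere (0 : E) 1 ↦ fderiv ℝ f (p.1 • (p.2 : E)) p.2 :=
    (hfc.comp (by fun_prop)).clm_apply (by fun_prop)
  obtain ⟨C, hC⟩ := ((isCompact_closedBall ρ 1).prod
    (isCompact_univ (X := sphere (0 : E) 1))).exists_bound_of_continuousOn hF'.continuousOn
  refine (hasDerivAt_integral_of_dominated_loc_of_deriv_le (bound := fun _ ↦ C)
    (F' := fun ρ (θ : sphere (0 : E) 1) ↦ fderiv ℝ f (ρ • (θ : E)) θ)
    (closedBall_mem_nhds ρ one_pos) ?_ ?_ ?_ ?_ (integrable_const _) ?_).2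
  · exact Filter.Eventually.of_forall fun t ↦
      (hf.continuous.comp (by fun_prop)).aestronglyMeasurable
  · exact Continuous.integrable_toSphere (hf.continuous.comp (by fun_prop))
  · exact (hF'.comp (by fun_prop : Continuous fun θ : sphere (0 : E) 1 ↦ (ρ, θ))).aestronglyMeasurable
  · exact ae_of_all _ fun θ t ht ↦ hC (t, θ) ⟨ht, mem_univ _⟩
  · refine ae_of_all _ fun θ t _ ↦ ?_
    have h1 : HasDerivAt (fun s : ℝ ↦ s • (θ : E)) (θ : E) t := by
      simpa using (hasDerivAt_id t).smul_const (θ : E)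
    exact ((hf.differentiable one_ne_zero) _).hasFDerivAt.comp_hasDerivAt t h1

theorem setIntegral_annulus (hE : finrank ℝ E = m + 1) {f : E → ℝ} (hf : Continuous f)
    (hf0 : ∀ x, 0 ≤ f x) {r R : ℝ} (hr : 0 < r) (hR : r ≤ R) :
    ∫ x in ball (0 : E) R \ closedBall 0 r, f x = ∫ ρ in r..R, ρ ^ m * sphereIntegral f ρ := by
  set A : Set E := ball (0 : E) R \ closedBall 0 r with hA
  have hAm : MeasurableSet A := measurableSet_ball.diff measurableSet_closedBall
  have hAi : IntegrableOn f A := (hf.integrableOn_of_isCompact (isCompact_closedBall (0 : E) R)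
    (isCompact_closedBall (0 : E) R).measure_lt_top.ne).mono_set
    (sdiff_subset.trans ball_subset_closedBall)
  have hS0 (ρ : ℝ) : 0 ≤ sphereIntegral f ρ := integral_nonneg fun θ ↦ hf0 _
  have hSc : Continuous fun ρ ↦ ρ ^ m * sphereIntegral f ρ :=
    (continuous_pow m).mul hf.sphereIntegral
  have hfm : Measurable fun x ↦ A.indicator (fun x ↦ ENNReal.ofReal (f x)) x :=
    hf.measurable.ennreal_ofReal.indicator hAm
  have hmem (ρ : ℝ) (hρ : 0 < ρ) (θ : sphere (0 : E) 1) : ρ • (θ : E) ∈ A ↔ ρ ∈ Ioo r R := by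
    simp [hA, norm_smul, abs_of_pos hρ, and_comm]
  rw [intervalIntegral.integral_of_le hR, integral_Ioc_eq_integral_Ioo]
  have hInt : IntegrableOn (fun ρ ↦ ρ ^ m * sphereIntegral f ρ) (Ioo r R) :=
    hSc.integrableOn_Icc.mono_set Ioo_subset_Icc_self
  rw [← ENNReal.ofReal_eq_ofReal_iff (setIntegral_nonneg hAm fun x _ ↦ hf0 x)
    (setIntegral_nonneg measurableSet_Ioo fun ρ hρ ↦
      mul_nonneg (pow_nonneg (hr.trans hρ.1).le _) (hS0 ρ)),
    ofReal_integral_eq_lintegral_ofReal hAi (ae_of_all _ hf0),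
    ofReal_integral_eq_lintegral_ofReal hInt
      ((ae_restrict_iff' measurableSet_Ioo).2 (ae_of_all _ fun ρ hρ ↦
      mul_nonneg (pow_nonneg (hr.trans hρ.1).le _) (hS0 ρ))),
    ← lintegral_indicator hAm, lintegral_eq_lintegral_polar hE hfm, lintegral_lintegral_swap]
  · have : Ioi (0 : ℝ) ∩ Ioo r R = Ioo r R :=
      inter_eq_self_of_subset_right fun ρ hρ ↦ hr.trans hρ.1
    rw [← this, inter_comm, ← setLIntegral_indicator measurableSet_Ioo]
    refine setLIntegral_congr_fun measurableSet_Ioi fun ρ hρ ↦ ?_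
    have hρ0 : 0 < ρ := hρ
    by_cases hmemρ : ρ ∈ Ioo r R
    · have hi : Integrable (fun θ : sphere (0 : E) 1 ↦ f (ρ • (θ : E)))
          (volume : Measure E).toSphere :=
        Continuous.integrable_toSphere (hf.comp (by fun_prop))
      rw [indicator_of_mem hmemρ, ENNReal.ofReal_mul (by positivity), sphereIntegral,
        ofReal_integral_eq_lintegral_ofReal hi (ae_of_all _ fun θ ↦ hf0 _), ← lintegral_const_mul']
      · refine lintegral_congr fun θ ↦ ?_
        rw [indicator_of_mem ((hmem ρ hρ0 θ).2 hmemρ)]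
      · exact ENNReal.ofReal_ne_top
    · rw [indicator_of_notMem hmemρ]
      refine (lintegral_congr fun θ ↦ ?_).trans lintegral_zero
      rw [indicator_of_notMem (mt (hmem ρ hρ0 θ).1 hmemρ), mul_zero]
  · refine Measurable.aemeasurable ?_
    have : Continuous fun p : sphere (0 : E) 1 × ℝ ↦ p.2 • (p.1 : E) := by fun_prop
    exact (measurable_snd.pow_const m).ennreal_ofReal.mul (hfm.comp this.measurable)

theorem toSphere_real_univ_pos (hE : finrank ℝ E = m + 1) :
    0 < (volume : Measure E).toSphere.real univ := by
  rw [Measure.toSphere_real_apply_univ, hE]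
  exact mul_pos (by positivity) (ENNReal.toReal_pos (measure_ball_pos _ _ one_pos).ne'
    measure_ball_lt_top.ne)

/-- The sharp Poincaré inequality on the sphere of radius `ρ`, in variance form. -/
theorem sphereIntegral_variance_le (hE : finrank ℝ E = m + 1) (hm : m ≠ 0) {u : E → ℝ}
    (hu : ContDiff ℝ 1 u) {ρ : ℝ} (hρ : 0 < ρ) :
    m / ρ ^ 2 * (sphereIntegral (fun x ↦ u x ^ 2) ρ
        - sphereIntegral u ρ ^ 2 / (volume : Measure E).toSphere.real univ)
      ≤ sphereIntegral (fun x ↦ ‖fderiv ℝ u x‖ ^ 2) ρ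
        - ∫ θ : sphere (0 : E) 1, (fderiv ℝ u (ρ • (θ : E)) θ) ^ 2
          ∂(volume : Measure E).toSphere := by
  have hσ := toSphere_real_univ_pos hE
  set σ := (volume : Measure E).toSphere.real univ with hσdef
  set c := sphereIntegral u ρ / σ with hc
  have hfc : Continuous (fderiv ℝ u) := hu.continuous_fderiv one_ne_zero
  have hi1 : Integrable (fun θ : sphere (0 : E) 1 ↦ u (ρ • (θ : E)))
      (volume : Measure E).toSphere :=
    Continuous.integrable_toSphere (hu.continuous.comp (by fun_prop))
  have hi2 : Integrable (fun θ : sphere (0 : E) 1 ↦ u (ρ • (θ : E)) ^ 2)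
      (volume : Measure E).toSphere :=
    Continuous.integrable_toSphere ((hu.continuous.comp (by fun_prop)).pow 2)
  have hi3 : Integrable (fun θ : sphere (0 : E) 1 ↦ ‖fderiv ℝ u (ρ • (θ : E))‖ ^ 2)
      (volume : Measure E).toSphere :=
    Continuous.integrable_toSphere ((hfc.comp (by fun_prop)).norm.pow 2)
  have hi4 : Integrable (fun θ : sphere (0 : E) 1 ↦ (fderiv ℝ u (ρ • (θ : E)) θ) ^ 2)
      (volume : Measure E).toSphere :=
    Continuous.integrable_toSphere (((hfc.comp (by fun_prop)).clm_apply (by fun_prop)).pow 2)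
  have hv : ContDiff ℝ 1 fun x : E ↦ u (ρ • x) - c := by fun_prop
  have hvd (x : E) : fderiv ℝ (fun x : E ↦ u (ρ • x) - c) x = ρ • fderiv ℝ u (ρ • x) := by
    rw [fderiv_sub_const, fderiv_comp_smul]
  have hv0 : ∫ θ : sphere (0 : E) 1, u (ρ • (θ : E)) - c ∂(volume : Measure E).toSphere = 0 := by
    rw [integral_sub hi1 (integrable_const _), integral_const, smul_eq_mul, hc]
    change sphereIntegral u ρ - σ * _ = 0
    field_simp
    ring
  have key := integral_sphere_sq_le hE hm hv hv0
  simp only [hvd] at key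
  have h1 : ∫ θ : sphere (0 : E) 1, (u (ρ • (θ : E)) - c) ^ 2 ∂(volume : Measure E).toSphere
      = sphereIntegral (fun x ↦ u x ^ 2) ρ - sphereIntegral u ρ ^ 2 / σ := by
    have (θ : sphere (0 : E) 1) : (u (ρ • (θ : E)) - c) ^ 2
      = u (ρ • (θ : E)) ^ 2 - 2 * c * u (ρ • (θ : E)) + c ^ 2 := by ring
    simp only [this]
    have hi5 : Integrable (fun θ : sphere (0 : E) 1 ↦
        u (ρ • (θ : E)) ^ 2 - 2 * c * u (ρ • (θ : E))) (volume : Measure E).toSphere :=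
      hi2.sub (hi1.const_mul _)
    rw [integral_add hi5 (integrable_const _), integral_sub hi2 (hi1.const_mul _), integral_const_mul, integral_const, smul_eq_mul]
    change sphereIntegral (fun x ↦ u x ^ 2) ρ - 2 * c * sphereIntegral u ρ + σ * c ^ 2 = _
    rw [hc]
    field_simp
    ring
  have h2 : ∫ θ : sphere (0 : E) 1, ‖ρ • fderiv ℝ u (ρ • (θ : E))‖ ^ 2
        - ((ρ • fderiv ℝ u (ρ • (θ : E))) θ) ^ 2 ∂(volume : Measure E).toSphere
      = ρ ^ 2 * (sphereIntegral (fun x ↦ ‖fderiv ℝ u x‖ ^ 2) ρ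
        - ∫ θ : sphere (0 : E) 1, (fderiv ℝ u (ρ • (θ : E)) θ) ^ 2
          ∂(volume : Measure E).toSphere) := by
    rw [sphereIntegral, ← integral_sub hi3 hi4, ← integral_const_mul]
    refine integral_congr_ae (ae_of_all _ fun θ ↦ ?_)
    simp only [norm_smul, _root_.smul_apply, smul_eq_mul, norm_of_nonneg hρ.le]
    ring
  rw [h1, h2] at key
  rw [div_mul_eq_mul_div, div_le_iff₀ (by positivity)]
  linarith

/-- The logarithmic derivative of the radial part `ρ + r ^ (m + 1) / (m * ρ ^ m)` of the first
eigenfunctions of an annulus with inner radius `r`. -/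
noncomputable def radialLogDeriv (m : ℕ) (r ρ : ℝ) : ℝ :=
  m * (ρ ^ (m + 1) - r ^ (m + 1)) / (ρ * (m * ρ ^ (m + 1) + r ^ (m + 1)))

theorem hasDerivAt_radialLogDeriv {m : ℕ} {r ρ : ℝ} (hr : 0 < r) (hρ : 0 < ρ) :
    HasDerivAt (radialLogDeriv m r)
      (m / ρ ^ 2 - radialLogDeriv m r ρ ^ 2 - m * radialLogDeriv m r ρ / ρ) ρ := by
  have hd : ρ * (m * ρ ^ (m + 1) + r ^ (m + 1)) ≠ 0 := by positivity
  have hd' : m * ρ ^ (m + 1) + r ^ (m + 1) ≠ 0 := by positivity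
  have h1 : HasDerivAt (fun ρ : ℝ ↦ ρ ^ (m + 1)) ((m + 1) * ρ ^ m) ρ := by
    simpa using hasDerivAt_pow (m + 1) ρ
  have h2 := ((h1.sub_const (r ^ (m + 1))).const_mul (m : ℝ)).div
    ((hasDerivAt_id ρ).mul ((h1.const_mul (m : ℝ)).add_const (r ^ (m + 1)))) hd
  refine h2.congr_deriv ?_
  simp only [radialLogDeriv, Pi.mul_apply, id]
  field_simp
  ring

theorem radialLogDeriv_self (m : ℕ) (r : ℝ) : radialLogDeriv m r r = 0 := by
  simp [radialLogDeriv]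

theorem hasDerivAt_pow_mul_radialLogDeriv {m : ℕ} {r ρ : ℝ} (hr : 0 < r) (hρ : 0 < ρ) :
    HasDerivAt (fun ρ ↦ ρ ^ m * radialLogDeriv m r ρ)
      (ρ ^ m * (m / ρ ^ 2 - radialLogDeriv m r ρ ^ 2)) ρ := by
  refine ((hasDerivAt_pow m ρ).mul (hasDerivAt_radialLogDeriv hr hρ)).congr_deriv ?_
  rcases m with _ | m
  · simp
  · simp only [Nat.add_sub_cancel]
    field_simp
    ring

/-- Lower bound for the Dirichlet energy on an annulus. -/
theorem pow_mul_radialLogDeriv_mul_variance_le (hE : finrank ℝ E = m + 1) (hm : m ≠ 0)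
    {u : E → ℝ} (hu : ContDiff ℝ 1 u) {r R : ℝ} (hr : 0 < r) (hR : r ≤ R) :
    R ^ m * radialLogDeriv m r R * (sphereIntegral (fun x ↦ u x ^ 2) R
        - sphereIntegral u R ^ 2 / (volume : Measure E).toSphere.real univ)
      ≤ ∫ x in ball (0 : E) R \ closedBall 0 r, ‖fderiv ℝ u x‖ ^ 2 := by
  have hσ := toSphere_real_univ_pos hE
  have hfc : Continuous (fderiv ℝ u) := hu.continuous_fderiv one_ne_zero
  rw [setIntegral_annulus hE (f := fun x ↦ ‖fderiv ℝ u x‖ ^ 2) (hfc.norm.pow 2) (fun x ↦ by positivity) hr hR]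
  set σ := (volume : Measure E).toSphere.real univ with hσdef
  let T : ℝ → ℝ := fun ρ ↦ sphereIntegral (fun x ↦ u x ^ 2) ρ - sphereIntegral u ρ ^ 2 / σ
  let P : ℝ → ℝ := fun ρ ↦ ∫ θ : sphere (0 : E) 1, fderiv ℝ u (ρ • (θ : E)) θ
    ∂(volume : Measure E).toSphere
  let Q : ℝ → ℝ := fun ρ ↦ ∫ θ : sphere (0 : E) 1, u (ρ • (θ : E)) * fderiv ℝ u (ρ • (θ : E)) θ
    ∂(volume : Measure E).toSphere
  have hT (ρ : ℝ) : HasDerivAt T (2 * Q ρ - 2 * sphereIntegral u ρ * P ρ / σ) ρ := by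
    have h1 := hasDerivAt_sphereIntegral (hu.pow 2) ρ
    have h2 := ((hasDerivAt_sphereIntegral hu ρ).pow 2).div_const σ
    refine (h1.sub h2).congr_deriv ?_
    congr 1
    · rw [← integral_const_mul]
      refine integral_congr_ae (ae_of_all _ fun θ ↦ ?_)
      have := (((hu.differentiable one_ne_zero) (ρ • (θ : E))).hasFDerivAt.pow 2).fderiv
      simp only
      rw [this]
      simp
      ring
    · simp [P]
  have hmain := intervalIntegral.sub_le_integral_of_hasDeriv_right_of_le
    (g := fun ρ ↦ ρ ^ m * radialLogDeriv m r ρ * T ρ)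
    (φ := fun ρ ↦ ρ ^ m * sphereIntegral (fun x ↦ ‖fderiv ℝ u x‖ ^ 2) ρ) hR
    (fun ρ hρ ↦ ((hasDerivAt_pow_mul_radialLogDeriv hr (hr.trans_le hρ.1)).mul
      (hT ρ)).continuousAt.continuousWithinAt)
    (fun ρ hρ ↦ ((hasDerivAt_pow_mul_radialLogDeriv hr (hr.trans hρ.1)).mul
      (hT ρ)).hasDerivWithinAt)
    (((continuous_pow m).mul (hfc.norm.pow 2).sphereIntegral).integrableOn_Icc)
    (fun ρ hρ ↦ ?_)
  · simpa only [radialLogDeriv_self, mul_zero, zero_mul, sub_zero] using hmain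
  · have hρ0 : 0 < ρ := hr.trans hρ.1
    set φ := radialLogDeriv m r ρ
    have hi1 : Integrable (fun θ : sphere (0 : E) 1 ↦ u (ρ • (θ : E)))
        (volume : Measure E).toSphere :=
      Continuous.integrable_toSphere (hu.continuous.comp (by fun_prop))
    have hi2 : Integrable (fun θ : sphere (0 : E) 1 ↦ u (ρ • (θ : E)) ^ 2)
        (volume : Measure E).toSphere :=
      Continuous.integrable_toSphere ((hu.continuous.comp (by fun_prop)).pow 2)
    have hdc : Continuous fun θ : sphere (0 : E) 1 ↦ fderiv ℝ u (ρ • (θ : E)) θ :=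
      (hfc.comp (by fun_prop)).clm_apply (by fun_prop)
    have hi3 := Continuous.integrable_toSphere hdc
    have hi4 : Integrable (fun θ : sphere (0 : E) 1 ↦ (fderiv ℝ u (ρ • (θ : E)) θ) ^ 2)
        (volume : Measure E).toSphere := Continuous.integrable_toSphere (hdc.pow 2)
    have hi5 : Integrable (fun θ : sphere (0 : E) 1 ↦
        u (ρ • (θ : E)) * fderiv ℝ u (ρ • (θ : E)) θ) (volume : Measure E).toSphere :=
      Continuous.integrable_toSphere ((hu.continuous.comp (by fun_prop)).mul hdc)
    have hpoin := sphereIntegral_variance_le hE hm hu hρ0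
    rw [← hσdef] at hpoin
    set c := sphereIntegral u ρ / σ with hc
    have hsq : 0 ≤ ∫ θ : sphere (0 : E) 1,
        (fderiv ℝ u (ρ • (θ : E)) θ - φ * (u (ρ • (θ : E)) - c)) ^ 2
          ∂(volume : Measure E).toSphere := integral_nonneg fun θ ↦ sq_nonneg _
    have hexp (θ : sphere (0 : E) 1) :
        (fderiv ℝ u (ρ • (θ : E)) θ - φ * (u (ρ • (θ : E)) - c)) ^ 2
        = (fderiv ℝ u (ρ • (θ : E)) θ) ^ 2
          - 2 * φ * (u (ρ • (θ : E)) * fderiv ℝ u (ρ • (θ : E)) θ)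
          + 2 * φ * c * fderiv ℝ u (ρ • (θ : E)) θ + φ ^ 2 * u (ρ • (θ : E)) ^ 2
          - 2 * φ ^ 2 * c * u (ρ • (θ : E)) + φ ^ 2 * c ^ 2 := by ring
    simp only [hexp] at hsq
    have a1 := hi4.sub (hi5.const_mul (2 * φ))
    have a2 := a1.add (hi3.const_mul (2 * φ * c))
    have a3 := a2.add (hi2.const_mul (φ ^ 2))
    have a4 := a3.sub (hi1.const_mul (2 * φ ^ 2 * c))
    simp only [Pi.sub_def, Pi.add_def] at a1 a2 a3 a4
    rw [integral_add a4 (integrable_const _), integral_sub a3 (hi1.const_mul _),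
      integral_add a2 (hi2.const_mul _), integral_add a1 (hi3.const_mul _),
      integral_sub hi4 (hi5.const_mul _)] at hsq
    simp only [integral_const_mul, integral_const, smul_eq_mul] at hsq
    change 0 ≤ _ - 2 * φ * Q ρ + 2 * φ * c * P ρ
      + φ ^ 2 * sphereIntegral (fun x ↦ u x ^ 2) ρ - 2 * φ ^ 2 * c * sphereIntegral u ρ
      + φ ^ 2 * (σ * c ^ 2) at hsq
    have hmc : sphereIntegral u ρ = σ * c := by
      rw [hc]
      field_simp
    have hTρ : T ρ = sphereIntegral (fun x ↦ u x ^ 2) ρ - σ * c ^ 2 := by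
      simp only [T, hmc]
      field_simp
    have hcc : 2 * sphereIntegral u ρ * P ρ / σ = 2 * c * P ρ := by
      rw [hc]
      ring
    have hTρ' : sphereIntegral (fun x ↦ u x ^ 2) ρ - sphereIntegral u ρ ^ 2 / σ = T ρ := rfl
    rw [hTρ'] at hpoin
    rw [hmc] at hsq
    rw [hcc, mul_assoc (ρ ^ m), mul_assoc (ρ ^ m), ← mul_add]
    refine mul_le_mul_of_nonneg_left ?_ (by positivity)
    nlinarith [hpoin, hsq, hTρ]

end AnnulusEstimate

section SphereOfRadius

open Set Module Measure
open scoped ENNReal NNReal RealInnerProductSpace Topology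

variable {E : Type*} [NormedAddCommGroup E] [InnerProductSpace ℝ E] [FiniteDimensional ℝ E]
  [MeasurableSpace E] [BorelSpace E] {m : ℕ}

omit [FiniteDimensional ℝ E] [MeasurableSpace E] [BorelSpace E] in
theorem image_smul_univ_unitSphere {R : ℝ} (hR : 0 < R) :
    (fun θ : sphere (0 : E) 1 ↦ R • (θ : E)) '' univ = sphere 0 R := by
  ext x
  simp only [image_univ, mem_range, mem_sphere_zero_iff_norm, Subtype.exists, exists_prop]
  constructor
  · rintro ⟨θ, hθ, rfl⟩
    rw [norm_smul, hθ, norm_of_nonneg hR.le, mul_one]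
  · intro hx
    refine ⟨R⁻¹ • x, ?_, smul_inv_smul₀ hR.ne' x⟩
    rw [norm_smul, hx, norm_of_nonneg (inv_nonneg.2 hR.le), inv_mul_cancel₀ hR.ne']

theorem restrict_sphere_euclideanHausdorffMeasure (hE : finrank ℝ E = m + 1) {R : ℝ}
    (hR : 0 < R) : (μHE[m] : Measure E).restrict (sphere 0 R) = ENNReal.ofReal (R ^ m)
      • (volume : Measure E).toSphere.map (fun θ : sphere (0 : E) 1 ↦ R • (θ : E)) := by
  have hc : Continuous fun θ : sphere (0 : E) 1 ↦ R • (θ : E) := by fun_prop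
  ext s hs
  rw [Measure.restrict_apply hs, Measure.smul_apply, Measure.map_apply hc.measurable hs,
    smul_eq_mul, IsPointedConvexDomain.pow_mul_toSphere hE hR, image_preimage_eq_inter_range,
    ← image_univ, image_smul_univ_unitSphere hR]

theorem setIntegral_sphere_euclideanHausdorffMeasure (hE : finrank ℝ E = m + 1) {R : ℝ}
    (hR : 0 < R) {f : E → ℝ} (hf : Continuous f) :
    ∫ x in sphere 0 R, f x ∂μHE[m] = R ^ m * sphereIntegral f R := by
  have hc : Continuous fun θ : sphere (0 : E) 1 ↦ R • (θ : E) := by fun_prop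
  rw [restrict_sphere_euclideanHausdorffMeasure hE hR, integral_smul_measure,
    integral_map hc.measurable.aemeasurable hf.aestronglyMeasurable,
    ENNReal.toReal_ofReal (by positivity), smul_eq_mul, sphereIntegral]

theorem radialLogDeriv_mul_setIntegral_sphere_le (hE : finrank ℝ E = m + 1) (hm : m ≠ 0)
    {u : E → ℝ} (hu : ContDiff ℝ 1 u) {r R : ℝ} (hr : 0 < r) (hR : r ≤ R)
    (hu0 : ∫ x in sphere 0 R, u x ∂μHE[m] = 0) :
    radialLogDeriv m r R * ∫ x in sphere 0 R, u x ^ 2 ∂μHE[m]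
      ≤ ∫ x in ball (0 : E) R \ closedBall 0 r, ‖fderiv ℝ u x‖ ^ 2 := by
  have hR0 := hr.trans_le hR
  rw [setIntegral_sphere_euclideanHausdorffMeasure hE hR0 hu.continuous] at hu0
  have hu1 := (mul_eq_zero.1 hu0).resolve_left (by positivity)
  rw [setIntegral_sphere_euclideanHausdorffMeasure hE hR0 (f := fun x ↦ u x ^ 2)
    (hu.continuous.pow 2)]
  have := pow_mul_radialLogDeriv_mul_variance_le hE hm hu hr hR
  rw [hu1] at this
  simp only [ne_eq, OfNat.ofNat_ne_zero, not_false_eq_true, zero_pow, zero_div, sub_zero] at this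
  linarith

theorem sphereIntegral_inner (hE : finrank ℝ E = m + 1) (a : E) (R : ℝ) :
    sphereIntegral (fun x : E ↦ ⟪a, x⟫) R = 0 := by
  have h1 := integral_separated_polar hE (fun x : E ↦ ⟪a, x⟫) fun r ↦ r * exp (-(r ^ 2 / 2))
  have h2 : ∫ r in Ioi (0 : ℝ), r ^ m * (r * exp (-(r ^ 2 / 2))) = gaussianMoment (m + 1) := by
    simp only [← mul_assoc, ← pow_succ, gaussianMoment]
  have h3 := integral_neg_eq_self
    (fun x : E ↦ ⟪a, ‖x‖⁻¹ • x⟫ * (‖x‖ * exp (-(‖x‖ ^ 2 / 2)))) volume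
  simp only [norm_neg, smul_neg, inner_neg_right, neg_mul, integral_neg] at h3
  rw [h2, show ∫ x : E, ⟪a, ‖x‖⁻¹ • x⟫ * (‖x‖ * exp (-(‖x‖ ^ 2 / 2))) = 0 by linarith] at h1
  have h4 := (mul_eq_zero.1 h1.symm).resolve_right (gaussianMoment_pos _).ne'
  simp only [sphereIntegral, inner_smul_right, integral_const_mul, h4, mul_zero]

theorem sphereIntegral_inner_sq_ne_zero (hE : finrank ℝ E = m + 1) {a : E} (ha : a ≠ 0) {R : ℝ}
    (hR : 0 < R) : sphereIntegral (fun x : E ↦ ⟪a, x⟫ ^ 2) R ≠ 0 := by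
  intro h0
  simp only [sphereIntegral, inner_smul_right, mul_pow, integral_const_mul] at h0
  have h1 := (mul_eq_zero.1 h0).resolve_left (by positivity)
  have h2 := integral_separated_polar hE (fun x : E ↦ ⟪a, x⟫ ^ 2) fun r ↦
    r ^ 2 * exp (-(r ^ 2 / 2))
  rw [h1, zero_mul] at h2
  have h3 := integral_inner_sq_mul_exp hE a
  have h4 : ∫ x : E, ⟪a, ‖x‖⁻¹ • x⟫ ^ 2 * (‖x‖ ^ 2 * exp (-(‖x‖ ^ 2 / 2)))
      = ∫ x : E, ⟪a, x⟫ ^ 2 * exp (-(‖x‖ ^ 2 / 2)) := by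
    refine integral_congr_ae (ae_of_all _ fun x ↦ ?_)
    rcases eq_or_ne x 0 with rfl | hx
    · simp
    · have : ‖x‖ ≠ 0 := norm_ne_zero_iff.2 hx
      simp only [inner_smul_right]
      field_simp
  rw [← h4, h2] at h3
  have := toSphere_real_univ_pos hE
  have := gaussianMoment_pos m
  have : 0 < ‖a‖ := norm_pos_iff.2 ha
  exact absurd h3 (by positivity)

theorem tendsto_radialLogDeriv_zero (m : ℕ) {R : ℝ} (hR : 0 < R) (hm : m ≠ 0) :
    Filter.Tendsto (fun r ↦ radialLogDeriv m r R) (𝓝 0) (𝓝 R⁻¹) := by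
  have hm' : (0 : ℝ) < m := by positivity
  have : ContinuousAt (fun r ↦ radialLogDeriv m r R) 0 := by
    unfold radialLogDeriv
    refine ContinuousAt.div (by fun_prop) (by fun_prop) ?_
    simp only [ne_eq, Nat.add_eq_zero_iff, one_ne_zero, and_false, not_false_eq_true, zero_pow]
    positivity
  have h0 : radialLogDeriv m 0 R = R⁻¹ := by
    simp only [radialLogDeriv, ne_eq, Nat.add_eq_zero_iff, one_ne_zero, and_false,
      not_false_eq_true, zero_pow]
    field_simp
    ring
  simpa only [ContinuousAt, h0] using this

end SphereOfRadius

section SteklovNeumann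

open Set Module Measure
open scoped ENNReal NNReal RealInnerProductSpace Topology

/-- The ratio between the normalised and the standard Hausdorff measure of dimension `m`. -/
noncomputable def hausdorffNormalization (m : ℕ) : ℝ :=
  (addHaarScalarFactor (volume : Measure (EuclideanSpace ℝ (Fin m))) μH[m] : ℝ≥0)

theorem hausdorffNormalization_pos (m : ℕ) : 0 < hausdorffNormalization m :=
  NNReal.coe_pos.2 (pos_iff_ne_zero.2 (addHaarScalarFactor_volume_hausdorffMeasure_ne_zero m))

variable {m : ℕ} {Ω Γ : Set (EuclideanSpace ℝ (Fin (m + 1)))}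

theorem setIntegral_euclideanHausdorffMeasure (f : EuclideanSpace ℝ (Fin (m + 1)) → ℝ) :
    ∫ x in Γ, f x ∂μHE[m]
      = hausdorffNormalization m * ∫ x in Γ, f x ∂μH[((m + 1 : ℕ) : ℝ) - 1] := by
  have hcast : ((m + 1 : ℕ) : ℝ) - 1 = m := by push_cast; ring
  rw [hcast, euclideanHausdorffMeasure_def, Measure.restrict_smul, integral_smul_nnreal_measure]
  rfl

theorem steklovNeumannMu1_le {u : EuclideanSpace ℝ (Fin (m + 1)) → ℝ} (hu : ContDiff ℝ 1 u)
    (hu0 : ∫ x in Γ, u x ∂μHE[m] = 0) (hu1 : ∫ x in Γ, u x ^ 2 ∂μHE[m] ≠ 0) :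
    steklovNeumannMu1 Ω Γ ≤ hausdorffNormalization m
      * ((∫ x in Ω, ‖fderiv ℝ u x‖ ^ 2) / ∫ x in Γ, u x ^ 2 ∂μHE[m]) := by
  have hκ := hausdorffNormalization_pos m
  rw [setIntegral_euclideanHausdorffMeasure] at hu0 hu1 ⊢
  refine csInf_le ⟨0, ?_⟩ ⟨u, hu, (mul_eq_zero.1 hu0).resolve_left hκ.ne', right_ne_zero_of_mul hu1,
    ?_⟩
  · rintro _ ⟨v, -, -, -, rfl⟩
    exact div_nonneg (integral_nonneg fun x ↦ by positivity)
      (integral_nonneg fun x ↦ by positivity)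
  · have := right_ne_zero_of_mul hu1
    field_simp

theorem le_steklovNeumannMu1 {t : ℝ} (hne : ∃ u : EuclideanSpace ℝ (Fin (m + 1)) → ℝ,
      ContDiff ℝ 1 u ∧ ∫ x in Γ, u x ∂μHE[m] = 0 ∧ ∫ x in Γ, u x ^ 2 ∂μHE[m] ≠ 0)
    (h : ∀ u : EuclideanSpace ℝ (Fin (m + 1)) → ℝ, ContDiff ℝ 1 u →
      ∫ x in Γ, u x ∂μHE[m] = 0 →
        t * ∫ x in Γ, u x ^ 2 ∂μHE[m] ≤ ∫ x in Ω, ‖fderiv ℝ u x‖ ^ 2) :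
    hausdorffNormalization m * t ≤ steklovNeumannMu1 Ω Γ := by
  have hκ := hausdorffNormalization_pos m
  refine le_csInf ?_ ?_
  · obtain ⟨u, hu, hu0, hu1⟩ := hne
    rw [setIntegral_euclideanHausdorffMeasure] at hu0 hu1
    exact ⟨_, u, hu, (mul_eq_zero.1 hu0).resolve_left hκ.ne', right_ne_zero_of_mul hu1, rfl⟩
  · rintro _ ⟨u, hu, hu0, hu1, rfl⟩
    have h1 := h u hu (by rw [setIntegral_euclideanHausdorffMeasure, hu0, mul_zero])
    rw [setIntegral_euclideanHausdorffMeasure] at h1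
    rw [le_div_iff₀ (lt_of_le_of_ne (integral_nonneg fun x ↦ by positivity) hu1.symm)]
    linarith

theorem exists_mean_zero_on_sphere {R : ℝ} (hR : 0 < R) :
    ∃ u : EuclideanSpace ℝ (Fin (m + 1)) → ℝ, ContDiff ℝ 1 u ∧
      ∫ x in sphere 0 R, u x ∂μHE[m] = 0 ∧ ∫ x in sphere 0 R, u x ^ 2 ∂μHE[m] ≠ 0 := by
  have hE : finrank ℝ (EuclideanSpace ℝ (Fin (m + 1))) = m + 1 := finrank_euclideanSpace_fin
  have hnt : Nontrivial (EuclideanSpace ℝ (Fin (m + 1))) :=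
    nontrivial_of_finrank_pos (R := ℝ) (by omega)
  obtain ⟨a, ha⟩ := exists_ne (0 : EuclideanSpace ℝ (Fin (m + 1)))
  refine ⟨fun x ↦ ⟪a, x⟫, contDiff_const.inner ℝ contDiff_id, ?_, ?_⟩
  · rw [setIntegral_sphere_euclideanHausdorffMeasure hE hR (by fun_prop),
      sphereIntegral_inner hE, mul_zero]
  · rw [setIntegral_sphere_euclideanHausdorffMeasure hE hR (by fun_prop)]
    exact mul_ne_zero (by positivity) (sphereIntegral_inner_sq_ne_zero hE ha hR)

end SteklovNeumann

/-- Isoperimetric inequality under a perimeter constraint for small holes: if `Ω_out` is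
open, bounded, convex and not a ball, and `B_{R_P}` has the same perimeter as `Ω_out`,
then for all sufficiently small `r > 0` the first nonzero Steklov–Neumann eigenvalue of
`Ω_out \ B̄_r` is (strictly) smaller than that of the annulus `B_{R_P} \ B̄_r`. -/
theorem stmt19 (n : ℕ) (hn : 2 ≤ n) (Ωout : Set (EuclideanSpace ℝ (Fin n)))
    (hopen : IsOpen Ωout) (hbdd : Bornology.IsBounded Ωout) (hconv : Convex ℝ Ωout)
    (h0 : (0 : EuclideanSpace ℝ (Fin n)) ∈ Ωout)
    (hnotball : ∀ (c : EuclideanSpace ℝ (Fin n)) (R : ℝ), Ωout ≠ ball c R)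
    (RP : ℝ) (hRP : 0 < RP)
    (hperim : μH[(n : ℝ) - 1] (frontier Ωout)
      = μH[(n : ℝ) - 1] (sphere (0 : EuclideanSpace ℝ (Fin n)) RP)) :
    ∃ r2P : ℝ, 0 < r2P ∧ ∀ r : ℝ, 0 < r → r < r2P →
      steklovNeumannMu1 (Ωout \ closedBall 0 r) (frontier Ωout)
        < steklovNeumannMu1 (ball (0 : EuclideanSpace ℝ (Fin n)) RP \ closedBall 0 r)
            (sphere (0 : EuclideanSpace ℝ (Fin n)) RP) := by
  obtain ⟨m, rfl⟩ : ∃ m, n = m + 1 := ⟨n - 1, by omega⟩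
  have hm : m ≠ 0 := by omega
  have hE : Module.finrank ℝ (EuclideanSpace ℝ (Fin (m + 1))) = m + 1 :=
    finrank_euclideanSpace_fin
  have hΩ : IsPointedConvexDomain Ωout := ⟨hopen, hbdd, hconv, h0⟩
  have hper : (μHE[m] : Measure (EuclideanSpace ℝ (Fin (m + 1)))) (frontier Ωout)
      = ENNReal.ofReal (RP ^ m)
        * (volume : Measure (EuclideanSpace ℝ (Fin (m + 1)))).toSphere Set.univ := by
    have hcast : ((m + 1 : ℕ) : ℝ) - 1 = m := by push_cast; ring
    rw [hcast] at hperim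
    rw [IsPointedConvexDomain.pow_mul_toSphere hE hRP, image_smul_univ_unitSphere hRP,
      Measure.euclideanHausdorffMeasure_def, Measure.smul_apply, Measure.smul_apply, hperim]
  obtain ⟨u, hu, hu0, hlt⟩ := hΩ.exists_test_function hE hm hRP hper hnotball
  have hΩi : IntegrableOn (fun x ↦ ‖fderiv ℝ u x‖ ^ 2) Ωout :=
    (((hu.continuous_fderiv one_ne_zero).norm.pow 2).integrableOn_of_isCompact
      hbdd.isCompact_closure hbdd.isCompact_closure.measure_lt_top.ne).mono_set subset_closure
  have hΩ0 : 0 ≤ ∫ x in Ωout, ‖fderiv ℝ u x‖ ^ 2 := integral_nonneg fun x ↦ by positivity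
  have hΓ : 0 < ∫ x in frontier Ωout, u x ^ 2 ∂μHE[m] := (mul_nonneg hRP.le hΩ0).trans_lt hlt
  have hratio : (∫ x in Ωout, ‖fderiv ℝ u x‖ ^ 2) / ∫ x in frontier Ωout, u x ^ 2 ∂μHE[m]
      < RP⁻¹ := by
    rw [div_lt_iff₀ hΓ, inv_mul_eq_div, lt_div_iff₀ hRP, mul_comm]
    exact hlt
  obtain ⟨ε, hε, hεr⟩ := Metric.eventually_nhds_iff.1
    ((tendsto_radialLogDeriv_zero m hRP hm).eventually_const_lt hratio)
  refine ⟨min ε RP, lt_min hε hRP, fun r hr hrlt ↦ ?_⟩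
  have hκ := hausdorffNormalization_pos m
  calc steklovNeumannMu1 (Ωout \ closedBall 0 r) (frontier Ωout)
      ≤ hausdorffNormalization m * ((∫ x in Ωout \ closedBall 0 r, ‖fderiv ℝ u x‖ ^ 2)
        / ∫ x in frontier Ωout, u x ^ 2 ∂μHE[m]) := steklovNeumannMu1_le hu hu0 hΓ.ne'
    _ ≤ hausdorffNormalization m * ((∫ x in Ωout, ‖fderiv ℝ u x‖ ^ 2)
        / ∫ x in frontier Ωout, u x ^ 2 ∂μHE[m]) := by
        refine mul_le_mul_of_nonneg_left (div_le_div_of_nonneg_right ?_ hΓ.le) hκ.le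
        exact setIntegral_mono_set hΩi (ae_of_all _ fun x ↦ by positivity)
          Set.sdiff_subset.eventuallyLE
    _ < hausdorffNormalization m * radialLogDeriv m r RP := by
        refine mul_lt_mul_of_pos_left (hεr ?_) hκ
        rw [dist_zero_right, norm_of_nonneg hr.le]
        exact hrlt.trans_le (min_le_left _ _)
    _ ≤ steklovNeumannMu1 (ball 0 RP \ closedBall 0 r) (sphere 0 RP) :=
        le_steklovNeumannMu1 (exists_mean_zero_on_sphere hRP) fun v hv hv0 ↦
          radialLogDeriv_mul_setIntegral_sphere_le hE hm hv hr
            (hrlt.le.trans (min_le_right _ _)) hv0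
end
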